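/- Let f ∈ M_p, 1<p<∞, α₁,α₂>0, n₁,n₂ ∈ ℕ. Then ω_{α₁,α₂}(f, 1/n₁, 1/n₂)_p ≍ n₁^{−α₁} n₂^{−α₂} {Σ_{ν₁=1}^{n₁+1} Σ_{ν₂=1}^{n₂+1} ν₁^{α₁p−1} ν₂^{α₂p−1} Y_{ν₁−1,ν₂−1}(f)_p^p}^{1/p}, with constants independent of f, n₁, n₂. -/

import Mathlib

open MeasureTheory Real
open scoped ENNReal

noncomputable section

/-- The `L_p` norm of a function of two variables over the period square `(0,2π]²`. -/
def Lp2Norm (p : ℝ) (f : ℝ → ℝ → ℝ) : ℝ≥0∞ :=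
  (∫⁻ x in Set.Ioc (0:ℝ) (2*π), ∫⁻ y in Set.Ioc (0:ℝ) (2*π),
      ENNReal.ofReal (|f x y| ^ p)) ^ (1/p)

/-- `f ∈ L_p^0(T²)`: measurable, `2π`-periodic in each variable, finite `L_p` norm,
and zero mean in each variable separately. -/
structure MemLp0 (p : ℝ) (f : ℝ → ℝ → ℝ) : Prop where
  meas : Measurable (Function.uncurry f)
  periodic_x : ∀ y, Function.Periodic (fun x => f x y) (2*π)
  periodic_y : ∀ x, Function.Periodic (f x) (2*π)
  norm_ne_top : Lp2Norm p f ≠ ⊤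
  mean_x : ∀ᵐ (y : ℝ) ∂volume, (∫ x in (0:ℝ)..(2*π), f x y) = 0
  mean_y : ∀ᵐ (x : ℝ) ∂volume, (∫ y in (0:ℝ)..(2*π), f x y) = 0

/-- Generalized (fractional) binomial coefficient `C(α,ν) = α(α-1)⋯(α-ν+1)/ν!`. -/
def fracBinom (α : ℝ) : ℕ → ℝ
  | 0 => 1
  | n+1 => fracBinom α n * (α - (n : ℝ)) / ((n : ℝ) + 1)

/-- Fractional difference of order `α` with step `h` in the first variable. -/
def diffX (α h : ℝ) (f : ℝ → ℝ → ℝ) : ℝ → ℝ → ℝ :=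
  fun x y => ∑' ν : ℕ, (-1 : ℝ) ^ ν * fracBinom α ν * f (x + (α - (ν : ℝ)) * h) y

/-- Fractional difference of order `α` with step `h` in the second variable. -/
def diffY (α h : ℝ) (f : ℝ → ℝ → ℝ) : ℝ → ℝ → ℝ :=
  fun x y => ∑' ν : ℕ, (-1 : ℝ) ^ ν * fracBinom α ν * f x (y + (α - (ν : ℝ)) * h)

/-- The mixed (fractional) modulus of smoothness `ω_{α₁,α₂}(f, δ₁, δ₂)_p`. -/
def mixedMod (p α₁ α₂ δ₁ δ₂ : ℝ) (f : ℝ → ℝ → ℝ) : ℝ≥0∞ :=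
  ⨆ (h₁ : ℝ) (_ : |h₁| ≤ δ₁) (h₂ : ℝ) (_ : |h₂| ≤ δ₂),
    Lp2Norm p (diffX α₁ h₁ (diffY α₂ h₂ f))

/-- `T` is (an `L_p(T²)` function which is) a trigonometric polynomial of degree
at most `m` in the first variable. -/
def TrigPolyX (p : ℝ) (m : ℕ) (T : ℝ → ℝ → ℝ) : Prop :=
  Measurable (Function.uncurry T) ∧ Lp2Norm p T ≠ ⊤ ∧
  (∀ x, Function.Periodic (T x) (2*π)) ∧
  ∃ a b : ℕ → ℝ → ℝ, ∀ x y,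
    T x y = ∑ k ∈ Finset.range (m+1),
      (a k y * Real.cos ((k : ℝ) * x) + b k y * Real.sin ((k : ℝ) * x))

/-- `T` is (an `L_p(T²)` function which is) a trigonometric polynomial of degree
at most `m` in the second variable. -/
def TrigPolyY (p : ℝ) (m : ℕ) (T : ℝ → ℝ → ℝ) : Prop :=
  Measurable (Function.uncurry T) ∧ Lp2Norm p T ≠ ⊤ ∧
  (∀ y, Function.Periodic (fun x => T x y) (2*π)) ∧
  ∃ a b : ℕ → ℝ → ℝ, ∀ x y,
    T x y = ∑ k ∈ Finset.range (m+1),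
      (a k x * Real.cos ((k : ℝ) * y) + b k x * Real.sin ((k : ℝ) * y))

/-- The best angular approximation `Y_{m₁,m₂}(f)_p`. -/
def Yapprox (p : ℝ) (m₁ m₂ : ℕ) (f : ℝ → ℝ → ℝ) : ℝ≥0∞ :=
  ⨅ (T₁ : ℝ → ℝ → ℝ) (_ : TrigPolyX p m₁ T₁) (T₂ : ℝ → ℝ → ℝ) (_ : TrigPolyY p m₂ T₂),
    Lp2Norm p (fun x y => f x y - T₁ x y - T₂ x y)

/-- The weighted sum of angular approximations
`n₁^{-α₁} n₂^{-α₂} {Σ_{ν₁=1}^{n₁+1} Σ_{ν₂=1}^{n₂+1} ν₁^{α₁s-1} ν₂^{α₂s-1} Y_{ν₁-1,ν₂-1}(f)_p^s}^{1/s}`. -/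
def Ysum (p α₁ α₂ s : ℝ) (n₁ n₂ : ℕ) (f : ℝ → ℝ → ℝ) : ℝ≥0∞ :=
  ENNReal.ofReal ((n₁:ℝ) ^ (-α₁) * (n₂:ℝ) ^ (-α₂)) *
    (∑ ν₁ ∈ Finset.Icc 1 (n₁+1), ∑ ν₂ ∈ Finset.Icc 1 (n₂+1),
      ENNReal.ofReal ((ν₁:ℝ) ^ (α₁*s-1) * (ν₂:ℝ) ^ (α₂*s-1)) *
        Yapprox p (ν₁-1) (ν₂-1) f ^ s) ^ (1/s)

/-- Cosine-cosine Fourier coefficient `a_{n₁,n₂}` of `f`. -/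
def fourierCC (f : ℝ → ℝ → ℝ) (n₁ n₂ : ℕ) : ℝ :=
  (1/π^2) * ∫ x in (0:ℝ)..(2*π), ∫ y in (0:ℝ)..(2*π),
    f x y * Real.cos ((n₁ : ℝ) * x) * Real.cos ((n₂ : ℝ) * y)

/-- Sine-cosine Fourier coefficient `b_{n₁,n₂}` of `f`. -/
def fourierSC (f : ℝ → ℝ → ℝ) (n₁ n₂ : ℕ) : ℝ :=
  (1/π^2) * ∫ x in (0:ℝ)..(2*π), ∫ y in (0:ℝ)..(2*π),
    f x y * Real.sin ((n₁ : ℝ) * x) * Real.cos ((n₂ : ℝ) * y)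

/-- Cosine-sine Fourier coefficient `c_{n₁,n₂}` of `f`. -/
def fourierCS (f : ℝ → ℝ → ℝ) (n₁ n₂ : ℕ) : ℝ :=
  (1/π^2) * ∫ x in (0:ℝ)..(2*π), ∫ y in (0:ℝ)..(2*π),
    f x y * Real.cos ((n₁ : ℝ) * x) * Real.sin ((n₂ : ℝ) * y)

/-- Sine-sine Fourier coefficient `d_{n₁,n₂}` of `f`. -/
def fourierSS (f : ℝ → ℝ → ℝ) (n₁ n₂ : ℕ) : ℝ :=
  (1/π^2) * ∫ x in (0:ℝ)..(2*π), ∫ y in (0:ℝ)..(2*π),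
    f x y * Real.sin ((n₁ : ℝ) * x) * Real.sin ((n₂ : ℝ) * y)

/-- The class `M_p`: `f ∈ L_p^0(T²)` with a pure cosine-cosine Fourier series
`Σ a_{ν₁,ν₂} cos ν₁x cos ν₂y` whose coefficients have nonnegative mixed differences. -/
def InMclass (p : ℝ) (f : ℝ → ℝ → ℝ) (a : ℕ → ℕ → ℝ) : Prop :=
  MemLp0 p f ∧
  (∀ ν₁ ν₂ : ℕ, 1 ≤ ν₁ → 1 ≤ ν₂ → fourierCC f ν₁ ν₂ = a ν₁ ν₂) ∧
  (∀ n₁ n₂ : ℕ, fourierSC f n₁ n₂ = 0 ∧ fourierCS f n₁ n₂ = 0 ∧ fourierSS f n₁ n₂ = 0) ∧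
  (∀ ν₁ ν₂ : ℕ, 1 ≤ ν₁ → 1 ≤ ν₂ →
    0 ≤ a ν₁ ν₂ - a (ν₁+1) ν₂ - a ν₁ (ν₂+1) + a (ν₁+1) (ν₂+1))

namespace MixedModulus

/-! ### Power sums and Hardy inequalities -/

theorem one_sub_rpow_le {β t : ℝ} (hβ : 0 < β) (h0 : 0 ≤ t) (h1 : t ≤ 1) :
    (1 - t) ^ β ≤ 1 - min 1 β * t := by
  rcases le_total 1 β with h | h
  · rw [min_eq_left h, one_mul]
    calc (1 - t) ^ β ≤ (1 - t) ^ (1 : ℝ) :=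
          Real.rpow_le_rpow_of_exponent_ge' (by linarith) (by linarith) zero_le_one h
      _ = 1 - t := Real.rpow_one _
  · rw [min_eq_right h]
    have := rpow_one_add_le_one_add_mul_self (s := -t) (by linarith) hβ.le h
    calc (1 - t) ^ β = (1 + -t) ^ β := by ring_nf
      _ ≤ 1 + β * -t := this
      _ = _ := by ring

theorem le_one_sub_rpow {β t : ℝ} (hβ : 0 < β) (h0 : 0 ≤ t) (h1 : t ≤ 1) :
    1 - max 1 β * t ≤ (1 - t) ^ β := by
  rcases le_total 1 β with h | h
  · rw [max_eq_right h]
    have := one_add_mul_self_le_rpow_one_add (s := -t) (by linarith) h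
    calc 1 - β * t = 1 + β * -t := by ring
      _ ≤ _ := this
      _ = _ := by ring_nf
  · rw [max_eq_left h, one_mul]
    calc 1 - t = (1 - t) ^ (1 : ℝ) := (Real.rpow_one _).symm
      _ ≤ (1 - t) ^ β := Real.rpow_le_rpow_of_exponent_ge' (by linarith) (by linarith) hβ.le h

theorem sub_one_rpow_eq {β x : ℝ} (hx : 1 ≤ x) :
    (x - 1) ^ β = x ^ β * (1 - 1 / x) ^ β := by
  have : 1 / x ≤ 1 := by rw [div_le_one (by linarith)]; exact hx
  rw [← Real.mul_rpow (by linarith) (by linarith)]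
  congr 1
  field_simp

theorem rpow_sub_one_eq_div {β x : ℝ} (hx : 1 ≤ x) : x ^ (β - 1) = x ^ β * (1 / x) := by
  rw [Real.rpow_sub_one (by linarith)]; ring

theorem sum_rpow_le {β : ℝ} (hβ : 0 < β) (s : ℕ) :
    min 1 β * ∑ i ∈ Finset.range s, ((i : ℝ) + 1) ^ (β - 1) ≤ (s : ℝ) ^ β := by
  induction s with
  | zero => simp [Real.zero_rpow hβ.ne']
  | succ s ih =>
    rw [Finset.sum_range_succ, mul_add]
    have hx : (1 : ℝ) ≤ (s : ℝ) + 1 := by linarith [s.cast_nonneg (α := ℝ)]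
    have h2 : 1 / ((s : ℝ) + 1) ≤ 1 := by rw [div_le_one (by linarith)]; exact hx
    have h := one_sub_rpow_le hβ (t := 1 / ((s : ℝ) + 1)) (by positivity) h2
    have e := sub_one_rpow_eq (β := β) hx
    rw [rpow_sub_one_eq_div hx]
    push_cast
    have hp : 0 ≤ ((s : ℝ) + 1) ^ β := by positivity
    have := mul_le_mul_of_nonneg_left h hp
    rw [← e] at this
    simp only [add_sub_cancel_right] at this
    nlinarith

theorem le_sum_rpow {β : ℝ} (hβ : 0 < β) (s : ℕ) :
    (s : ℝ) ^ β ≤ max 1 β * ∑ i ∈ Finset.range s, ((i : ℝ) + 1) ^ (β - 1) := by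
  induction s with
  | zero => simp [Real.zero_rpow hβ.ne']
  | succ s ih =>
    rw [Finset.sum_range_succ, mul_add]
    have hx : (1 : ℝ) ≤ (s : ℝ) + 1 := by linarith [s.cast_nonneg (α := ℝ)]
    have h2 : 1 / ((s : ℝ) + 1) ≤ 1 := by rw [div_le_one (by linarith)]; exact hx
    have h := le_one_sub_rpow hβ (t := 1 / ((s : ℝ) + 1)) (by positivity) h2
    have e := sub_one_rpow_eq (β := β) hx
    rw [rpow_sub_one_eq_div hx]
    push_cast
    have hp : 0 ≤ ((s : ℝ) + 1) ^ β := by positivity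
    have := mul_le_mul_of_nonneg_left h hp
    rw [← e] at this
    simp only [add_sub_cancel_right] at this
    nlinarith

theorem rpow_neg_tail_step {r x : ℝ} (hr : 0 < r) (hx : 1 ≤ x) :
    min 1 r / 2 * x ^ (-r - 1) ≤ x ^ (-r) - (x + 1) ^ (-r) := by
  have h2 : 1 / (x + 1) ≤ 1 := by rw [div_le_one (by linarith)]; linarith
  have h := one_sub_rpow_le hr (t := 1 / (x + 1)) (by positivity) h2
  have e := sub_one_rpow_eq (β := r) (x := x + 1) (by linarith)
  rw [add_sub_cancel_right] at e
  have hx0 : 0 < x := by linarith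
  have a : 0 < x ^ r := by positivity
  have b : 0 < (x + 1) ^ r := by positivity
  have hr1 : 0 < min 1 r := lt_min one_pos hr
  have ht : 1 / (2 * x) ≤ 1 / (x + 1) := by
    apply one_div_le_one_div_of_le <;> linarith
  have key : x ^ (-r) - (x + 1) ^ (-r) = x ^ (-r) * (1 - (1 - 1 / (x + 1)) ^ r) := by
    rw [Real.rpow_neg hx0.le, Real.rpow_neg (by linarith), mul_sub, mul_one]
    congr 1
    rw [e]
    have hc : 0 < 1 - 1 / (x + 1) := by
      rw [sub_pos, div_lt_one (by linarith)]; linarith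
    have hc' : 0 < (1 - 1 / (x + 1)) ^ r := Real.rpow_pos_of_pos hc r
    rw [mul_inv, mul_assoc, inv_mul_cancel₀ hc'.ne', mul_one]
  rw [key, Real.rpow_sub_one hx0.ne', div_eq_mul_inv (x ^ (-r)) x]
  have hpos : 0 < x ^ (-r) := by positivity
  have : min 1 r / 2 * x⁻¹ ≤ 1 - (1 - 1 / (x + 1)) ^ r := by
    have h3 : min 1 r / 2 * x⁻¹ = min 1 r * (1 / (2 * x)) := by field_simp
    rw [h3]
    nlinarith [mul_le_mul_of_nonneg_left ht hr1.le]
  nlinarith [mul_le_mul_of_nonneg_left this hpos.le]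

theorem sum_rpow_neg_tail_le {r : ℝ} (hr : 0 < r) (N k : ℕ) :
    min 1 r / 2 * ∑ i ∈ Finset.range k, (((N + i : ℕ) : ℝ) + 1) ^ (-r - 1)
      ≤ ((N : ℝ) + 1) ^ (-r) := by
  have : min 1 r / 2 * ∑ i ∈ Finset.range k, (((N + i : ℕ) : ℝ) + 1) ^ (-r - 1)
      ≤ ((N : ℝ) + 1) ^ (-r) - (((N + k : ℕ) : ℝ) + 1) ^ (-r) := by
    induction k with
    | zero => simp
    | succ k ih =>
      rw [Finset.sum_range_succ, mul_add]
      have := rpow_neg_tail_step hr (x := ((N + k : ℕ) : ℝ) + 1)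
        (by linarith [(N + k).cast_nonneg (α := ℝ)])
      push_cast at *
      have e : (N : ℝ) + (k + 1) + 1 = N + k + 1 + 1 := by ring
      rw [e]
      linarith
  have h2 : 0 ≤ (((N + k : ℕ) : ℝ) + 1) ^ (-r) := by positivity
  linarith

/-- Weighted Jensen inequality for infinite sums. -/
theorem tsum_mul_rpow_le {p : ℝ} (hp : 1 < p) (m z : ℕ → ℝ≥0∞) :
    (∑' i, m i * z i) ^ p ≤ (∑' i, m i) ^ (p - 1) * ∑' i, m i * z i ^ p := by
  have hp0 : 0 < p := by linarith
  set q := p.conjExponent with hq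
  have hpq : p.HolderConjugate q := Real.HolderConjugate.conjExponent hp
  have hfin : ∀ s : Finset ℕ, (∑ i ∈ s, m i * z i) ^ p
      ≤ (∑' i, m i) ^ (p - 1) * ∑' i, m i * z i ^ p := by
    intro s
    by_cases htop : ∃ i ∈ s, m i = ⊤
    · obtain ⟨i, hi, hm⟩ := htop
      have h1 : ∑' i, m i = ⊤ := by
        rw [ENNReal.tsum_eq_top_of_eq_top ⟨i, hm⟩]
      rw [h1, ENNReal.top_rpow_of_pos (by linarith)]
      by_cases h0 : ∑' i, m i * z i ^ p = 0
      · have : ∑ i ∈ s, m i * z i = 0 := by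
          rw [ENNReal.tsum_eq_zero] at h0
          apply Finset.sum_eq_zero
          intro j _
          have := h0 j
          rw [mul_eq_zero] at this ⊢
          rcases this with h | h
          · exact Or.inl h
          · right; exact (ENNReal.rpow_eq_zero_iff_of_pos hp0).1 h
        rw [this, ENNReal.zero_rpow_of_pos hp0]; exact zero_le
      · rw [ENNReal.top_mul h0]; exact le_top
    push Not at htop
    have hH := ENNReal.inner_le_Lp_mul_Lq s (fun i => m i ^ (1 / q))
      (fun i => m i ^ (1 / p) * z i) hpq.symm
    have e1 : ∀ i ∈ s, m i ^ (1 / q) * (m i ^ (1 / p) * z i) = m i * z i := by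
      intro i hi
      rw [← mul_assoc, ← ENNReal.rpow_add_of_nonneg _ _ (by simpa using hpq.symm.nonneg)
        (by positivity), one_div, one_div, add_comm, hpq.inv_add_inv_eq_one, ENNReal.rpow_one]
    have e2 : ∀ i ∈ s, (m i ^ (1 / q)) ^ q = m i := by
      intro i _
      rw [← ENNReal.rpow_mul, one_div_mul_cancel hpq.symm.ne_zero, ENNReal.rpow_one]
    have e3 : ∀ i ∈ s, (m i ^ (1 / p) * z i) ^ p = m i * z i ^ p := by
      intro i _
      rw [ENNReal.mul_rpow_of_nonneg _ _ hp0.le, ← ENNReal.rpow_mul,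
        one_div_mul_cancel hp0.ne', ENNReal.rpow_one]
    rw [Finset.sum_congr rfl e1, Finset.sum_congr rfl e2, Finset.sum_congr rfl e3] at hH
    calc (∑ i ∈ s, m i * z i) ^ p
        ≤ ((∑ i ∈ s, m i) ^ (1 / q) * (∑ i ∈ s, m i * z i ^ p) ^ (1 / p)) ^ p := by gcongr
      _ = (∑ i ∈ s, m i) ^ (p - 1) * ∑ i ∈ s, m i * z i ^ p := by
        rw [ENNReal.mul_rpow_of_nonneg _ _ hp0.le, ← ENNReal.rpow_mul, ← ENNReal.rpow_mul,
          one_div_mul_cancel hp0.ne', ENNReal.rpow_one]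
        congr 2
        rw [one_div, ← hpq.one_sub_inv]; field_simp
      _ ≤ _ := by
        have hp1 : 0 ≤ p - 1 := by linarith
        exact mul_le_mul' (ENNReal.rpow_le_rpow (ENNReal.sum_le_tsum s) hp1)
          (ENNReal.sum_le_tsum s)
  have ht : Filter.Tendsto (fun s : Finset ℕ => (∑ i ∈ s, m i * z i) ^ p) Filter.atTop
      (nhds ((∑' i, m i * z i) ^ p)) :=
    (ENNReal.continuous_rpow_const.tendsto _).comp ENNReal.summable.hasSum
  exact le_of_tendsto' ht hfin

theorem add_rpow_le {p : ℝ} (hp : 1 < p) (a b : ℝ≥0∞) :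
    (a + b) ^ p ≤ 2 ^ (p - 1) * (a ^ p + b ^ p) := by
  have := ENNReal.rpow_add_le_mul_rpow_add_rpow a b hp.le
  simpa using this

/-! ### Majorants of Dirichlet kernels -/

/-- Lebesgue measure on a period. -/
def circ : Measure ℝ := volume.restrict (Set.Ioc (0 : ℝ) (2 * π))

/-- Normalized majorant of the Dirichlet kernel of degree `i + 1`. -/
def dker (i : ℕ) (x : ℝ) : ℝ≥0∞ := min 1 (ENNReal.ofReal (((i : ℝ) + 1) * |sin (x / 2)|))⁻¹

/-- The Hardy–Littlewood weight. -/
def wt (p : ℝ) (i : ℕ) : ℝ≥0∞ := ENNReal.ofReal (((i : ℝ) + 1) ^ (p - 2))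

theorem measurable_dker (i : ℕ) : Measurable (dker i) := by
  unfold dker
  fun_prop

theorem sum_min_mul_rpow_le {r σ : ℝ} (hr : 0 < r) (hr1 : r < 1) (h0 : 0 < σ)
    (n : ℕ) :
    ∑ i ∈ Finset.range n, min 1 (((i : ℝ) + 1) * σ)⁻¹ * ((i : ℝ) + 1) ^ (-r)
      ≤ (1 / (1 - r) + 2 / r) * σ ^ (r - 1) := by
  set N := ⌊1 / σ⌋₊ with hN
  have hNle : (N : ℝ) ≤ 1 / σ := Nat.floor_le (by positivity)
  have hNlt : 1 / σ < (N : ℝ) + 1 := Nat.lt_floor_add_one _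
  have hσ : (1 / σ) ^ (1 - r) = σ ^ (r - 1) := by
    rw [one_div, Real.inv_rpow h0.le, ← Real.rpow_neg h0.le]; ring_nf
  have hnn : ∀ i : ℕ, 0 ≤ min 1 (((i : ℝ) + 1) * σ)⁻¹ * ((i : ℝ) + 1) ^ (-r) := by
    intro i; positivity
  calc ∑ i ∈ Finset.range n, min 1 (((i : ℝ) + 1) * σ)⁻¹ * ((i : ℝ) + 1) ^ (-r)
      ≤ ∑ i ∈ Finset.range (N + n), min 1 (((i : ℝ) + 1) * σ)⁻¹ * ((i : ℝ) + 1) ^ (-r) := by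
        apply Finset.sum_le_sum_of_subset_of_nonneg
        · intro i hi; simp at hi ⊢; omega
        · intro i _ _; exact hnn i
    _ = ∑ i ∈ Finset.range N, min 1 (((i : ℝ) + 1) * σ)⁻¹ * ((i : ℝ) + 1) ^ (-r)
        + ∑ i ∈ Finset.range n,
          min 1 ((((N + i : ℕ) : ℝ) + 1) * σ)⁻¹ * (((N + i : ℕ) : ℝ) + 1) ^ (-r) :=
        Finset.sum_range_add _ _ _
    _ ≤ ∑ i ∈ Finset.range N, ((i : ℝ) + 1) ^ ((1 - r) - 1)
        + ∑ i ∈ Finset.range n, σ⁻¹ * (((N + i : ℕ) : ℝ) + 1) ^ (-r - 1) := by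
        apply add_le_add
        · apply Finset.sum_le_sum
          intro i _
          have : (1 - r) - 1 = -r := by ring
          rw [this]
          have h3 : 0 ≤ ((i : ℝ) + 1) ^ (-r) := by positivity
          exact mul_le_of_le_one_left h3 (min_le_left _ _)
        · apply Finset.sum_le_sum
          intro i _
          have h3 : (0 : ℝ) < ((N + i : ℕ) : ℝ) + 1 := by positivity
          rw [Real.rpow_sub_one h3.ne']
          calc _ ≤ ((((N + i : ℕ) : ℝ) + 1) * σ)⁻¹ * (((N + i : ℕ) : ℝ) + 1) ^ (-r) := by
                gcongr; exact min_le_right _ _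
            _ = _ := by rw [mul_inv]; ring
    _ ≤ 1 / (1 - r) * σ ^ (r - 1) + 2 / r * σ ^ (r - 1) := by
        apply add_le_add
        · have := sum_rpow_le (β := 1 - r) (by linarith) N
          rw [min_eq_right (by linarith)] at this
          have h4 : (N : ℝ) ^ (1 - r) ≤ (1 / σ) ^ (1 - r) := by
            apply Real.rpow_le_rpow (by positivity) hNle (by linarith)
          rw [hσ] at h4
          rw [div_mul_eq_mul_div, le_div_iff₀ (by linarith)]
          linarith
        · rw [← Finset.mul_sum]
          have := sum_rpow_neg_tail_le hr N n
          rw [min_eq_right hr1.le] at this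
          have h4 : ((N : ℝ) + 1) ^ (-r) ≤ (1 / σ) ^ (-r) :=
            Real.rpow_le_rpow_of_nonpos (by positivity) hNlt.le (by linarith)
          have h5 : (1 / σ) ^ (-r) = σ * σ ^ (r - 1) := by
            rw [one_div, Real.inv_rpow h0.le, ← Real.rpow_neg h0.le, Real.rpow_sub_one h0.ne']
            field_simp
          rw [h5] at h4
          have h6 : 0 < σ ^ (r - 1) := by positivity
          have h7 : ∑ i ∈ Finset.range n, (((N + i : ℕ) : ℝ) + 1) ^ (-r - 1)
              ≤ 2 / r * (σ * σ ^ (r - 1)) := by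
            rw [div_mul_eq_mul_div, le_div_iff₀ hr]; linarith
          calc _ ≤ σ⁻¹ * (2 / r * (σ * σ ^ (r - 1))) := by gcongr
            _ = _ := by field_simp
    _ = _ := by ring

theorem dker_eq_ofReal {x : ℝ} (h : sin (x / 2) ≠ 0) (i : ℕ) :
    dker i x = ENNReal.ofReal (min 1 (((i : ℝ) + 1) * |sin (x / 2)|)⁻¹) := by
  have : 0 < |sin (x / 2)| := abs_pos.2 h
  rw [dker, ENNReal.ofReal_min, ENNReal.ofReal_one, ENNReal.ofReal_inv_of_pos (by positivity)]

theorem tsum_dker_mul_le {r x : ℝ} (hr : 0 < r) (hr1 : r < 1) (h : sin (x / 2) ≠ 0) :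
    ∑' i : ℕ, dker i x * ENNReal.ofReal (((i : ℝ) + 1) ^ (-r))
      ≤ ENNReal.ofReal ((1 / (1 - r) + 2 / r) * |sin (x / 2)| ^ (r - 1)) := by
  apply ENNReal.tsum_le_of_sum_range_le
  intro n
  have : ∀ i ∈ Finset.range n, dker i x * ENNReal.ofReal (((i : ℝ) + 1) ^ (-r))
      = ENNReal.ofReal (min 1 (((i : ℝ) + 1) * |sin (x / 2)|)⁻¹ * ((i : ℝ) + 1) ^ (-r)) := by
    intro i _
    rw [dker_eq_ofReal h, ENNReal.ofReal_mul (by positivity)]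
  rw [Finset.sum_congr rfl this, ← ENNReal.ofReal_sum_of_nonneg (fun i _ => by positivity)]
  exact ENNReal.ofReal_le_ofReal
    (sum_min_mul_rpow_le hr hr1 (abs_pos.2 h) n)

theorem div_pi_le_abs_sin {x : ℝ} (h0 : 0 ≤ x) (h1 : x ≤ π) : x / π ≤ |sin (x / 2)| := by
  have := Real.mul_le_sin (x := x / 2) (by linarith) (by linarith)
  refine le_trans (le_of_eq ?_) (this.trans (le_abs_self _))
  field_simp

theorem lintegral_dker_mul_le {e : ℝ} (he : -1 < e) (he0 : e < 0) (i : ℕ) :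
    ∫⁻ x, dker i x * ENNReal.ofReal (|sin (x / 2)| ^ e) ∂circ
      ≤ ENNReal.ofReal (2 * (π ^ (-e) / (e + 1) + π ^ (1 - e) / (-e)))
        * ENNReal.ofReal (((i : ℝ) + 1) ^ (-e - 1)) := by
  set δ : ℝ := 1 / ((i : ℝ) + 1) with hδ
  have hδ0 : 0 < δ := by positivity
  have hpi := Real.pi_pos
  set h1 : ℝ → ℝ≥0∞ := (Set.Ioc 0 δ).indicator (fun x => ENNReal.ofReal (π ^ (-e) * x ^ e))
  set h2 : ℝ → ℝ≥0∞ := (Set.Ioi δ).indicator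
    (fun x => ENNReal.ofReal (π ^ (1 - e) * δ * x ^ (e - 1)))
  have m1 : Measurable h1 := Measurable.indicator (by fun_prop) measurableSet_Ioc
  have m2 : Measurable h2 := Measurable.indicator (by fun_prop) measurableSet_Ioi
  have hH : ∀ x, 0 < x → x ≤ π →
      dker i x * ENNReal.ofReal (|sin (x / 2)| ^ e) ≤ h1 x + h2 x := by
    intro x hx hxp
    have hs := div_pi_le_abs_sin hx.le hxp
    have hσ : 0 < |sin (x / 2)| := lt_of_lt_of_le (by positivity) hs
    have hse : |sin (x / 2)| ^ e ≤ (x / π) ^ e :=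
      Real.rpow_le_rpow_of_nonpos (by positivity) hs he0.le
    have hxe : (x / π) ^ e = π ^ (-e) * x ^ e := by
      rw [Real.div_rpow hx.le hpi.le, Real.rpow_neg hpi.le]; field_simp
    rcases le_or_gt x δ with hxd | hxd
    · have : h1 x = ENNReal.ofReal (π ^ (-e) * x ^ e) := 
        Set.indicator_of_mem (show x ∈ Set.Ioc 0 δ from ⟨hx, hxd⟩) _
      rw [this]
      refine le_trans ?_ le_self_add
      rw [← hxe]
      calc _ ≤ 1 * ENNReal.ofReal (|sin (x / 2)| ^ e) := by gcongr; exact min_le_left _ _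
        _ ≤ _ := by rw [one_mul]; exact ENNReal.ofReal_le_ofReal hse
    · have : h2 x = ENNReal.ofReal (π ^ (1 - e) * δ * x ^ (e - 1)) :=
        Set.indicator_of_mem hxd _
      rw [this]
      refine le_trans ?_ le_add_self
      rw [dker_eq_ofReal (abs_pos.1 hσ), ← ENNReal.ofReal_mul (by positivity)]
      apply ENNReal.ofReal_le_ofReal
      calc _ ≤ (((i : ℝ) + 1) * |sin (x / 2)|)⁻¹ * |sin (x / 2)| ^ e := by
            gcongr; exact min_le_right _ _
        _ ≤ (((i : ℝ) + 1) * (x / π))⁻¹ * (x / π) ^ e := by gcongr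
        _ = _ := by
            rw [hxe, hδ, Real.rpow_sub_one hx.ne', Real.rpow_sub hpi, Real.rpow_neg hpi.le,
              Real.rpow_one]
            field_simp
  have hpt : ∀ x ∈ Set.Ioc (0 : ℝ) (2 * π), dker i x * ENNReal.ofReal (|sin (x / 2)| ^ e)
      ≤ (h1 x + h2 x) + (h1 (2 * π - x) + h2 (2 * π - x)) := by
    rintro x ⟨hx0, hx2⟩
    rcases le_or_gt x π with h | h
    · exact (hH x hx0 h).trans le_self_add
    · rcases hx2.eq_or_lt with h2 | h2
      · have : sin (x / 2) = 0 := by rw [h2]; simp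
        rw [this]; simp [Real.zero_rpow he0.ne]
      · refine le_trans ?_ le_add_self
        have h3 := hH (2 * π - x) (by linarith) (by linarith)
        have h4 : sin ((2 * π - x) / 2) = sin (x / 2) := by
          rw [← Real.sin_pi_sub]; congr 1; ring
        have h5 : dker i (2 * π - x) = dker i x := by simp only [dker, h4]
        rwa [h4, h5] at h3
  have i1 : ∫⁻ x, h1 x = ENNReal.ofReal (π ^ (-e) / (e + 1) * ((i : ℝ) + 1) ^ (-e - 1)) := by
    rw [lintegral_indicator measurableSet_Ioc, ← ofReal_integral_eq_lintegral_ofReal]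
    · rw [← intervalIntegral.integral_of_le hδ0.le, intervalIntegral.integral_const_mul,
        integral_rpow (Or.inl he), Real.zero_rpow (by linarith)]
      congr 1
      rw [hδ, one_div, Real.inv_rpow (by positivity), ← Real.rpow_neg (by positivity)]
      ring_nf
    · have := (intervalIntegral.intervalIntegrable_rpow' (a := 0) (b := δ) he).const_mul (π ^ (-e))
      rwa [intervalIntegrable_iff_integrableOn_Ioc_of_le hδ0.le] at this
    · filter_upwards [ae_restrict_mem measurableSet_Ioc] with x hx
      have := hx.1
      simp only [Pi.zero_apply]; positivity
  have i2 : ∫⁻ x, h2 x = ENNReal.ofReal (π ^ (1 - e) / (-e) * ((i : ℝ) + 1) ^ (-e - 1)) := by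
    rw [lintegral_indicator measurableSet_Ioi, ← ofReal_integral_eq_lintegral_ofReal]
    · rw [integral_const_mul, integral_Ioi_rpow_of_lt (by linarith) hδ0]
      congr 1
      rw [hδ, one_div, Real.inv_rpow (by positivity), ← Real.rpow_neg (by positivity),
        Real.rpow_sub_one (by positivity)]
      have : e ≠ 0 := he0.ne
      ring_nf
    · exact (integrableOn_Ioi_rpow_of_lt (by linarith) hδ0).const_mul _
    · filter_upwards [ae_restrict_mem measurableSet_Ioi] with x hx
      have : 0 < x := lt_trans hδ0 hx
      simp only [Pi.zero_apply]; positivity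
  calc ∫⁻ x, dker i x * ENNReal.ofReal (|sin (x / 2)| ^ e) ∂circ
      ≤ ∫⁻ x in Set.Ioc (0 : ℝ) (2 * π),
          (h1 x + h2 x) + (h1 (2 * π - x) + h2 (2 * π - x)) :=
        setLIntegral_mono' measurableSet_Ioc hpt
    _ ≤ ∫⁻ x, (h1 x + h2 x) + (h1 (2 * π - x) + h2 (2 * π - x)) := setLIntegral_le_lintegral _ _
    _ = (∫⁻ x, h1 x + h2 x) + ∫⁻ x, (h1 x + h2 x) := by
        rw [lintegral_add_left (by fun_prop)]
        congr 1
        exact lintegral_sub_left_eq_self (fun x => h1 x + h2 x) (2 * π)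
    _ = _ := by
        have a1 : 0 ≤ π ^ (-e) / (e + 1) := div_nonneg (by positivity) (by linarith)
        have a2 : 0 ≤ π ^ (1 - e) / (-e) := div_nonneg (by positivity) (by linarith)
        rw [lintegral_add_left m1, i1, i2, ← ENNReal.ofReal_add (by positivity) (by positivity),
          ← ENNReal.ofReal_add (by positivity) (by positivity),
          ← ENNReal.ofReal_mul (by positivity)]
        congr 1; ring

/-- `M` satisfies the one-dimensional Hardy–Littlewood upper bound with constant `C`. -/
structure TBound (p : ℝ) (C : ℝ≥0∞) (M : ℕ → ℝ → ℝ≥0∞) : Prop where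
  meas : ∀ i, Measurable (M i)
  bound : ∀ c : ℕ → ℝ≥0∞, ∫⁻ x, (∑' i, c i * M i x) ^ p ∂circ ≤ C * ∑' i, c i ^ p * wt p i

theorem sin_half_ne_zero_ae : ∀ᵐ x : ℝ ∂circ, sin (x / 2) ≠ 0 := by
  have h1 : ∀ᵐ x : ℝ ∂circ, x ≠ 2 * π := by
    apply ae_restrict_of_ae
    exact (Set.countable_singleton (2 * π)).ae_notMem volume
  filter_upwards [h1, ae_restrict_mem measurableSet_Ioc] with x hx hx2
  have : 0 < sin (x / 2) := by
    apply Real.sin_pos_of_pos_of_lt_pi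
    · linarith [hx2.1]
    · have := lt_of_le_of_ne hx2.2 hx
      linarith
  exact this.ne'

theorem exists_tbound_dker {p : ℝ} (hp : 1 < p) :
    ∃ C : ℝ≥0∞, C ≠ ⊤ ∧ TBound p C dker := by
  set r : ℝ := 1 - 1 / p with hr
  have hp0 : 0 < p := by linarith
  have hp1 : 1 / p < 1 := by rw [div_lt_one hp0]; exact hp
  have hp2 : 0 < 1 / p := by positivity
  have hr0 : 0 < r := by rw [hr]; linarith
  have hr1 : r < 1 := by rw [hr]; linarith
  set e : ℝ := (r - 1) * (p - 1) with he
  have hee : e = -r := by rw [he, hr]; field_simp; ring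
  set A : ℝ := 1 / (1 - r) + 2 / r with hA
  have hA0 : 0 ≤ A := by
    have : 0 < 1 - r := by linarith
    positivity
  set B : ℝ≥0∞ := ENNReal.ofReal (2 * (π ^ (-e) / (e + 1) + π ^ (1 - e) / (-e))) with hB
  refine ⟨ENNReal.ofReal (A ^ (p - 1)) * B, ENNReal.mul_ne_top ENNReal.ofReal_ne_top
    ENNReal.ofReal_ne_top, measurable_dker, fun c => ?_⟩
  have hpt : ∀ᵐ x ∂circ, (∑' i, c i * dker i x) ^ p ≤
      ∑' i : ℕ, (ENNReal.ofReal (A ^ (p - 1)) * (c i ^ p *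
        ENNReal.ofReal (((i : ℝ) + 1) ^ (r * (p - 1))))) *
        (dker i x * ENNReal.ofReal (|sin (x / 2)| ^ e)) := by
    filter_upwards [sin_half_ne_zero_ae] with x hx
    have hσ : 0 < |sin (x / 2)| := abs_pos.2 hx
    have h1 := tsum_mul_rpow_le hp
      (fun i : ℕ => dker i x * ENNReal.ofReal (((i : ℝ) + 1) ^ (-r)))
      (fun i : ℕ => ENNReal.ofReal (((i : ℝ) + 1) ^ r) * c i)
    have e1 : ∀ i : ℕ, dker i x * ENNReal.ofReal (((i : ℝ) + 1) ^ (-r)) *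
        (ENNReal.ofReal (((i : ℝ) + 1) ^ r) * c i) = c i * dker i x := by
      intro i
      have : ENNReal.ofReal (((i : ℝ) + 1) ^ (-r)) * ENNReal.ofReal (((i : ℝ) + 1) ^ r) = 1 := by
        rw [← ENNReal.ofReal_mul (by positivity), ← Real.rpow_add (by positivity)]
        simp
      calc _ = (ENNReal.ofReal (((i : ℝ) + 1) ^ (-r)) * ENNReal.ofReal (((i : ℝ) + 1) ^ r))
            * (c i * dker i x) := by ring
        _ = _ := by rw [this, one_mul]
    simp only [e1] at h1
    refine h1.trans ?_
    have h2 := tsum_dker_mul_le hr0 hr1 hx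
    calc _ ≤ (ENNReal.ofReal (A * |sin (x / 2)| ^ (r - 1))) ^ (p - 1) *
          ∑' i : ℕ, dker i x * ENNReal.ofReal (((i : ℝ) + 1) ^ (-r)) *
            (ENNReal.ofReal (((i : ℝ) + 1) ^ r) * c i) ^ p :=
          mul_le_mul' (ENNReal.rpow_le_rpow h2 (by linarith)) le_rfl
      _ = _ := by
          rw [← ENNReal.tsum_mul_left]
          congr 1; ext i
          rw [ENNReal.ofReal_rpow_of_nonneg (by positivity) (by linarith),
            Real.mul_rpow hA0 (by positivity), ← Real.rpow_mul (by positivity), ← he,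
            ENNReal.ofReal_mul (by positivity), ENNReal.mul_rpow_of_nonneg _ _ hp0.le,
            ENNReal.ofReal_rpow_of_nonneg (by positivity) hp0.le, ← Real.rpow_mul (by positivity)]
          have h3 : ENNReal.ofReal (((i : ℝ) + 1) ^ (-r)) * ENNReal.ofReal (((i : ℝ) + 1) ^ (r * p))
              = ENNReal.ofReal (((i : ℝ) + 1) ^ (r * (p - 1))) := by
            rw [← ENNReal.ofReal_mul (by positivity), ← Real.rpow_add (by positivity)]
            congr 2; ring
          rw [← h3]; ring
  calc ∫⁻ x, (∑' i, c i * dker i x) ^ p ∂circ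
      ≤ ∫⁻ x, ∑' i : ℕ, (ENNReal.ofReal (A ^ (p - 1)) * (c i ^ p *
        ENNReal.ofReal (((i : ℝ) + 1) ^ (r * (p - 1))))) *
        (dker i x * ENNReal.ofReal (|sin (x / 2)| ^ e)) ∂circ := lintegral_mono_ae hpt
    _ = ∑' i : ℕ, (ENNReal.ofReal (A ^ (p - 1)) * (c i ^ p *
        ENNReal.ofReal (((i : ℝ) + 1) ^ (r * (p - 1))))) *
        ∫⁻ x, dker i x * ENNReal.ofReal (|sin (x / 2)| ^ e) ∂circ := by
        have hm : ∀ i, Measurable fun x => dker i x * ENNReal.ofReal (|sin (x / 2)| ^ e) :=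
          fun i => (measurable_dker i).mul (by fun_prop)
        rw [lintegral_tsum]
        · congr 1; ext i
          rw [lintegral_const_mul _ (hm i)]
        · intro i
          exact ((hm i).const_mul _).aemeasurable
    _ ≤ ∑' i : ℕ, (ENNReal.ofReal (A ^ (p - 1)) * (c i ^ p *
        ENNReal.ofReal (((i : ℝ) + 1) ^ (r * (p - 1))))) *
        (B * ENNReal.ofReal (((i : ℝ) + 1) ^ (-e - 1))) := by
        gcongr with i
        exact lintegral_dker_mul_le (by linarith) (by linarith) i
    _ = _ := by
        rw [← ENNReal.tsum_mul_left]
        congr 1; ext i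
        have h3 : ENNReal.ofReal (((i : ℝ) + 1) ^ (r * (p - 1))) *
            ENNReal.ofReal (((i : ℝ) + 1) ^ (-e - 1)) = wt p i := by
          rw [← ENNReal.ofReal_mul (by positivity), ← Real.rpow_add (by positivity), wt]
          congr 2; rw [he]; ring
        rw [← h3]; ring

/-! ### Kernel sums and tail sums -/

theorem lintegral_circ_shift {F : ℝ → ℝ≥0∞} (hF : Function.Periodic F (2 * π)) (s : ℝ) :
    ∫⁻ x, F (x + s) ∂circ = ∫⁻ x, F x ∂circ := by
  have h2 : (0 : ℝ) < 2 * π := Real.two_pi_pos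
  have h1 : ∫⁻ x, F (x + s) ∂circ = ∫⁻ x in Set.Ioc s (s + 2 * π), F x := by
    rw [circ, ← lintegral_indicator measurableSet_Ioc, ← lintegral_indicator measurableSet_Ioc,
      ← lintegral_add_right_eq_self ((Set.Ioc s (s + 2 * π)).indicator F) s]
    congr 1; ext x
    by_cases hx : x ∈ Set.Ioc (0 : ℝ) (2 * π)
    · rw [Set.indicator_of_mem hx, Set.indicator_of_mem]
      exact ⟨by linarith [hx.1], by linarith [hx.2]⟩
    · rw [Set.indicator_of_notMem hx, Set.indicator_of_notMem]
      intro h; exact hx ⟨by linarith [h.1], by linarith [h.2]⟩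
  rw [h1, circ]
  have key := IsAddFundamentalDomain.setLIntegral_eq
    (isAddFundamentalDomain_Ioc h2 s volume) (isAddFundamentalDomain_Ioc h2 0 volume) F
    (fun g x => by
      obtain ⟨n, hn⟩ := AddSubgroup.mem_zmultiples_iff.1 g.2
      have : (g +ᵥ x : ℝ) = x + n • (2 * π) := by
        rw [hn, add_comm]; rfl
      rw [this]
      exact hF.zsmul n x)
  rw [zero_add] at key
  exact key

theorem dker_periodic (i : ℕ) : Function.Periodic (dker i) (2 * π) := by
  intro x
  have : sin ((x + 2 * π) / 2) = - sin (x / 2) := by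
    rw [← Real.sin_add_pi]; congr 1; ring
  simp only [dker, this, abs_neg]

theorem TBound.shift {p : ℝ} {C : ℝ≥0∞} {M : ℕ → ℝ → ℝ≥0∞} (h : TBound p C M)
    (hper : ∀ i, Function.Periodic (M i) (2 * π)) (s : ℝ) :
    TBound p C (fun i x => M i (x + s)) where
  meas i := (h.meas i).comp (measurable_id.add_const s)
  bound c := by
    have := lintegral_circ_shift (F := fun x => (∑' i, c i * M i x) ^ p)
      (fun x => by simp only [fun i => hper i x]) s
    rw [this]
    exact h.bound c

theorem TBound.add {p : ℝ} (hp : 1 < p) {C C' : ℝ≥0∞} {M M' : ℕ → ℝ → ℝ≥0∞} (h : TBound p C M)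
    (h' : TBound p C' M') : TBound p (2 ^ (p - 1) * (C + C')) (fun i x => M i x + M' i x) where
  meas i := (h.meas i).add (h'.meas i)
  bound c := by
    have hm : Measurable fun x => (∑' i, c i * M i x) ^ p :=
      (Measurable.tsum fun i => (h.meas i).const_mul _).pow_const _
    have hm' : Measurable fun x => (∑' i, c i * M' i x) ^ p :=
      (Measurable.tsum fun i => (h'.meas i).const_mul _).pow_const _
    calc ∫⁻ x, (∑' i, c i * (M i x + M' i x)) ^ p ∂circ
        ≤ ∫⁻ x, 2 ^ (p - 1) * ((∑' i, c i * M i x) ^ p + (∑' i, c i * M' i x) ^ p) ∂circ := by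
          apply lintegral_mono
          intro x
          have hx : ∑' i, c i * (M i x + M' i x) = ∑' i, c i * M i x + ∑' i, c i * M' i x := by
            simp only [mul_add, ENNReal.tsum_add]
          simp only [hx]
          exact add_rpow_le hp _ _
      _ = 2 ^ (p - 1) * (∫⁻ x, (∑' i, c i * M i x) ^ p ∂circ
          + ∫⁻ x, (∑' i, c i * M' i x) ^ p ∂circ) := by
          have hmm : Measurable fun x => (∑' i, c i * M i x) ^ p + (∑' i, c i * M' i x) ^ p :=
            hm.add hm'
          rw [lintegral_const_mul _ hmm, lintegral_add_left hm]
      _ ≤ 2 ^ (p - 1) * (C * ∑' i, c i ^ p * wt p i + C' * ∑' i, c i ^ p * wt p i) :=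
          mul_le_mul' le_rfl (add_le_add (h.bound c) (h'.bound c))
      _ = _ := by ring

theorem TBound.average {p : ℝ} (hp : 1 < p) {C : ℝ≥0∞} {M : ℕ → ℝ → ℝ≥0∞} (h : TBound p C M)
    (hper : ∀ i, Function.Periodic (M i) (2 * π)) (m : ℕ → ℝ≥0∞) (s : ℕ → ℝ) :
    TBound p ((∑' j, m j) ^ (p - 1) * (∑' j, m j) * C)
      (fun i x => ∑' j, m j * M i (x + s j)) where
  meas i := Measurable.tsum fun j => ((h.shift hper (s j)).meas i).const_mul _
  bound c := by
    have hm : ∀ j, Measurable fun x => (∑' i, c i * M i (x + s j)) ^ p := fun j =>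
      (Measurable.tsum fun i => ((h.shift hper (s j)).meas i).const_mul _).pow_const _
    calc ∫⁻ x, (∑' i, c i * ∑' j, m j * M i (x + s j)) ^ p ∂circ
        ≤ ∫⁻ x, (∑' j, m j) ^ (p - 1) * ∑' j, m j * (∑' i, c i * M i (x + s j)) ^ p ∂circ := by
          apply lintegral_mono
          intro x
          have : ∑' i, c i * ∑' j, m j * M i (x + s j)
              = ∑' j, m j * ∑' i, c i * M i (x + s j) := by
            simp only [← ENNReal.tsum_mul_left]
            rw [ENNReal.tsum_comm]
            congr 1; ext j; congr 1; ext i; ring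
          simp only [this]
          exact tsum_mul_rpow_le hp _ _
      _ = (∑' j, m j) ^ (p - 1) * ∑' j, m j * ∫⁻ x, (∑' i, c i * M i (x + s j)) ^ p ∂circ := by
          rw [lintegral_const_mul _ (Measurable.tsum fun j => (hm j).const_mul _),
            lintegral_tsum fun j => ((hm j).const_mul _).aemeasurable]
          congr 2; ext j
          rw [lintegral_const_mul _ (hm j)]
      _ ≤ (∑' j, m j) ^ (p - 1) * ∑' j, m j * (C * ∑' i, c i ^ p * wt p i) := by
          gcongr with j
          exact (h.shift hper (s j)).bound c
      _ = _ := by rw [ENNReal.tsum_mul_right]; ring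

theorem TBound.tensor {p : ℝ} {C C' : ℝ≥0∞} {M M' : ℕ → ℝ → ℝ≥0∞} (h : TBound p C M)
    (h' : TBound p C' M') (c : ℕ → ℕ → ℝ≥0∞) :
    ∫⁻ x, ∫⁻ y, (∑' i, ∑' j, c i j * M i x * M' j y) ^ p ∂circ ∂circ
      ≤ C * C' * ∑' i, ∑' j, c i j ^ p * wt p i * wt p j := by
  have hm : Measurable (Function.uncurry fun x y => (∑' i, ∑' j, c i j * M i x * M' j y) ^ p) := by
    apply Measurable.pow_const
    refine Measurable.tsum fun i => Measurable.tsum fun j => ?_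
    exact (((h.meas i).comp measurable_fst).const_mul _).mul ((h'.meas j).comp measurable_snd)
  have hsum : ∀ x y, ∑' i, ∑' j, c i j * M i x * M' j y
      = ∑' i, (∑' j, c i j * M' j y) * M i x := by
    intro x y
    congr 1; ext i
    rw [← ENNReal.tsum_mul_right]
    congr 1; ext j; ring
  have hm2 : ∀ i, Measurable fun y => (∑' j, c i j * M' j y) ^ p := fun i =>
    (Measurable.tsum fun j => (h'.meas j).const_mul _).pow_const _
  have : SFinite circ := by unfold circ; infer_instance
  calc ∫⁻ x, ∫⁻ y, (∑' i, ∑' j, c i j * M i x * M' j y) ^ p ∂circ ∂circ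
      = ∫⁻ y, ∫⁻ x, (∑' i, ∑' j, c i j * M i x * M' j y) ^ p ∂circ ∂circ :=
        lintegral_lintegral_swap hm.aemeasurable
    _ ≤ ∫⁻ y, C * ∑' i, (∑' j, c i j * M' j y) ^ p * wt p i ∂circ := by
        apply lintegral_mono
        intro y
        simp only [hsum]
        exact h.bound fun i => ∑' j, c i j * M' j y
    _ = C * ∑' i, (∫⁻ y, (∑' j, c i j * M' j y) ^ p ∂circ) * wt p i := by
        rw [lintegral_const_mul _ (Measurable.tsum fun i => (hm2 i).mul_const _),
          lintegral_tsum fun i => ((hm2 i).mul_const _).aemeasurable]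
        congr 2; ext i
        rw [lintegral_mul_const _ (hm2 i)]
    _ ≤ C * ∑' i, (C' * ∑' j, c i j ^ p * wt p j) * wt p i := by
        gcongr with i
        exact h'.bound (c i)
    _ = _ := by
        rw [mul_assoc, ← ENNReal.tsum_mul_left (a := C')]
        congr 2; ext i
        rw [mul_assoc, ← ENNReal.tsum_mul_right]
        congr 2; ext j; ring

/-- The indicator of `i ≤ k`. -/
def ind (i k : ℕ) : ℝ≥0∞ := if i ≤ k then 1 else 0

/-- Iterated tail sums of a double sequence. -/
def tailSum (d : ℕ → ℕ → ℝ≥0∞) (i j : ℕ) : ℝ≥0∞ := ∑' k, ∑' l, ind i k * ind j l * d k l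

theorem sum_range_eq_tsum_ind (v : ℕ → ℝ≥0∞) (k : ℕ) :
    ∑ i ∈ Finset.range (k + 1), v i = ∑' i, ind i k * v i := by
  rw [tsum_eq_sum (s := Finset.range (k + 1))]
  · apply Finset.sum_congr rfl
    intro i hi
    have : i ≤ k := by simp at hi; omega
    simp [ind, this]
  · intro i hi
    have : ¬ i ≤ k := by simp at hi; omega
    simp [ind, this]

theorem tsum_mul_le_tailSum {C C' : ℝ≥0∞} {w w' : ℕ → ℝ≥0∞} {M M' G G' : ℕ → ℝ≥0∞}
    (hG : ∀ k, G k ≤ C * ∑ i ∈ Finset.range (k + 1), w i * M i)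
    (hG' : ∀ k, G' k ≤ C' * ∑ i ∈ Finset.range (k + 1), w' i * M' i) (d : ℕ → ℕ → ℝ≥0∞) :
    ∑' k, ∑' l, d k l * G k * G' l
      ≤ ∑' i, ∑' j, (C * C' * (w i * w' j * tailSum d i j)) * M i * M' j := by
  calc ∑' k, ∑' l, d k l * G k * G' l
      ≤ ∑' k, ∑' l, d k l * (C * ∑ i ∈ Finset.range (k + 1), w i * M i) *
          (C' * ∑ i ∈ Finset.range (l + 1), w' i * M' i) := by
        gcongr with k l
        · exact hG k
        · exact hG' l
    _ = ∑' k, ∑' l, ∑' i, ∑' j, C * C' * (w i * w' j * (ind i k * ind j l * d k l))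
          * M i * M' j := by
        congr 1; ext k; congr 1; ext l
        rw [sum_range_eq_tsum_ind, sum_range_eq_tsum_ind]
        simp only [← ENNReal.tsum_mul_left, ← ENNReal.tsum_mul_right]
        rw [ENNReal.tsum_comm]
        congr 1; ext i; congr 1; ext j; ring
    _ = ∑' k, ∑' i, ∑' j, ∑' l, C * C' * (w i * w' j * (ind i k * ind j l * d k l))
          * M i * M' j := by
        congr 1; ext k
        rw [ENNReal.tsum_comm]
        congr 1; ext i
        rw [ENNReal.tsum_comm]
    _ = ∑' i, ∑' j, ∑' k, ∑' l, C * C' * (w i * w' j * (ind i k * ind j l * d k l))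
          * M i * M' j := by
        rw [ENNReal.tsum_comm]
        congr 1; ext i
        rw [ENNReal.tsum_comm]
    _ = _ := by
        congr 1; ext i; congr 1; ext j
        simp only [tailSum, ENNReal.tsum_mul_left, ENNReal.tsum_mul_right]

/-- Hardy–Littlewood upper bound for a double sum of kernels with nonnegative coefficients. -/
theorem lintegral_kernel_sum_le {p : ℝ} (hp : 1 < p) {B B' C C' : ℝ≥0∞} {w w' : ℕ → ℝ≥0∞}
    {M M' G G' : ℕ → ℝ → ℝ≥0∞} (hM : TBound p B M) (hM' : TBound p B' M')
    (hG : ∀ k x, G k x ≤ C * ∑ i ∈ Finset.range (k + 1), w i * M i x)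
    (hG' : ∀ k x, G' k x ≤ C' * ∑ i ∈ Finset.range (k + 1), w' i * M' i x)
    (d : ℕ → ℕ → ℝ≥0∞) :
    ∫⁻ x, ∫⁻ y, (∑' k, ∑' l, d k l * G k x * G' l y) ^ p ∂circ ∂circ
      ≤ B * B' * (C * C') ^ p *
        ∑' i, ∑' j, (w i * w' j * tailSum d i j) ^ p * wt p i * wt p j := by
  have hp0 : 0 ≤ p := by linarith
  calc _ ≤ ∫⁻ x, ∫⁻ y, (∑' i, ∑' j, (C * C' * (w i * w' j * tailSum d i j)) * M i x * M' j y) ^ p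
        ∂circ ∂circ := by
        apply lintegral_mono; intro x
        apply lintegral_mono; intro y
        exact ENNReal.rpow_le_rpow
          (tsum_mul_le_tailSum (fun k => hG k x) (fun k => hG' k y) d) hp0
    _ ≤ _ := hM.tensor hM' _
    _ = _ := by
        rw [mul_assoc (B * B'), ← ENNReal.tsum_mul_left (a := (C * C') ^ p)]
        congr 2; ext i
        rw [← ENNReal.tsum_mul_left]
        congr 1; ext j
        rw [ENNReal.mul_rpow_of_nonneg _ _ hp0]; ring

theorem dker_anti {i k : ℕ} (h : i ≤ k) (x : ℝ) : dker k x ≤ dker i x := by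
  unfold dker
  gcongr

/-- The Dirichlet majorant is dominated by the sum of the normalized majorants. -/
theorem mul_dker_le_sum {w : ℕ → ℝ≥0∞} {c : ℝ≥0∞} {k : ℕ} (x : ℝ)
    (hw : ∀ i ≤ k, k + 1 ≤ 2 * (i + 1) → w k ≤ c * w i) :
    w k * (((k : ℝ≥0∞) + 1) * dker k x)
      ≤ 2 * c * ∑ i ∈ Finset.range (k + 1), w i * dker i x := by
  have hcard : (k + 1) ≤ 2 * (Finset.Icc (k / 2) k).card := by
    rw [Nat.card_Icc]; omega
  have hcard' : (k : ℝ≥0∞) + 1 ≤ 2 * ((Finset.Icc (k / 2) k).card : ℝ≥0∞) := by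
    exact_mod_cast hcard
  calc w k * (((k : ℝ≥0∞) + 1) * dker k x)
      ≤ w k * (2 * ((Finset.Icc (k / 2) k).card : ℝ≥0∞) * dker k x) := by gcongr
    _ = 2 * ∑ i ∈ Finset.Icc (k / 2) k, w k * dker k x := by
        rw [Finset.sum_const, nsmul_eq_mul]; ring
    _ ≤ 2 * ∑ i ∈ Finset.Icc (k / 2) k, c * w i * dker i x := by
        gcongr with i hi
        · rw [Finset.mem_Icc] at hi
          exact hw i hi.2 (by omega)
        · exact dker_anti (Finset.mem_Icc.1 hi).2 x
    _ ≤ 2 * ∑ i ∈ Finset.range (k + 1), c * w i * dker i x := by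
        gcongr
        intro i hi
        simp at hi ⊢; omega
    _ = _ := by
        rw [mul_assoc, Finset.mul_sum (a := c)]
        congr 2; ext i; ring

/-! ### Coefficients of fractional differences -/

/-- The signed coefficients of the fractional difference. -/
def dcoef (α : ℝ) (j : ℕ) : ℝ := (-1) ^ j * fracBinom α j

theorem dcoef_zero (α : ℝ) : dcoef α 0 = 1 := by simp [dcoef, fracBinom]

theorem succ_mul_dcoef_succ (α : ℝ) (j : ℕ) :
    ((j : ℝ) + 1) * dcoef α (j + 1) = (j - α) * dcoef α j := by
  simp only [dcoef, fracBinom, pow_succ]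
  field_simp
  ring

theorem summable_abs_dcoef {α : ℝ} (hα : 0 < α) : Summable fun j => |dcoef α j| := by
  obtain ⟨K, hK⟩ := exists_nat_ge α
  rw [← summable_nat_add_iff K]
  have hstep : ∀ j : ℕ, α * |dcoef α (j + K)| = ((j : ℝ) + K) * |dcoef α (j + K)|
      - ((j : ℝ) + 1 + K) * |dcoef α (j + 1 + K)| := by
    intro j
    have h := congrArg abs (succ_mul_dcoef_succ α (j + K))
    have h1 : (0 : ℝ) ≤ ((j + K : ℕ) : ℝ) - α := by push_cast; linarith [Nat.cast_nonneg (α := ℝ) j]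
    rw [abs_mul, abs_mul, abs_of_nonneg h1, abs_of_pos (by positivity)] at h
    rw [show j + 1 + K = j + K + 1 by ring]
    push_cast at h
    linear_combination h
  refine summable_of_sum_range_le (c := K * |dcoef α K| / α) (fun _ => abs_nonneg _) fun n => ?_
  rw [le_div_iff₀' hα, Finset.mul_sum]
  have : ∀ n : ℕ, ∑ i ∈ Finset.range n, α * |dcoef α (i + K)|
      = K * |dcoef α K| - ((n : ℝ) + K) * |dcoef α (n + K)| := by
    intro n
    induction n with
    | zero => simp
    | succ n ih => rw [Finset.sum_range_succ, ih, hstep]; push_cast; ring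
  rw [this]
  have : 0 ≤ ((n : ℝ) + K) * |dcoef α (n + K)| := by positivity
  linarith

/-- The total absolute mass of the coefficients of the fractional difference. -/
def dmass (α : ℝ) : ℝ := ∑' j, |dcoef α j|

theorem tsum_ofReal_abs_dcoef {α : ℝ} (hα : 0 < α) :
    ∑' j, ENNReal.ofReal |dcoef α j| = ENNReal.ofReal (dmass α) :=
  (ENNReal.ofReal_tsum_of_nonneg (fun _ => abs_nonneg _) (summable_abs_dcoef hα)).symm

theorem fracBinom_eq_choose (α : ℝ) (n : ℕ) : fracBinom α n = Ring.choose α n := by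
  induction n with
  | zero => simp [fracBinom]
  | succ n ih =>
    have h1 := Ring.descPochhammer_eq_factorial_smul_choose α n
    have h2 := Ring.descPochhammer_eq_factorial_smul_choose α (n + 1)
    rw [descPochhammer_succ_right, Polynomial.smeval_mul, h1] at h2
    simp only [Polynomial.smeval_sub, Polynomial.smeval_X, Polynomial.smeval_natCast, pow_one,
      pow_zero, nsmul_eq_mul, mul_one, Nat.factorial_succ, Nat.cast_mul, Nat.cast_succ] at h2
    rw [fracBinom, ih]
    have : (n.factorial : ℝ) ≠ 0 := by positivity
    rw [div_eq_iff (by positivity)]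
    apply mul_left_cancel₀ this
    linear_combination h2

theorem hasSum_dcoef_of_norm_lt_one (α : ℝ) {z : ℂ} (hz : ‖z‖ < 1) :
    HasSum (fun j => (dcoef α j : ℂ) * z ^ j) ((1 - z) ^ (α : ℂ)) := by
  have h := (Complex.one_add_cpow_hasFPowerSeriesOnBall_zero (a := (α : ℂ))).hasSum (y := -z)
    (by
      rw [← ENNReal.ofReal_one, Metric.eball_ofReal]
      simpa using hz)
  have he : ∀ j, (dcoef α j : ℂ) * z ^ j = (binomialSeries ℂ (α : ℂ) j) fun _ => -z := by
    intro j
    rw [binomialSeries_apply, ← Complex.ofReal_choose, ← fracBinom_eq_choose]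
    simp [dcoef, neg_pow z]
    ring
  simp only [he]
  simpa [← sub_eq_add_neg] using h

theorem tsum_dcoef_mul_pow {α : ℝ} (hα : 0 < α) {z : ℂ} (hz : ‖z‖ = 1) :
    ∑' j, (dcoef α j : ℂ) * z ^ j = (1 - z) ^ (α : ℂ) := by
  have h1 : Filter.Tendsto (fun r : ℝ => ∑' j, (dcoef α j : ℂ) * (r * z) ^ j)
      (nhdsWithin 1 (Set.Ioo 0 1)) (nhds (∑' j, (dcoef α j : ℂ) * z ^ j)) := by
    refine tendsto_tsum_of_dominated_convergence (summable_abs_dcoef hα) ?_ ?_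
    · intro j
      have : Continuous fun r : ℝ => (dcoef α j : ℂ) * (r * z) ^ j := by fun_prop
      simpa using (this.tendsto 1).mono_left nhdsWithin_le_nhds
    · filter_upwards [self_mem_nhdsWithin] with r hr j
      rw [norm_mul, Complex.norm_real, norm_pow, norm_mul, hz, Complex.norm_real, mul_one]
      refine mul_le_of_le_one_right (norm_nonneg _) (pow_le_one₀ (norm_nonneg _) ?_)
      rw [norm_eq_abs, abs_of_pos hr.1]; exact hr.2.le
  have h2 : Filter.Tendsto (fun r : ℝ => (1 - r * z) ^ (α : ℂ))
      (nhdsWithin 1 (Set.Ioo 0 1)) (nhds ((1 - z) ^ (α : ℂ))) := by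
    have hc : ContinuousAt (fun w : ℂ => w ^ (α : ℂ)) (1 - z) := by
      by_cases h : z = 1
      · subst h
        rw [sub_self]
        exact ContinuousAt.comp (f := fun w : ℂ => (w, (α : ℂ)))
          (Complex.continuousAt_cpow_zero_of_re_pos (z := (α : ℂ)) (by simpa using hα))
          (by fun_prop)
      · apply continuousAt_cpow_const
        left
        have h1 := Complex.re_le_norm z
        rw [hz] at h1
        rcases h1.lt_or_eq with h1 | h1
        · simpa using h1
        · exfalso; apply h
          have := Complex.sq_norm_sub_sq_re z
          rw [hz, h1] at this
          have him : z.im = 0 := by nlinarith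
          exact Complex.ext (by simpa using h1) (by simpa using him)
    have hr : Filter.Tendsto (fun r : ℝ => 1 - (r : ℂ) * z) (nhdsWithin 1 (Set.Ioo 0 1))
        (nhds (1 - z)) := by
      have : Continuous fun r : ℝ => 1 - (r : ℂ) * z := by fun_prop
      simpa using (this.tendsto 1).mono_left nhdsWithin_le_nhds
    exact hc.tendsto.comp hr
  have : (nhdsWithin (1 : ℝ) (Set.Ioo 0 1)).NeBot := by
    rw [← mem_closure_iff_nhdsWithin_neBot, closure_Ioo (by norm_num)]
    simp
  refine tendsto_nhds_unique (h1.congr' ?_) h2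
  filter_upwards [self_mem_nhdsWithin] with r hr
  apply (hasSum_dcoef_of_norm_lt_one α _).tsum_eq
  rw [norm_mul, hz, Complex.norm_real, norm_eq_abs, abs_of_pos hr.1, mul_one]
  exact hr.2

theorem summable_dcoef_mul {α : ℝ} (hα : 0 < α) {v : ℕ → ℝ} {B : ℝ} (hv : ∀ j, |v j| ≤ B) :
    Summable fun j => dcoef α j * v j := by
  refine Summable.of_norm_bounded ((summable_abs_dcoef hα).mul_right B) fun j => ?_
  rw [norm_mul, norm_eq_abs, norm_eq_abs]
  exact mul_le_mul_of_nonneg_left (hv j) (abs_nonneg _)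

theorem abs_tsum_dcoef_mul_le {α : ℝ} (hα : 0 < α) {v : ℕ → ℝ} {B : ℝ} (hv : ∀ j, |v j| ≤ B) :
    |∑' j, dcoef α j * v j| ≤ dmass α * B := by
  have hs := (summable_abs_dcoef hα).mul_right B
  rw [dmass, ← tsum_mul_right]
  refine tsum_of_norm_bounded (f := fun j => dcoef α j * v j) hs.hasSum fun j => ?_
  rw [norm_mul, norm_eq_abs, norm_eq_abs]
  exact mul_le_mul_of_nonneg_left (hv j) (abs_nonneg _)

theorem one_sub_exp_cpow {α θ : ℝ} (hα : 0 < α) (h0 : 0 ≤ θ) (h1 : θ < 2 * π) :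
    (1 - Complex.exp (-(θ * Complex.I))) ^ (α : ℂ)
      = ((2 * sin (θ / 2)) ^ α : ℝ) * Complex.exp ((α * (π - θ) / 2 : ℝ) * Complex.I) := by
  rcases h0.eq_or_lt with rfl | h0
  · simp [hα.ne', Real.zero_rpow]
  have hs : 0 < 2 * sin (θ / 2) := by
    have := sin_pos_of_pos_of_lt_pi (x := θ / 2) (by linarith) (by linarith)
    linarith
  have key : 1 - Complex.exp (-(θ * Complex.I))
      = (2 * sin (θ / 2) : ℝ) * Complex.exp (((π - θ) / 2 : ℝ) * Complex.I) := by
    have e1 : Complex.exp (-(θ * Complex.I)) = Complex.exp (-(θ / 2 * Complex.I))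
        * Complex.exp (-(θ / 2 * Complex.I)) := by rw [← Complex.exp_add]; congr 1; ring
    have e2 : (1 : ℂ) = Complex.exp (θ / 2 * Complex.I) * Complex.exp (-(θ / 2 * Complex.I)) := by
      rw [← Complex.exp_add]; simp
    have e3 : Complex.exp (((π - θ) / 2 : ℝ) * Complex.I)
        = Complex.I * Complex.exp (-(θ / 2 * Complex.I)) := by
      nth_rewrite 2 [← Complex.exp_pi_div_two_mul_I]
      rw [← Complex.exp_add]
      congr 1; push_cast; ring
    rw [e3, e1]
    nth_rewrite 1 [e2]
    push_cast
    rw [Complex.sin]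
    have : Complex.I * Complex.I = -1 := Complex.I_mul_I
    simp only [neg_mul]
    linear_combination (Complex.exp (θ / 2 * Complex.I) - Complex.exp (-(θ / 2 * Complex.I))) *
      Complex.exp (-(θ / 2 * Complex.I)) * (this)
  have hs' : ((2 * sin (θ / 2) : ℝ) : ℂ) ≠ 0 := by exact_mod_cast hs.ne'
  rw [key, Complex.cpow_def_of_ne_zero (mul_ne_zero hs' (Complex.exp_ne_zero _)),
    Complex.log_ofReal_mul hs (Complex.exp_ne_zero _), Complex.log_exp, add_mul, Complex.exp_add,
    ← Complex.ofReal_mul, ← Complex.ofReal_exp, ← Real.rpow_def_of_pos hs]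
  · congr 2; push_cast; ring
  · simp only [Complex.mul_im, Complex.ofReal_re, Complex.I_im, Complex.ofReal_im, Complex.I_re]
    linarith
  · simp only [Complex.mul_im, Complex.ofReal_re, Complex.I_im, Complex.ofReal_im, Complex.I_re]
    linarith

/-- Action of the fractional difference on a single frequency. -/
theorem tsum_dcoef_mul_cos {α θ : ℝ} (hα : 0 < α) (h0 : 0 ≤ θ) (h1 : θ < 2 * π) (ψ : ℝ) :
    ∑' j : ℕ, dcoef α j * cos (ψ + (α - j) * θ)
      = (2 * sin (θ / 2)) ^ α * cos (ψ + α * θ / 2 + α * π / 2) := by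
  have h := tsum_dcoef_mul_pow hα (z := Complex.exp (-(θ * Complex.I)))
    (by rw [← neg_mul, ← Complex.ofReal_neg, Complex.norm_exp_ofReal_mul_I])
  rw [one_sub_exp_cpow hα h0 h1] at h
  have h2 : ∑' j, (dcoef α j : ℂ) * Complex.exp ((ψ + (α - j) * θ : ℝ) * Complex.I)
      = ((2 * sin (θ / 2)) ^ α : ℝ)
        * Complex.exp ((ψ + α * θ / 2 + α * π / 2 : ℝ) * Complex.I) := by
    calc _ = Complex.exp ((ψ + α * θ : ℝ) * Complex.I)
          * ∑' j, (dcoef α j : ℂ) * Complex.exp (-(θ * Complex.I)) ^ j := by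
          rw [← tsum_mul_left]
          congr 1; ext j
          rw [← Complex.exp_nat_mul, mul_left_comm, ← Complex.exp_add]
          congr 2; push_cast; ring
      _ = _ := by
          rw [h, mul_left_comm, ← Complex.exp_add]
          congr 2; push_cast; ring
  have hsum : Summable fun j : ℕ =>
      (dcoef α j : ℂ) * Complex.exp ((ψ + (α - j) * θ : ℝ) * Complex.I) := by
    refine Summable.of_norm_bounded (summable_abs_dcoef hα) fun j => ?_
    rw [norm_mul, Complex.norm_exp_ofReal_mul_I, mul_one, Complex.norm_real, norm_eq_abs]
  have h3 := congrArg Complex.re h2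
  rw [Complex.re_tsum hsum] at h3
  simpa only [Complex.re_ofReal_mul, Complex.exp_ofReal_mul_I_re] using h3

/-! ### Fractional differences of Dirichlet kernels -/

theorem abs_sum_cos_mul_sin_le (φ z : ℝ) (k : ℕ) :
    |∑ ν ∈ Finset.range k, cos (φ + ν * z)| * |sin (z / 2)| ≤ 1 := by
  have key : ∀ k : ℕ, (∑ ν ∈ Finset.range k, cos (φ + ν * z)) * (2 * sin (z / 2))
      = sin (φ + k * z - z / 2) - sin (φ - z / 2) := by
    intro k
    induction k with
    | zero => simp
    | succ k ih =>
      rw [Finset.sum_range_succ, add_mul, ih]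
      have e : φ + ((k + 1 : ℕ) : ℝ) * z - z / 2 = (φ + k * z) + z / 2 := by push_cast; ring
      rw [e, sin_add, sin_sub (φ + k * z)]
      ring
  have h := congrArg abs (key k)
  rw [abs_mul, abs_mul, abs_two] at h
  have h2 : |sin (φ + k * z - z / 2) - sin (φ - z / 2)| ≤ 1 + 1 :=
    (abs_sub _ _).trans (add_le_add (abs_sin_le_one _) (abs_sin_le_one _))
  linarith

/-- Summation by parts with an increasing multiplier. -/
theorem abs_sum_mul_le_of_monotone {μ b : ℕ → ℝ} {β : ℝ} (k : ℕ) (hμ0 : 0 ≤ μ 0)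
    (hμ : ∀ i < k, μ i ≤ μ (i + 1)) (hb : ∀ i, |∑ ν ∈ Finset.range i, b ν| ≤ β) :
    |∑ ν ∈ Finset.range (k + 1), μ ν * b ν| ≤ 2 * μ k * β := by
  have hβ : 0 ≤ β := (abs_nonneg _).trans (hb 0)
  have key : ∀ i ≤ k, 0 ≤ μ i ∧ |μ i * ∑ ν ∈ Finset.range i, b ν
      - ∑ ν ∈ Finset.range i, μ ν * b ν| ≤ (μ i - μ 0) * β := by
    intro i hi
    induction i with
    | zero => simp [hμ0]
    | succ i ih =>
      obtain ⟨h0, h1⟩ := ih (by omega)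
      have h2 := hμ i (by omega)
      refine ⟨h0.trans h2, ?_⟩
      have e : μ (i + 1) * ∑ ν ∈ Finset.range (i + 1), b ν
          - ∑ ν ∈ Finset.range (i + 1), μ ν * b ν
          = (μ (i + 1) - μ i) * ∑ ν ∈ Finset.range (i + 1), b ν + (μ i * ∑ ν ∈ Finset.range i, b ν
            - ∑ ν ∈ Finset.range i, μ ν * b ν) := by
        simp only [Finset.sum_range_succ]; ring
      rw [e]
      refine (abs_add_le _ _).trans ?_
      rw [abs_mul, abs_of_nonneg (by linarith : 0 ≤ μ (i + 1) - μ i)]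
      have := mul_le_mul_of_nonneg_left (hb (i + 1)) (by linarith : 0 ≤ μ (i + 1) - μ i)
      linarith
  obtain ⟨h0, h1⟩ := key k le_rfl
  have e : ∑ ν ∈ Finset.range (k + 1), μ ν * b ν = μ k * ∑ ν ∈ Finset.range (k + 1), b ν
      - (μ k * ∑ ν ∈ Finset.range k, b ν - ∑ ν ∈ Finset.range k, μ ν * b ν) := by
    simp only [Finset.sum_range_succ]; ring
  rw [e]
  refine (abs_sub _ _).trans ?_
  rw [abs_mul, abs_of_nonneg h0]
  have := mul_le_mul_of_nonneg_left (hb (k + 1)) h0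
  have := mul_nonneg hμ0 hβ
  linarith

theorem ofReal_abs_le_mul_dker {E c x : ℝ} {k : ℕ} (hc : 0 ≤ c) (h1 : |E| ≤ c * (k + 1))
    (h2 : |E| * |sin (x / 2)| ≤ c) :
    ENNReal.ofReal |E| ≤ ENNReal.ofReal c * (((k : ℝ≥0∞) + 1) * dker k x) := by
  have hk : (k : ℝ≥0∞) + 1 = ENNReal.ofReal (k + 1) := by
    rw [ENNReal.ofReal_add (by positivity) zero_le_one]; simp
  unfold dker
  rw [hk, mul_min, mul_min, le_min_iff]
  constructor
  · rw [mul_one, ← ENNReal.ofReal_mul hc]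
    exact ENNReal.ofReal_le_ofReal h1
  · by_cases hs : |sin (x / 2)| = 0
    · rw [hs, mul_zero, ENNReal.ofReal_zero, ENNReal.inv_zero, ENNReal.mul_top
        (by rw [Ne, ENNReal.ofReal_eq_zero]; push Not; positivity)]
      rcases hc.eq_or_lt with rfl | hc
      · have : |E| = 0 := le_antisymm (by simpa using h1) (abs_nonneg _)
        simp [this]
      · rw [ENNReal.mul_top (by simpa using hc)]; exact le_top
    · have hs' : 0 < |sin (x / 2)| := lt_of_le_of_ne (abs_nonneg _) (Ne.symm hs)
      have hk0 : (0 : ℝ) < k + 1 := by positivity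
      rw [← ENNReal.ofReal_inv_of_pos (by positivity), ← ENNReal.ofReal_mul hk0.le,
        ← ENNReal.ofReal_mul hc]
      apply ENNReal.ofReal_le_ofReal
      have : c * ((k + 1) * ((k + 1) * |sin (x / 2)|)⁻¹) = c / |sin (x / 2)| := by
        field_simp
      rw [this, le_div_iff₀ hs']
      exact h2

/-- The modified Dirichlet kernel `∑_{ν=1}^{k+1} cos νx`. -/
def dirk (k : ℕ) (x : ℝ) : ℝ := ∑ ν ∈ Finset.range (k + 1), cos (((ν : ℝ) + 1) * x)

theorem dirk_neg (k : ℕ) (x : ℝ) : dirk k (-x) = dirk k x := by simp [dirk]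

theorem continuous_dirk (k : ℕ) : Continuous (dirk k) := by unfold dirk; fun_prop

theorem abs_dirk_le (k : ℕ) (x : ℝ) : |dirk k x| ≤ k + 1 := by
  refine (Finset.abs_sum_le_sum_abs _ _).trans ?_
  refine (Finset.sum_le_sum fun _ _ => abs_cos_le_one _).trans ?_
  simp

theorem dker_neg (k : ℕ) (x : ℝ) : dker k (-x) = dker k x := by
  unfold dker; rw [neg_div, sin_neg, abs_neg]

/-- A block of frequencies `m, …, i` with a common phase. -/
def block (m i : ℕ) (φ x : ℝ) : ℝ := ∑ ν ∈ Finset.Icc m i, cos (((ν : ℝ) + 1) * x + φ)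

theorem ofReal_abs_block_le (m i : ℕ) (φ x : ℝ) :
    ENNReal.ofReal |block m i φ x| ≤ ((i : ℝ≥0∞) + 1) * dker i x := by
  have e : block m i φ x
      = ∑ ν ∈ Finset.range (i + 1 - m), cos (((m + 1) * x + φ) + ν * x) := by
    rw [block, ← Finset.Ico_succ_right_eq_Icc, Finset.sum_Ico_eq_sum_range]
    apply Finset.sum_congr rfl
    intro ν _
    congr 1; push_cast; ring
  have := ofReal_abs_le_mul_dker (E := block m i φ x) (k := i) (x := x) zero_le_one (by
    rw [e]
    refine (Finset.abs_sum_le_sum_abs _ _).trans ?_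
    refine (Finset.sum_le_sum fun _ _ => abs_cos_le_one _).trans ?_
    have : ((i + 1 - m : ℕ) : ℝ) ≤ ((i + 1 : ℕ) : ℝ) := by exact_mod_cast Nat.sub_le _ _
    push_cast at this
    simpa using this) (by rw [e]; exact abs_sum_cos_mul_sin_le _ _ _)
  simpa using this

theorem dirk_eq_block (k : ℕ) (x : ℝ) : dirk k x = block 0 k 0 x := by
  have : Finset.range (k + 1) = Finset.Icc 0 k := by ext; simp
  simp [dirk, block, this]

theorem ofReal_abs_dirk_le (k : ℕ) (x : ℝ) :
    ENNReal.ofReal |dirk k x| ≤ ((k : ℝ≥0∞) + 1) * dker k x := by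
  rw [dirk_eq_block]; exact ofReal_abs_block_le _ _ _ _

/-- The fractional difference of the modified Dirichlet kernel. -/
def diffDirk (α h : ℝ) (k : ℕ) (x : ℝ) : ℝ := ∑' j : ℕ, dcoef α j * dirk k (x + (α - j) * h)

theorem diffDirk_eq {α h : ℝ} (hα : 0 < α) (hh : 0 ≤ h) {k : ℕ} (hk : ((k : ℝ) + 1) * h ≤ 1)
    (x : ℝ) : diffDirk α h k x = ∑ ν ∈ Finset.range (k + 1),
      (2 * sin (((ν : ℝ) + 1) * h / 2)) ^ α
        * cos ((x + α * h / 2 + α * π / 2) + ν * (x + α * h / 2)) := by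
  have h1 : ∀ ν ∈ Finset.range (k + 1), Summable fun j : ℕ =>
      dcoef α j * cos (((ν : ℝ) + 1) * (x + (α - j) * h)) := fun ν _ =>
    summable_dcoef_mul hα fun _ => abs_cos_le_one _
  simp only [diffDirk, dirk, Finset.mul_sum]
  rw [Summable.tsum_finsetSum h1]
  apply Finset.sum_congr rfl
  intro ν hν
  have hν' : (ν : ℝ) ≤ k := by
    rw [Finset.mem_range] at hν; exact_mod_cast (by omega : ν ≤ k)
  have hle : ((ν : ℝ) + 1) * h ≤ 1 := le_trans (by gcongr) hk
  have := tsum_dcoef_mul_cos hα (θ := ((ν : ℝ) + 1) * h) (by positivity)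
    (by linarith [pi_gt_three]) (((ν : ℝ) + 1) * x)
  have e : x + α * h / 2 + α * π / 2 + ν * (x + α * h / 2)
      = ((ν : ℝ) + 1) * x + α * (((ν : ℝ) + 1) * h) / 2 + α * π / 2 := by ring
  rw [e, ← this]
  congr 1; ext j; congr 2; ring

theorem diffDirk_neg (α h : ℝ) (k : ℕ) (x : ℝ) : diffDirk α (-h) k x = diffDirk α h k (-x) := by
  unfold diffDirk
  congr 1; ext j
  rw [← dirk_neg]; congr 2; ring

theorem ofReal_abs_diffDirk_le_low {α h : ℝ} (hα : 0 < α) {k : ℕ}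
    (hk : ((k : ℝ) + 1) * |h| ≤ 1) (x : ℝ) : ENNReal.ofReal |diffDirk α h k x|
      ≤ ENNReal.ofReal (2 * (((k : ℝ) + 1) * |h|) ^ α)
        * (((k : ℝ≥0∞) + 1) * dker k (x + α * h / 2)) := by
  wlog hh : 0 ≤ h generalizing h x
  · have := this (h := -h) (by rwa [abs_neg]) (-x) (by linarith)
    rw [diffDirk_neg, neg_neg, abs_neg] at this
    rw [← dker_neg]
    convert this using 4
    ring
  rw [abs_of_nonneg hh] at hk ⊢
  have hpi := pi_gt_three
  set z := x + α * h / 2 with hz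
  set μ : ℕ → ℝ := fun ν => (2 * sin (((ν : ℝ) + 1) * h / 2)) ^ α with hμ
  have hsin : ∀ ν ≤ k, 0 ≤ 2 * sin (((ν : ℝ) + 1) * h / 2) ∧
      2 * sin (((ν : ℝ) + 1) * h / 2) ≤ ((k : ℝ) + 1) * h := by
    intro ν hν
    have hν' : (ν : ℝ) ≤ k := by exact_mod_cast hν
    have hle : ((ν : ℝ) + 1) * h ≤ ((k : ℝ) + 1) * h := by gcongr
    have h0 : 0 ≤ ((ν : ℝ) + 1) * h / 2 := by positivity
    exact ⟨mul_nonneg zero_le_two (sin_nonneg_of_nonneg_of_le_pi h0 (by linarith)),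
      by linarith [sin_le h0]⟩
  have hμ0 : ∀ ν ≤ k, 0 ≤ μ ν := fun ν hν => Real.rpow_nonneg (hsin ν hν).1 _
  have hμ1 : ∀ ν ≤ k, μ ν ≤ (((k : ℝ) + 1) * h) ^ α := fun ν hν =>
    Real.rpow_le_rpow (hsin ν hν).1 (hsin ν hν).2 hα.le
  have hmono : ∀ i < k, μ i ≤ μ (i + 1) := by
    intro i hi
    apply Real.rpow_le_rpow (hsin i hi.le).1 _ hα.le
    have hi' : ((i : ℝ) + 1) ≤ k := by exact_mod_cast hi
    have hle : ((i : ℝ) + 1 + 1) * h ≤ ((k : ℝ) + 1) * h := by gcongr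
    have h0 : 0 ≤ ((i : ℝ) + 1) * h := by positivity
    push_cast
    gcongr
    apply sin_le_sin_of_le_of_le_pi_div_two
    · linarith
    · linarith
    · gcongr; linarith
  set M := (((k : ℝ) + 1) * h) ^ α with hM
  have hM0 : 0 ≤ M := by positivity
  rw [diffDirk_eq hα hh hk]
  apply ofReal_abs_le_mul_dker (by positivity)
  · refine (Finset.abs_sum_le_sum_abs _ _).trans ?_
    calc _ ≤ ∑ ν ∈ Finset.range (k + 1), M := by
          apply Finset.sum_le_sum
          intro ν hν
          have hν : ν ≤ k := by rw [Finset.mem_range] at hν; omega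
          rw [abs_mul, abs_of_nonneg (hμ0 ν hν)]
          exact (mul_le_of_le_one_right (hμ0 ν hν) (abs_cos_le_one _)).trans (hμ1 ν hν)
      _ = M * (k + 1) := by simp; ring
      _ ≤ _ := by nlinarith [Nat.cast_nonneg (α := ℝ) k]
  · have := abs_sum_mul_le_of_monotone (μ := μ) (β := 1)
      (b := fun ν => cos ((z + α * π / 2) + ν * z) * |sin (z / 2)|) k (hμ0 0 (Nat.zero_le _)) hmono
      (fun i => by
        rw [← Finset.sum_mul, abs_mul, abs_abs]; exact abs_sum_cos_mul_sin_le _ _ _)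
    simp only [← mul_assoc] at this
    rw [← Finset.sum_mul, abs_mul, abs_abs] at this
    linarith [hμ1 k le_rfl]

theorem ofReal_abs_diffDirk_le {α h : ℝ} (hα : 0 < α) (k : ℕ) (x : ℝ) :
    ENNReal.ofReal |diffDirk α h k x| ≤ ∑' j : ℕ, ENNReal.ofReal |dcoef α j| *
      (((k : ℝ≥0∞) + 1) * dker k (x + (α - j) * h)) := by
  have hs := summable_dcoef_mul hα (v := fun j => dirk k (x + (α - j) * h)) fun j => abs_dirk_le _ _
  calc _ ≤ ENNReal.ofReal (∑' j : ℕ, |dcoef α j * dirk k (x + (α - j) * h)|) := by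
        apply ENNReal.ofReal_le_ofReal
        exact norm_tsum_le_tsum_norm hs.norm
    _ = ∑' j : ℕ, ENNReal.ofReal |dcoef α j * dirk k (x + (α - j) * h)| :=
        ENNReal.ofReal_tsum_of_nonneg (fun _ => abs_nonneg _) hs.abs
    _ ≤ _ := by
        gcongr with j
        rw [abs_mul, ENNReal.ofReal_mul (abs_nonneg _)]
        gcongr
        exact ofReal_abs_dirk_le _ _

/-- The weights `min((i+1)/n, 1)^α`. -/
def wgt (α : ℝ) (n i : ℕ) : ℝ := (min (((i : ℝ) + 1) / n) 1) ^ α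

theorem wgt_pos {α : ℝ} {n : ℕ} (hn : 1 ≤ n) (i : ℕ) : 0 < wgt α n i := by
  have : (0 : ℝ) < n := by exact_mod_cast hn
  exact Real.rpow_pos_of_pos (lt_min (by positivity) one_pos) _

theorem wgt_le_one {α : ℝ} (hα : 0 < α) {n : ℕ} (i : ℕ) : wgt α n i ≤ 1 :=
  Real.rpow_le_one (le_min (by positivity) zero_le_one) (min_le_right _ _) hα.le

theorem wgt_doubling {α : ℝ} (hα : 0 < α) {n : ℕ} {i k : ℕ} (h : k + 1 ≤ 2 * (i + 1)) :
    wgt α n k ≤ 2 ^ α * wgt α n i := by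
  unfold wgt
  rw [← Real.mul_rpow (by norm_num) (le_min (by positivity) zero_le_one)]
  apply Real.rpow_le_rpow (le_min (by positivity) zero_le_one) _ hα.le
  have h' : (k : ℝ) + 1 ≤ 2 * (i + 1) := by exact_mod_cast h
  rw [mul_min_of_nonneg _ _ (by norm_num : (0 : ℝ) ≤ 2)]
  apply min_le_min
  · rw [← mul_div_assoc]; gcongr
  · norm_num

/-- The majorant of the differences of the Dirichlet kernels. -/
def diffKer (α h : ℝ) (i : ℕ) (x : ℝ) : ℝ≥0∞ :=
  dker i (x + α * h / 2) + ∑' j : ℕ, ENNReal.ofReal |dcoef α j| * dker i (x + (α - j) * h)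

theorem exists_tbound_diffKer {p α : ℝ} (hp : 1 < p) (hα : 0 < α) :
    ∃ C ≠ (⊤ : ℝ≥0∞), ∀ h, TBound p C (diffKer α h) := by
  obtain ⟨C, hC, hT⟩ := exists_tbound_dker hp
  refine ⟨_, ?_, fun h => TBound.add hp (hT.shift dker_periodic (α * h / 2))
    (hT.average hp dker_periodic (fun j => ENNReal.ofReal |dcoef α j|) fun j => (α - j) * h)⟩ 
  rw [tsum_ofReal_abs_dcoef hα]
  have hp' : 0 ≤ p - 1 := by linarith
  refine ENNReal.mul_ne_top (ENNReal.rpow_ne_top_of_nonneg hp' (by simp)) ?_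
  refine ENNReal.add_ne_top.2 ⟨hC, ENNReal.mul_ne_top (ENNReal.mul_ne_top ?_ (by simp)) hC⟩
  exact ENNReal.rpow_ne_top_of_nonneg hp' (by simp)

theorem ofReal_abs_diffDirk_le_sum {α h : ℝ} (hα : 0 < α) {n : ℕ} (hn : 1 ≤ n)
    (hh : |h| ≤ 1 / n) (k : ℕ) (x : ℝ) : ENNReal.ofReal |diffDirk α h k x|
      ≤ 4 * ENNReal.ofReal (2 ^ α) * ∑ i ∈ Finset.range (k + 1),
        ENNReal.ofReal (wgt α n i) * diffKer α h i x := by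
  have hn0 : (0 : ℝ) < n := by exact_mod_cast hn
  have hd : ∀ i ≤ k, k + 1 ≤ 2 * (i + 1) →
      ENNReal.ofReal (wgt α n k) ≤ ENNReal.ofReal (2 ^ α) * ENNReal.ofReal (wgt α n i) := by
    intro i _ hi
    rw [← ENNReal.ofReal_mul (by positivity)]
    exact ENNReal.ofReal_le_ofReal (wgt_doubling hα hi)
  have h1 : ∀ y, ENNReal.ofReal (wgt α n k) * (((k : ℝ≥0∞) + 1) * dker k y)
      ≤ 2 * ENNReal.ofReal (2 ^ α) * ∑ i ∈ Finset.range (k + 1),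
        ENNReal.ofReal (wgt α n i) * dker i y := fun y => mul_dker_le_sum y hd
  have h2 : ENNReal.ofReal |diffDirk α h k x| ≤ 2 * (ENNReal.ofReal (wgt α n k) *
      (((k : ℝ≥0∞) + 1) * dker k (x + α * h / 2))) +
      2 * ∑' j : ℕ, ENNReal.ofReal |dcoef α j| * (ENNReal.ofReal (wgt α n k) *
      (((k : ℝ≥0∞) + 1) * dker k (x + (α - j) * h))) := by
    by_cases hkn : k + 1 ≤ n
    · have hkn' : (k : ℝ) + 1 ≤ n := by exact_mod_cast hkn
      have hle : ((k : ℝ) + 1) * |h| ≤ ((k : ℝ) + 1) / n := by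
        rw [div_eq_mul_one_div]; gcongr
      have hle1 : ((k : ℝ) + 1) / n ≤ 1 := (div_le_one hn0).2 hkn'
      refine le_add_right ((ofReal_abs_diffDirk_le_low hα (hle.trans hle1) x).trans ?_)
      rw [ENNReal.ofReal_mul (by norm_num), mul_assoc]
      have : wgt α n k = (((k : ℝ) + 1) / n) ^ α := by rw [wgt, min_eq_left hle1]
      rw [this]
      simp only [ENNReal.ofReal_ofNat]
      gcongr
    · have hkn' : (n : ℝ) ≤ k + 1 := by push Not at hkn; exact_mod_cast hkn.le
      have : wgt α n k = 1 := by
        rw [wgt, min_eq_right ((one_le_div hn0).2 hkn'), Real.one_rpow]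
      rw [this]
      simp only [ENNReal.ofReal_one, one_mul]
      refine le_add_left ((ofReal_abs_diffDirk_le hα k x).trans ?_)
      exact le_mul_of_one_le_left' one_le_two
  refine h2.trans ?_
  calc _ ≤ 2 * (2 * ENNReal.ofReal (2 ^ α) * ∑ i ∈ Finset.range (k + 1),
        ENNReal.ofReal (wgt α n i) * dker i (x + α * h / 2)) +
      2 * ∑' j : ℕ, ENNReal.ofReal |dcoef α j| * (2 * ENNReal.ofReal (2 ^ α) *
        ∑ i ∈ Finset.range (k + 1), ENNReal.ofReal (wgt α n i) * dker i (x + (α - j) * h)) := by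
        refine add_le_add (mul_le_mul' le_rfl (h1 _)) (mul_le_mul' le_rfl ?_)
        exact ENNReal.tsum_le_tsum fun j => mul_le_mul' le_rfl (h1 _)
    _ = _ := by
        have : ∑' j : ℕ, ENNReal.ofReal |dcoef α j| * (2 * ENNReal.ofReal (2 ^ α) *
            ∑ i ∈ Finset.range (k + 1), ENNReal.ofReal (wgt α n i) * dker i (x + (α - j) * h))
            = 2 * ENNReal.ofReal (2 ^ α) * ∑ i ∈ Finset.range (k + 1), ENNReal.ofReal (wgt α n i) *
              ∑' j : ℕ, ENNReal.ofReal |dcoef α j| * dker i (x + (α - j) * h) := by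
          simp only [← ENNReal.tsum_mul_left]
          rw [← Summable.tsum_finsetSum (fun _ _ => ENNReal.summable), ← ENNReal.tsum_mul_left]
          congr 1; ext j
          simp only [Finset.mul_sum]
          apply Finset.sum_congr rfl
          intro i _; ring
        rw [this]
        simp only [diffKer, mul_add, Finset.sum_add_distrib]
        ring

/-! ### Periodic functions of two variables and their pairings -/

instance isFiniteMeasure_circ : IsFiniteMeasure circ := by unfold circ; infer_instance

/-- Lebesgue measure on the period square. -/
def torus : Measure (ℝ × ℝ) := circ.prod circ

instance isFiniteMeasure_torus : IsFiniteMeasure torus := by unfold torus; infer_instance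

/-- Measurable, doubly periodic and integrable functions. -/
structure Nice (v : ℝ → ℝ → ℝ) : Prop where
  meas : Measurable (Function.uncurry v)
  per_x : ∀ y, Function.Periodic (fun x => v x y) (2 * π)
  per_y : ∀ x, Function.Periodic (v x) (2 * π)
  int : Integrable (Function.uncurry v) torus

/-- Continuous periodic test functions bounded by one. -/
structure TestFun (φ : ℝ → ℝ) : Prop where
  cont : Continuous φ
  le_one : ∀ x, |φ x| ≤ 1
  per : Function.Periodic φ (2 * π)

/-- The integral of `v` against a product function. -/
def pair (v : ℝ → ℝ → ℝ) (φ ψ : ℝ → ℝ) : ℝ := ∫ z, v z.1 z.2 * (φ z.1 * ψ z.2) ∂torus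

theorem Nice.flip {v : ℝ → ℝ → ℝ} (hv : Nice v) : Nice (fun x y => v y x) where
  meas := hv.meas.comp measurable_swap
  per_x := hv.per_y
  per_y := hv.per_x
  int := hv.int.swap

theorem pair_flip (v : ℝ → ℝ → ℝ) (φ ψ : ℝ → ℝ) :
    pair (fun x y => v y x) φ ψ = pair v ψ φ := by
  unfold pair torus
  rw [← integral_prod_swap]
  congr 1; ext z
  simp only [Prod.fst_swap, Prod.snd_swap]
  ring

theorem TestFun.comp_add {φ : ℝ → ℝ} (hφ : TestFun φ) (s : ℝ) : TestFun (fun x => φ (x + s)) where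
  cont := hφ.cont.comp (by fun_prop)
  le_one x := hφ.le_one _
  per x := by
    have := hφ.per (x + s)
    simp only at this ⊢
    rw [← this]; congr 1; ring

theorem Nice.integrable_mul {v : ℝ → ℝ → ℝ} (hv : Nice v) {φ ψ : ℝ → ℝ} (hφ : TestFun φ)
    (hψ : TestFun ψ) : Integrable (fun z : ℝ × ℝ => v z.1 z.2 * (φ z.1 * ψ z.2)) torus := by
  refine hv.int.mul_bdd (c := 1) ?_ (Filter.Eventually.of_forall fun z => ?_)
  · exact ((hφ.cont.comp continuous_fst).mul (hψ.cont.comp continuous_snd)).aestronglyMeasurable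
  · rw [norm_mul, norm_eq_abs, norm_eq_abs]
    exact mul_le_one₀ (hφ.le_one _) (abs_nonneg _) (hψ.le_one _)

theorem lintegral_torus_shift {G : ℝ × ℝ → ℝ≥0∞} (hG : Measurable G)
    (hper : ∀ y, Function.Periodic (fun x => G (x, y)) (2 * π)) (s : ℝ) :
    ∫⁻ z, G (z.1 + s, z.2) ∂torus = ∫⁻ z, G z ∂torus := by
  have hG' : Measurable fun z : ℝ × ℝ => G (z.1 + s, z.2) := hG.comp (by fun_prop)
  unfold torus
  rw [lintegral_prod_symm _ hG'.aemeasurable, lintegral_prod_symm _ hG.aemeasurable]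
  congr 1; ext y
  exact lintegral_circ_shift (hper y) s

theorem integral_circ_shift {F : ℝ → ℝ} (hF : Function.Periodic F (2 * π)) (s : ℝ) :
    ∫ x, F (x + s) ∂circ = ∫ x, F x ∂circ := by
  unfold circ
  rw [← intervalIntegral.integral_of_le two_pi_pos.le,
    ← intervalIntegral.integral_of_le two_pi_pos.le,
    intervalIntegral.integral_comp_add_right F s, zero_add, add_comm,
    hF.intervalIntegral_add_eq s 0, zero_add]

theorem integrable_torus_shift {G : ℝ × ℝ → ℝ} (hm : Measurable G)
    (hper : ∀ y, Function.Periodic (fun x => G (x, y)) (2 * π)) (hG : Integrable G torus) (s : ℝ) :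
    Integrable (fun z : ℝ × ℝ => G (z.1 + s, z.2)) torus := by
  refine ⟨(hm.comp (by fun_prop)).aestronglyMeasurable, ?_⟩
  have := lintegral_torus_shift (G := fun z => ‖G z‖ₑ) hm.enorm (fun y x => by simp [hper y x]) s
  rw [HasFiniteIntegral, this]
  exact hG.2

theorem integral_torus_shift {G : ℝ × ℝ → ℝ} (hm : Measurable G)
    (hper : ∀ y, Function.Periodic (fun x => G (x, y)) (2 * π)) (hG : Integrable G torus) (s : ℝ) :
    ∫ z, G (z.1 + s, z.2) ∂torus = ∫ z, G z ∂torus := by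
  have h1 := integrable_torus_shift hm hper hG s
  unfold torus at *
  rw [integral_prod_symm _ h1, integral_prod_symm _ hG]
  congr 1; ext y
  exact integral_circ_shift (hper y) s

theorem Nice.shift {v : ℝ → ℝ → ℝ} (hv : Nice v) (s : ℝ) : Nice (fun x y => v (x + s) y) where
  meas := hv.meas.comp (f := fun z : ℝ × ℝ => (z.1 + s, z.2)) (by fun_prop)
  per_x y x := by
    have := hv.per_x y (x + s)
    simp only at this ⊢
    rw [← this]; congr 1; ring
  per_y x := hv.per_y _
  int := integrable_torus_shift hv.meas hv.per_x hv.int s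

theorem pair_shift {v : ℝ → ℝ → ℝ} (hv : Nice v) {φ ψ : ℝ → ℝ} (hφ : TestFun φ)
    (hψ : TestFun ψ) (s : ℝ) :
    pair (fun x y => v (x + s) y) φ ψ = pair v (fun x => φ (x + -s)) ψ := by
  have hφ' := hφ.comp_add (-s)
  have hm : Measurable fun z : ℝ × ℝ => v z.1 z.2 * (φ (z.1 + -s) * ψ z.2) :=
    hv.meas.mul ((hφ'.cont.measurable.comp measurable_fst).mul
      (hψ.cont.measurable.comp measurable_snd))
  have := integral_torus_shift hm
    (fun y x => by
      have h1 := hv.per_x y x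
      have h2 := hφ'.per x
      simp only at h1 h2 ⊢
      rw [h1, h2]) (hv.integrable_mul hφ' hψ) s
  unfold pair
  rw [← this]
  simp

theorem lintegral_enorm_shift {v : ℝ → ℝ → ℝ} (hv : Nice v) (s : ℝ) :
    ∫⁻ z : ℝ × ℝ, ‖v (z.1 + s) z.2‖ₑ ∂torus = ∫⁻ z : ℝ × ℝ, ‖v z.1 z.2‖ₑ ∂torus :=
  lintegral_torus_shift (G := fun z => ‖v z.1 z.2‖ₑ) hv.meas.enorm
    (fun y x => by have := hv.per_x y x; simp only at this ⊢; rw [this]) s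

theorem diffX_eq (α h : ℝ) (v : ℝ → ℝ → ℝ) (x y : ℝ) :
    diffX α h v x y = ∑' j : ℕ, dcoef α j * v (x + (α - j) * h) y := rfl

theorem diffY_eq (α h : ℝ) (v : ℝ → ℝ → ℝ) :
    diffY α h v = fun x y => diffX α h (fun x y => v y x) y x := rfl

theorem measurable_diffX {v : ℝ → ℝ → ℝ} (hv : Measurable (Function.uncurry v)) (α h : ℝ) :
    Measurable (Function.uncurry (diffX α h v)) := by
  have : Function.uncurry (diffX α h v)
      = fun z : ℝ × ℝ => ∑' j : ℕ, dcoef α j * v (z.1 + (α - j) * h) z.2 := rfl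
  rw [this]
  refine Measurable.tsum fun j => ?_
  exact (hv.comp (f := fun z : ℝ × ℝ => (z.1 + (α - j) * h, z.2)) (by fun_prop)).const_mul _

theorem Nice.diffX {α : ℝ} (hα : 0 < α) (h : ℝ) {v : ℝ → ℝ → ℝ} (hv : Nice v) :
    Nice (diffX α h v) where
  meas := measurable_diffX hv.meas α h
  per_x y x := by
    simp only [diffX_eq]
    congr 1; ext j
    have := hv.per_x y (x + (α - j) * h)
    simp only at this
    rw [← this]
    congr 2; ring
  per_y x y := by
    simp only [diffX_eq]
    congr 1; ext j
    rw [hv.per_y _ y]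
  int := by
    refine ⟨(measurable_diffX hv.meas α h).aestronglyMeasurable, ?_⟩
    have hs : ∀ j : ℕ, Measurable fun z : ℝ × ℝ => ‖dcoef α j * v (z.1 + (α - j) * h) z.2‖ₑ :=
      fun j => ((hv.shift _).meas.const_mul _).enorm
    calc ∫⁻ z, ‖Function.uncurry (_root_.diffX α h v) z‖ₑ ∂torus
        ≤ ∫⁻ z : ℝ × ℝ, ∑' j : ℕ, ‖dcoef α j * v (z.1 + (α - j) * h) z.2‖ₑ ∂torus :=
          lintegral_mono fun z => enorm_tsum_le_tsum_enorm
      _ = ∑' j : ℕ, ∫⁻ z : ℝ × ℝ, ‖dcoef α j * v (z.1 + (α - j) * h) z.2‖ₑ ∂torus :=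
          lintegral_tsum fun j => (hs j).aemeasurable
      _ = ∑' j : ℕ, ENNReal.ofReal |dcoef α j| * ∫⁻ z : ℝ × ℝ, ‖v z.1 z.2‖ₑ ∂torus := by
          congr 1; ext j
          simp only [enorm_mul]
          have hm : Measurable fun z : ℝ × ℝ => ‖v (z.1 + (α - j) * h) z.2‖ₑ :=
            (hv.shift _).meas.enorm
          rw [lintegral_const_mul _ hm, lintegral_enorm_shift hv, Real.enorm_eq_ofReal_abs]
      _ < ⊤ := by
          rw [ENNReal.tsum_mul_right, tsum_ofReal_abs_dcoef hα]
          exact ENNReal.mul_lt_top ENNReal.ofReal_lt_top hv.int.2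

theorem Nice.diffY {α : ℝ} (hα : 0 < α) (h : ℝ) {v : ℝ → ℝ → ℝ} (hv : Nice v) :
    Nice (diffY α h v) := (hv.flip.diffX hα h).flip

theorem pair_diffX {α : ℝ} (hα : 0 < α) (h : ℝ) {v : ℝ → ℝ → ℝ} (hv : Nice v) {φ ψ : ℝ → ℝ}
    (hφ : TestFun φ) (hψ : TestFun ψ) : pair (diffX α h v) φ ψ
      = ∑' j : ℕ, dcoef α j * pair v (fun x => φ (x + -((α - j) * h))) ψ := by
  have hint : ∀ j : ℕ, Integrable (fun z : ℝ × ℝ => dcoef α j *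
      (v (z.1 + (α - j) * h) z.2 * (φ z.1 * ψ z.2))) torus := fun j =>
    ((hv.shift _).integrable_mul hφ hψ).const_mul _
  have hle : ∀ j : ℕ,
      ∫ z : ℝ × ℝ, ‖dcoef α j * (v (z.1 + (α - j) * h) z.2 * (φ z.1 * ψ z.2))‖ ∂torus
      ≤ |dcoef α j| * ∫ z : ℝ × ℝ, ‖v z.1 z.2‖ ∂torus := by
    intro j
    have e : ∫ z : ℝ × ℝ, ‖v z.1 z.2‖ ∂torus
        = ∫ z : ℝ × ℝ, ‖v (z.1 + (α - j) * h) z.2‖ ∂torus :=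
      (integral_torus_shift (G := fun z => ‖v z.1 z.2‖) hv.meas.norm
        (fun y x => by have := hv.per_x y x; simp only at this ⊢; rw [this]) hv.int.norm _).symm
    rw [e, ← integral_const_mul]
    apply integral_mono (hint j).norm (((hv.shift _).int.norm).const_mul _)
    intro z
    simp only [norm_mul, norm_eq_abs, Function.uncurry]
    refine mul_le_mul_of_nonneg_left ?_ (abs_nonneg _)
    exact mul_le_of_le_one_right (abs_nonneg _)
      (mul_le_one₀ (hφ.le_one _) (abs_nonneg _) (hψ.le_one _))
  have hsum : Summable fun j : ℕ =>
      ∫ z : ℝ × ℝ, ‖dcoef α j * (v (z.1 + (α - j) * h) z.2 * (φ z.1 * ψ z.2))‖ ∂torus :=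
    Summable.of_nonneg_of_le (fun j => integral_nonneg fun _ => norm_nonneg _) hle
      ((summable_abs_dcoef hα).mul_right _)
  have := (hasSum_integral_of_summable_integral_norm hint hsum).tsum_eq
  unfold pair
  calc _ = ∫ z : ℝ × ℝ, ∑' j : ℕ, dcoef α j *
        (v (z.1 + (α - j) * h) z.2 * (φ z.1 * ψ z.2)) ∂torus := by
        congr 1; ext z
        rw [diffX_eq, ← tsum_mul_right]
        congr 1; ext j; ring
    _ = _ := by
        rw [← this]
        congr 1; ext j
        rw [integral_const_mul]
        congr 1
        exact pair_shift hv hφ hψ _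

/-- A single cosine wave of frequency `ν + 1`. -/
def cosw (ν : ℕ) (φ x : ℝ) : ℝ := cos (((ν : ℝ) + 1) * x + φ)

theorem testFun_cosw (ν : ℕ) (φ : ℝ) : TestFun (cosw ν φ) where
  cont := by unfold cosw; fun_prop
  le_one x := abs_cos_le_one _
  per x := by
    unfold cosw
    have := cos_add_nat_mul_two_pi (((ν : ℝ) + 1) * x + φ) (ν + 1)
    rw [← this]; congr 1; push_cast; ring

/-- The multiplier of the fractional difference on a phase-shifted cosine wave. -/
def mult (α h : ℝ) (ν : ℕ) (φ : ℝ) : ℝ :=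
  ∑' j : ℕ, dcoef α j * cos (φ - ((ν : ℝ) + 1) * (α - j) * h)

theorem pair_diffX_cosw {α : ℝ} (hα : 0 < α) (h : ℝ) {v : ℝ → ℝ → ℝ} (hv : Nice v) {ψ : ℝ → ℝ}
    (hψ : TestFun ψ) {ν : ℕ} {A : ℝ} (hA : ∀ φ, pair v (cosw ν φ) ψ = A * cos φ) (φ : ℝ) :
    pair (diffX α h v) (cosw ν φ) ψ = A * mult α h ν φ := by
  rw [pair_diffX hα h hv (testFun_cosw _ _) hψ, mult, ← tsum_mul_left]
  congr 1; ext j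
  have : (fun x => cosw ν φ (x + -((α - j) * h)))
      = cosw ν (φ - ((ν : ℝ) + 1) * (α - j) * h) := by
    ext x; unfold cosw; congr 1; ring
  rw [this, hA]; ring

/-- Action of the mixed difference on pure cosine modes. -/
theorem pair_diff_cosw {α₁ α₂ : ℝ} (hα₁ : 0 < α₁) (hα₂ : 0 < α₂) (h₁ h₂ : ℝ) {v : ℝ → ℝ → ℝ}
    (hv : Nice v) {ν μ : ℕ} {A : ℝ}
    (hA : ∀ φ ψ, pair v (cosw ν φ) (cosw μ ψ) = A * cos φ * cos ψ) (φ ψ : ℝ) :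
    pair (diffX α₁ h₁ (diffY α₂ h₂ v)) (cosw ν φ) (cosw μ ψ)
      = A * mult α₁ h₁ ν φ * mult α₂ h₂ μ ψ := by
  have h1 : ∀ φ ψ, pair (diffY α₂ h₂ v) (cosw ν φ) (cosw μ ψ)
      = A * mult α₂ h₂ μ ψ * cos φ := by
    intro φ ψ
    rw [diffY_eq, pair_flip, pair_diffX_cosw hα₂ h₂ hv.flip (testFun_cosw ν φ)
      (A := A * cos φ) (fun ψ => by rw [pair_flip, hA])]
    ring
  rw [pair_diffX_cosw hα₁ h₁ (hv.diffY hα₂ h₂) (testFun_cosw μ ψ) (fun φ => h1 φ ψ)]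
  ring

theorem mult_low {α h : ℝ} (hα : 0 < α) (hh : 0 ≤ h) {ν : ℕ} (hν : ((ν : ℝ) + 1) * h ≤ 1) :
    mult α h ν (((ν : ℝ) + 1) * (α * h / 2) + α * π / 2)
      = (2 * sin (((ν : ℝ) + 1) * h / 2)) ^ α := by
  have := tsum_dcoef_mul_cos hα (θ := ((ν : ℝ) + 1) * h) (by positivity)
    (by linarith [pi_gt_three]) (-(((ν : ℝ) + 1) * (α * h / 2) + α * π / 2))
  have e : -(((ν : ℝ) + 1) * (α * h / 2) + α * π / 2) + α * (((ν : ℝ) + 1) * h) / 2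
      + α * π / 2 = 0 := by ring
  rw [e, cos_zero, mul_one] at this
  rw [← this, mult]
  congr 1; ext j
  rw [← cos_neg]; congr 2; ring

theorem mult_high (α h : ℝ) (ν : ℕ) :
    mult α h ν (((ν : ℝ) + 1) * (α * h)) = ∑' j : ℕ, dcoef α j * cos (j * ((ν : ℝ) + 1) * h) := by
  unfold mult
  congr 1; ext j; congr 2; ring

/-! ### Norms and duality -/

theorem Lp2Norm_eq (p : ℝ) (f : ℝ → ℝ → ℝ) (hp : 0 < p) : Lp2Norm p f
    = (∫⁻ x, ∫⁻ y, (ENNReal.ofReal |f x y|) ^ p ∂circ ∂circ) ^ (1 / p) := by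
  simp only [ENNReal.ofReal_rpow_of_nonneg (abs_nonneg _) hp.le]
  rfl

theorem Lp2Norm_rpow {p : ℝ} (hp : 0 < p) (f : ℝ → ℝ → ℝ) : Lp2Norm p f ^ p
    = ∫⁻ x, ∫⁻ y, (ENNReal.ofReal |f x y|) ^ p ∂circ ∂circ := by
  rw [Lp2Norm_eq p f hp, ← ENNReal.rpow_mul, one_div_mul_cancel hp.ne', ENNReal.rpow_one]

theorem Lp2Norm_eq_torus {p : ℝ} (hp : 0 < p) {f : ℝ → ℝ → ℝ}
    (hf : Measurable (Function.uncurry f)) : Lp2Norm p f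
    = (∫⁻ z : ℝ × ℝ, ‖f z.1 z.2‖ₑ ^ p ∂torus) ^ (1 / p) := by
  have hm : Measurable fun z : ℝ × ℝ => ‖f z.1 z.2‖ₑ ^ p := hf.enorm.pow_const _
  rw [Lp2Norm_eq p f hp, torus, lintegral_prod _ hm.aemeasurable]
  simp only [Real.enorm_eq_ofReal_abs]

theorem Nice.of_Lp2Norm {p : ℝ} (hp : 1 < p) {f : ℝ → ℝ → ℝ}
    (hf : Measurable (Function.uncurry f)) (hx : ∀ y, Function.Periodic (fun x => f x y) (2 * π))
    (hy : ∀ x, Function.Periodic (f x) (2 * π)) (h : Lp2Norm p f ≠ ⊤) : Nice f where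
  meas := hf
  per_x := hx
  per_y := hy
  int := by
    have hp0 : 0 < p := by linarith
    refine ⟨hf.aestronglyMeasurable, ?_⟩
    have h1 : ∫⁻ z : ℝ × ℝ, ‖f z.1 z.2‖ₑ ^ p ∂torus ≠ ⊤ := by
      intro htop
      apply h
      rw [Lp2Norm_eq_torus hp0 hf, htop]
      exact ENNReal.top_rpow_of_pos (by positivity)
    calc ∫⁻ z : ℝ × ℝ, ‖f z.1 z.2‖ₑ ∂torus ≤ ∫⁻ z : ℝ × ℝ, (1 + ‖f z.1 z.2‖ₑ ^ p) ∂torus := by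
          apply lintegral_mono
          intro z
          simp only
          rcases le_total ‖f z.1 z.2‖ₑ 1 with h0 | h0
          · exact le_add_right h0
          · refine le_add_left ?_
            calc ‖f z.1 z.2‖ₑ = ‖f z.1 z.2‖ₑ ^ (1 : ℝ) := (ENNReal.rpow_one _).symm
              _ ≤ _ := ENNReal.rpow_le_rpow_of_exponent_le h0 hp.le
      _ = torus Set.univ + ∫⁻ z : ℝ × ℝ, ‖f z.1 z.2‖ₑ ^ p ∂torus := by
          rw [lintegral_add_left measurable_const]; simp
      _ < ⊤ := ENNReal.add_lt_top.2 ⟨measure_lt_top _ _, h1.lt_top⟩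

theorem tsum_tsum_eq_sum {S S' : Finset ℕ} {F : ℕ → ℕ → ℝ≥0∞}
    (h : ∀ i j, ¬ (i ∈ S ∧ j ∈ S') → F i j = 0) :
    ∑' i, ∑' j, F i j = ∑ i ∈ S, ∑ j ∈ S', F i j := by
  rw [tsum_eq_sum (s := S)]
  · apply Finset.sum_congr rfl
    intro i _
    rw [tsum_eq_sum (s := S')]
    intro j hj
    exact h i j (by tauto)
  · intro i hi
    simp [fun j => h i j (by tauto)]

theorem block_add (m i : ℕ) (φ τ x : ℝ) :
    block m i φ (x + τ) = ∑ ν ∈ Finset.Icc m i, cosw ν (((ν : ℝ) + 1) * τ + φ) x := by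
  unfold block cosw
  apply Finset.sum_congr rfl
  intro ν _
  congr 1; ring

/-- Duality estimate for block test functions. -/
theorem exists_dual_bound {p q : ℝ} (hpq : p.HolderConjugate q) : ∃ K ≠ (⊤ : ℝ≥0∞),
    ∀ (v : ℝ → ℝ → ℝ), Nice v → ∀ (S S' : Finset ℕ) (c : ℕ → ℕ → ℝ), (∀ i j, 0 ≤ c i j) →
    ∀ (m m' : ℕ) (τ τ' φ φ' : ℝ),
    ENNReal.ofReal (∑ i ∈ S, ∑ j ∈ S', c i j / (((i : ℝ) + 1) * ((j : ℝ) + 1)) *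
      ∑ ν ∈ Finset.Icc m i, ∑ μ ∈ Finset.Icc m' j,
        pair v (cosw ν (((ν : ℝ) + 1) * τ + φ)) (cosw μ (((μ : ℝ) + 1) * τ' + φ')))
    ≤ K * Lp2Norm p v *
      (∑ i ∈ S, ∑ j ∈ S', ENNReal.ofReal (c i j) ^ q * wt q i * wt q j) ^ (1 / q) := by
  obtain ⟨C, hC, hT⟩ := exists_tbound_dker hpq.symm.lt
  have hp0 : 0 < p := hpq.pos
  have hq0 : 0 < q := hpq.symm.pos
  refine ⟨(C * C) ^ (1 / q), ENNReal.rpow_ne_top_of_nonneg (by positivity)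
    (ENNReal.mul_ne_top hC hC), ?_⟩
  intro v hv S S' c hc m m' τ τ' φ φ'
  set g : ℝ → ℝ → ℝ := fun x y => ∑ i ∈ S, ∑ j ∈ S', c i j / (((i : ℝ) + 1) * ((j : ℝ) + 1)) *
    (block m i φ (x + τ) * block m' j φ' (y + τ')) with hg
  have hgm : Measurable (Function.uncurry g) := by
    apply Continuous.measurable
    simp only [hg, block, Function.uncurry_def]
    fun_prop
  have e1 : ∑ i ∈ S, ∑ j ∈ S', c i j / (((i : ℝ) + 1) * ((j : ℝ) + 1)) *
      ∑ ν ∈ Finset.Icc m i, ∑ μ ∈ Finset.Icc m' j,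
        pair v (cosw ν (((ν : ℝ) + 1) * τ + φ)) (cosw μ (((μ : ℝ) + 1) * τ' + φ'))
      = ∫ z, v z.1 z.2 * g z.1 z.2 ∂torus := by
    have hi : ∀ ν μ a b, Integrable (fun z : ℝ × ℝ =>
        v z.1 z.2 * (cosw ν a z.1 * cosw μ b z.2)) torus := fun ν μ a b =>
      hv.integrable_mul (testFun_cosw _ _) (testFun_cosw _ _)
    have e2 : ∀ z : ℝ × ℝ, v z.1 z.2 * g z.1 z.2 = ∑ i ∈ S, ∑ j ∈ S',
        c i j / (((i : ℝ) + 1) * ((j : ℝ) + 1)) * ∑ ν ∈ Finset.Icc m i, ∑ μ ∈ Finset.Icc m' j,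
        v z.1 z.2 * (cosw ν (((ν : ℝ) + 1) * τ + φ) z.1 *
          cosw μ (((μ : ℝ) + 1) * τ' + φ') z.2) := by
      intro z
      simp only [hg, block_add, Finset.mul_sum, Finset.sum_mul]
      refine Finset.sum_congr rfl fun i _ => Finset.sum_congr rfl fun j _ => ?_
      rw [Finset.sum_comm]
      refine Finset.sum_congr rfl fun ν _ => Finset.sum_congr rfl fun μ _ => ?_
      ring
    simp only [e2]
    rw [integral_finsetSum _ fun i _ => integrable_finsetSum _ fun j _ =>
      (integrable_finsetSum _ fun ν _ => integrable_finsetSum _ fun μ _ =>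
        hi _ _ _ _).const_mul _]
    refine Finset.sum_congr rfl fun i _ => ?_
    rw [integral_finsetSum _ fun j _ =>
      (integrable_finsetSum _ fun ν _ => integrable_finsetSum _ fun μ _ =>
        hi _ _ _ _).const_mul _]
    refine Finset.sum_congr rfl fun j _ => ?_
    rw [integral_const_mul, integral_finsetSum _ fun ν _ => integrable_finsetSum _ fun μ _ =>
        hi _ _ _ _]
    congr 1
    refine Finset.sum_congr rfl fun ν _ => ?_
    rw [integral_finsetSum _ fun μ _ => hi _ _ _ _]
    rfl
  set c' : ℕ → ℕ → ℝ≥0∞ := fun i j => if i ∈ S ∧ j ∈ S' then ENNReal.ofReal (c i j) else 0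
    with hc'
  have hgle : ∀ x y, ‖g x y‖ₑ ≤ ∑' i, ∑' j, c' i j * dker i (x + τ) * dker j (y + τ') := by
    intro x y
    rw [tsum_tsum_eq_sum (S := S) (S' := S') fun i j h => by simp [hc', h]]
    refine (enorm_sum_le _ _).trans (Finset.sum_le_sum fun i hi => ?_)
    refine (enorm_sum_le _ _).trans (Finset.sum_le_sum fun j hj => ?_)
    have hb := ofReal_abs_block_le m i φ (x + τ)
    have hb' := ofReal_abs_block_le m' j φ' (y + τ')
    have hcast : ∀ k : ℕ, (k : ℝ≥0∞) + 1 = ENNReal.ofReal (k + 1) := fun k => by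
      rw [ENNReal.ofReal_add (by positivity) zero_le_one]; simp
    simp only [hc', hi, hj, and_self, if_true]
    rw [enorm_mul, enorm_mul, Real.enorm_eq_ofReal_abs, Real.enorm_eq_ofReal_abs,
      Real.enorm_eq_ofReal_abs, abs_of_nonneg (div_nonneg (hc i j) (by positivity))]
    calc _ ≤ ENNReal.ofReal (c i j / (((i : ℝ) + 1) * ((j : ℝ) + 1))) *
          ((((i : ℝ≥0∞) + 1) * dker i (x + τ)) * (((j : ℝ≥0∞) + 1) * dker j (y + τ'))) := by
          gcongr
      _ = (ENNReal.ofReal (c i j / (((i : ℝ) + 1) * ((j : ℝ) + 1))) *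
          (ENNReal.ofReal (i + 1) * ENNReal.ofReal (j + 1))) *
            (dker i (x + τ) * dker j (y + τ')) := by rw [hcast, hcast]; ring
      _ = _ := by
          rw [← ENNReal.ofReal_mul (by positivity), ← ENNReal.ofReal_mul
            (div_nonneg (hc i j) (by positivity)), div_mul_cancel₀ _ (by positivity), mul_assoc]
  rw [e1]
  calc ENNReal.ofReal (∫ z, v z.1 z.2 * g z.1 z.2 ∂torus)
      ≤ ‖∫ z, v z.1 z.2 * g z.1 z.2 ∂torus‖ₑ := by
        rw [Real.enorm_eq_ofReal_abs]; exact ENNReal.ofReal_le_ofReal (le_abs_self _)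
    _ ≤ ∫⁻ z, ‖v z.1 z.2 * g z.1 z.2‖ₑ ∂torus := enorm_integral_le_lintegral_enorm _
    _ = ∫⁻ z, ((fun z : ℝ × ℝ => ‖v z.1 z.2‖ₑ) * fun z : ℝ × ℝ => ‖g z.1 z.2‖ₑ) z ∂torus := by
        simp only [enorm_mul, Pi.mul_apply]
    _ ≤ (∫⁻ z : ℝ × ℝ, ‖v z.1 z.2‖ₑ ^ p ∂torus) ^ (1 / p) *
        (∫⁻ z : ℝ × ℝ, ‖g z.1 z.2‖ₑ ^ q ∂torus) ^ (1 / q) :=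
        ENNReal.lintegral_mul_le_Lp_mul_Lq _ hpq hv.meas.enorm.aemeasurable hgm.enorm.aemeasurable
    _ = Lp2Norm p v * (∫⁻ z : ℝ × ℝ, ‖g z.1 z.2‖ₑ ^ q ∂torus) ^ (1 / q) := by
        rw [Lp2Norm_eq_torus hp0 hv.meas]
    _ ≤ Lp2Norm p v * (C * C * ∑ i ∈ S, ∑ j ∈ S',
        ENNReal.ofReal (c i j) ^ q * wt q i * wt q j) ^ (1 / q) := by
        gcongr
        have hm : Measurable fun z : ℝ × ℝ => ‖g z.1 z.2‖ₑ ^ q := hgm.enorm.pow_const _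
        rw [torus, lintegral_prod _ hm.aemeasurable]
        calc _ ≤ ∫⁻ x, ∫⁻ y, (∑' i, ∑' j, c' i j * dker i (x + τ) * dker j (y + τ')) ^ q
              ∂circ ∂circ := by
              apply lintegral_mono; intro x
              apply lintegral_mono; intro y
              exact ENNReal.rpow_le_rpow (hgle x y) hq0.le
          _ ≤ _ := (hT.shift dker_periodic τ).tensor (hT.shift dker_periodic τ') c'
          _ = _ := by
              rw [tsum_tsum_eq_sum (S := S) (S' := S') fun i j h => by
                simp [hc', h, ENNReal.zero_rpow_of_pos hq0]]
              congr 1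
              refine Finset.sum_congr rfl fun i hi => Finset.sum_congr rfl fun j hj => ?_
              simp [hc', hi, hj]
    _ = _ := by
        rw [ENNReal.mul_rpow_of_nonneg _ _ (by positivity)]; ring

/-! ### Coefficients of functions in the class -/

theorem tendsto_integral_mul_cos {F : ℝ → ℝ} (hF : Integrable F circ) :
    Filter.Tendsto (fun μ : ℕ => ∫ y, F y * cos (((μ : ℝ) + 1) * y) ∂circ)
      Filter.atTop (nhds 0) := by
  set g : ℝ → ℂ := (Set.Ioc (0 : ℝ) (2 * π)).indicator fun y => ((F y : ℝ) : ℂ) with hg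
  have h := Real.tendsto_integral_exp_smul_cocompact g
  have hw : Filter.Tendsto (fun μ : ℕ => ((μ : ℝ) + 1) / (2 * π)) Filter.atTop
      (Filter.cocompact ℝ) := by
    refine Filter.Tendsto.mono_right ?_ atTop_le_cocompact
    exact (Filter.tendsto_atTop_add_const_right _ _ tendsto_natCast_atTop_atTop).atTop_div_const
      two_pi_pos
  have h2 := (Complex.continuous_re.tendsto _).comp (h.comp hw)
  simp only [Complex.zero_re] at h2
  refine h2.congr fun μ => ?_
  simp only [Function.comp_apply]
  have e1 : ∀ v : ℝ, (Real.fourierChar (-(v * (((μ : ℝ) + 1) / (2 * π))))) • g v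
      = (Set.Ioc (0 : ℝ) (2 * π)).indicator (fun y =>
        Complex.exp (((-(((μ : ℝ) + 1) * y) : ℝ) : ℂ) * Complex.I) * ((F y : ℝ) : ℂ)) v := by
    intro v
    rw [Circle.smul_def, Real.fourierChar_apply]
    by_cases hv : v ∈ Set.Ioc (0 : ℝ) (2 * π)
    · rw [hg, Set.indicator_of_mem hv, Set.indicator_of_mem hv, smul_eq_mul]
      congr 4
      field_simp
    · rw [hg, Set.indicator_of_notMem hv, Set.indicator_of_notMem hv, smul_zero]
  simp only [e1]
  rw [integral_indicator measurableSet_Ioc]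
  have hint : Integrable (fun y : ℝ =>
      Complex.exp (((-(((μ : ℝ) + 1) * y) : ℝ) : ℂ) * Complex.I) * ((F y : ℝ) : ℂ)) circ := by
    refine (hF.ofReal (𝕜 := ℂ)).bdd_mul (c := 1) ?_ (Filter.Eventually.of_forall fun y => ?_)
    · exact Continuous.aestronglyMeasurable (by fun_prop)
    · rw [Complex.norm_exp_ofReal_mul_I]
  have h3 := integral_re hint
  simp only [RCLike.re_to_complex] at h3
  refine h3.symm.trans ?_
  congr 1; ext y
  rw [Complex.mul_re, Complex.ofReal_re, Complex.ofReal_im, Complex.exp_ofReal_mul_I_re, cos_neg]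
  ring

/-- Null double sequences with nonnegative mixed differences. -/
structure MonoCoef (z : ℕ → ℕ → ℝ) : Prop where
  diff_nonneg : ∀ i j, 0 ≤ z i j - z (i + 1) j - z i (j + 1) + z (i + 1) (j + 1)
  lim_fst : ∀ j, Filter.Tendsto (fun i => z i j) Filter.atTop (nhds 0)
  lim_snd : ∀ i, Filter.Tendsto (z i) Filter.atTop (nhds 0)

namespace MonoCoef

variable {z : ℕ → ℕ → ℝ}

theorem swap (hz : MonoCoef z) : MonoCoef fun i j => z j i where
  diff_nonneg i j := by linarith [hz.diff_nonneg j i]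
  lim_fst := hz.lim_snd
  lim_snd := hz.lim_fst

theorem antitone_sub (hz : MonoCoef z) (i : ℕ) : Antitone fun j => z i j - z (i + 1) j :=
  antitone_nat_of_succ_le fun j => by linarith [hz.diff_nonneg i j]

theorem tendsto_sub (hz : MonoCoef z) (i : ℕ) :
    Filter.Tendsto (fun j => z i j - z (i + 1) j) Filter.atTop (nhds 0) := by
  simpa using (hz.lim_snd i).sub (hz.lim_snd (i + 1))

theorem antitone_fst (hz : MonoCoef z) (j : ℕ) : Antitone fun i => z i j :=
  antitone_nat_of_succ_le fun i => by
    have : 0 ≤ z i j - z (i + 1) j := (hz.antitone_sub i).le_of_tendsto (hz.tendsto_sub i) j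
    linarith

theorem antitone_snd (hz : MonoCoef z) (i : ℕ) : Antitone (z i) := hz.swap.antitone_fst i

theorem nonneg (hz : MonoCoef z) (i j : ℕ) : 0 ≤ z i j :=
  (hz.antitone_fst j).le_of_tendsto (hz.lim_fst j) i

end MonoCoef

theorem tsum_ind_mul_sub {u : ℕ → ℝ} (hu : Antitone u)
    (h : Filter.Tendsto u Filter.atTop (nhds 0)) (i : ℕ) :
    ∑' k, ind i k * ENNReal.ofReal (u k - u (k + 1)) = ENNReal.ofReal (u i) := by
  have e0 : ∀ n, ∑ k ∈ Finset.range (i + n), ind i k * ENNReal.ofReal (u k - u (k + 1))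
      = ENNReal.ofReal (u i - u (i + n)) := by
    intro n
    induction n with
    | zero =>
      simp only [add_zero, sub_self, ENNReal.ofReal_zero]
      apply Finset.sum_eq_zero
      intro k hk
      rw [Finset.mem_range] at hk
      simp [ind, not_le.2 hk]
    | succ n ih =>
      rw [← add_assoc, Finset.sum_range_succ, ih, ind, if_pos (by omega), one_mul,
        ← ENNReal.ofReal_add (sub_nonneg.2 (hu (by omega))) (sub_nonneg.2 (hu (by omega)))]
      congr 1; ring
  have h1 := (ENNReal.tendsto_nat_tsum fun k =>
    ind i k * ENNReal.ofReal (u k - u (k + 1))).comp (Filter.tendsto_add_atTop_nat i)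
  have h2 : Filter.Tendsto (fun n => ENNReal.ofReal (u i - u (i + n))) Filter.atTop
      (nhds (ENNReal.ofReal (u i))) := by
    have := (h.comp (Filter.tendsto_add_atTop_nat i)).const_sub (u i)
    rw [sub_zero] at this
    refine ((ENNReal.continuous_ofReal.tendsto _).comp this).congr fun n => ?_
    simp [add_comm]
  refine tendsto_nhds_unique (h1.congr fun n => ?_) h2
  simp only [Function.comp_apply]
  rw [add_comm n i, e0]

/-- The mixed differences of a double sequence. -/
def mixedDiff (z : ℕ → ℕ → ℝ) (k l : ℕ) : ℝ≥0∞ :=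
  ENNReal.ofReal (z k l - z (k + 1) l - z k (l + 1) + z (k + 1) (l + 1))

theorem MonoCoef.tsum_ind_mixedDiff {z : ℕ → ℕ → ℝ} (hz : MonoCoef z) (k j : ℕ) :
    ∑' l, ind j l * mixedDiff z k l = ENNReal.ofReal (z k j - z (k + 1) j) := by
  rw [← tsum_ind_mul_sub (hz.antitone_sub k) (hz.tendsto_sub k) j]
  apply tsum_congr; intro l
  rw [mixedDiff]; congr 2; ring

theorem MonoCoef.tailSum_mixedDiff {z : ℕ → ℕ → ℝ} (hz : MonoCoef z) (i j : ℕ) :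
    tailSum (mixedDiff z) i j = ENNReal.ofReal (z i j) := by
  rw [tailSum, ← tsum_ind_mul_sub (hz.antitone_fst j) (hz.lim_fst j) i]
  apply tsum_congr; intro k
  simp only [mul_assoc]
  rw [ENNReal.tsum_mul_left, hz.tsum_ind_mixedDiff]

theorem Nice.interval_eq_pair {f : ℝ → ℝ → ℝ} (hf : Nice f) {φ ψ : ℝ → ℝ} (hφ : TestFun φ)
    (hψ : TestFun ψ) : ∫ x in (0:ℝ)..(2*π), ∫ y in (0:ℝ)..(2*π), f x y * φ x * ψ y
    = pair f φ ψ := by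
  unfold pair torus
  rw [integral_prod _ (hf.integrable_mul hφ hψ)]
  simp only [intervalIntegral.integral_of_le two_pi_pos.le, ← mul_assoc]
  rfl

theorem testFun_cos (n : ℕ) : TestFun fun x => cos ((n : ℝ) * x) where
  cont := by fun_prop
  le_one _ := abs_cos_le_one _
  per x := by
    simp only
    rw [mul_add, cos_add_nat_mul_two_pi]

theorem testFun_sin (n : ℕ) : TestFun fun x => sin ((n : ℝ) * x) where
  cont := by fun_prop
  le_one _ := abs_sin_le_one _
  per x := by
    simp only
    rw [mul_add, sin_add_nat_mul_two_pi]

theorem pair_comb_left {f : ℝ → ℝ → ℝ} (hf : Nice f) {φ φ' ψ : ℝ → ℝ} (hφ : TestFun φ)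
    (hφ' : TestFun φ') (hψ : TestFun ψ) (c c' : ℝ) :
    pair f (fun x => φ x * c - φ' x * c') ψ = c * pair f φ ψ - c' * pair f φ' ψ := by
  unfold pair
  rw [← integral_const_mul, ← integral_const_mul, ← integral_sub
    ((hf.integrable_mul hφ hψ).const_mul c) ((hf.integrable_mul hφ' hψ).const_mul c')]
  congr 1; ext z; ring

theorem pair_comb_right {f : ℝ → ℝ → ℝ} (hf : Nice f) {φ ψ ψ' : ℝ → ℝ} (hφ : TestFun φ)
    (hψ : TestFun ψ) (hψ' : TestFun ψ') (c c' : ℝ) :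
    pair f φ (fun x => ψ x * c - ψ' x * c') = c * pair f φ ψ - c' * pair f φ ψ' := by
  have := pair_comb_left hf.flip hψ hψ' hφ c c'
  simpa only [pair_flip] using this

theorem pair_cosw_eq {f : ℝ → ℝ → ℝ} (hf : Nice f) (hs : ∀ n₁ n₂ : ℕ, fourierSC f n₁ n₂ = 0 ∧
    fourierCS f n₁ n₂ = 0 ∧ fourierSS f n₁ n₂ = 0) (ν μ : ℕ) (φ ψ : ℝ) :
    pair f (cosw ν φ) (cosw μ ψ) = π ^ 2 * fourierCC f (ν + 1) (μ + 1) * cos φ * cos ψ := by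
  have e1 : ∀ (ν : ℕ) φ, cosw ν φ = fun x => cos (((ν + 1 : ℕ) : ℝ) * x) * cos φ
      - sin (((ν + 1 : ℕ) : ℝ) * x) * sin φ := by
    intro ν φ; ext x; rw [cosw, cos_add]; push_cast; rfl
  have hpi : (π : ℝ) ^ 2 ≠ 0 := by positivity
  obtain ⟨h1, h2, h3⟩ := hs (ν + 1) (μ + 1)
  simp only [fourierSC, fourierCS, fourierSS, mul_eq_zero, one_div, inv_eq_zero, hpi,
    false_or] at h1 h2 h3
  rw [hf.interval_eq_pair (testFun_sin (ν + 1)) (testFun_cos (μ + 1))] at h1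
  rw [hf.interval_eq_pair (testFun_cos (ν + 1)) (testFun_sin (μ + 1))] at h2
  rw [hf.interval_eq_pair (testFun_sin (ν + 1)) (testFun_sin (μ + 1))] at h3
  rw [fourierCC, hf.interval_eq_pair (testFun_cos (ν + 1)) (testFun_cos (μ + 1))]
  have h5 := testFun_cosw μ ψ
  rw [e1 ν φ, pair_comb_left hf (testFun_cos _) (testFun_sin _) h5, e1 μ ψ,
    pair_comb_right hf (testFun_cos _) (testFun_cos _) (testFun_sin _),
    pair_comb_right hf (testFun_sin _) (testFun_cos _) (testFun_sin _), h1, h2, h3]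
  field_simp
  ring

theorem Nice.tendsto_pair {f : ℝ → ℝ → ℝ} (hf : Nice f) {φ : ℝ → ℝ} (hφ : TestFun φ) :
    Filter.Tendsto (fun μ : ℕ => pair f φ (cosw μ 0)) Filter.atTop (nhds 0) := by
  have h1 : Integrable (fun z : ℝ × ℝ => f z.1 z.2 * (φ z.1 * cos (((0 : ℕ) : ℝ) * z.2))) torus :=
    hf.integrable_mul hφ (testFun_cos 0)
  refine (tendsto_integral_mul_cos h1.integral_prod_right).congr fun μ => ?_
  unfold pair torus
  rw [integral_prod_symm _ (hf.integrable_mul hφ (testFun_cosw μ 0))]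
  congr 1; ext y
  rw [← integral_mul_const]
  congr 1; ext x
  simp [cosw, mul_assoc]

theorem MemLp0.nice {p : ℝ} (hp : 1 < p) {f : ℝ → ℝ → ℝ} (hf : MemLp0 p f) : Nice f :=
  Nice.of_Lp2Norm hp hf.meas hf.periodic_x hf.periodic_y hf.norm_ne_top

theorem pair_cosw_of_inMclass {p : ℝ} (hp : 1 < p) {f : ℝ → ℝ → ℝ} {a : ℕ → ℕ → ℝ}
    (h : InMclass p f a) (ν μ : ℕ) (φ ψ : ℝ) :
    pair f (cosw ν φ) (cosw μ ψ) = π ^ 2 * a (ν + 1) (μ + 1) * cos φ * cos ψ := by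
  rw [pair_cosw_eq (MemLp0.nice hp h.1) h.2.2.1, h.2.1 _ _ (by omega) (by omega)]

theorem monoCoef_of_inMclass {p : ℝ} (hp : 1 < p) {f : ℝ → ℝ → ℝ} {a : ℕ → ℕ → ℝ}
    (h : InMclass p f a) : MonoCoef fun i j => a (i + 1) (j + 1) := by
  have hf := MemLp0.nice hp h.1
  have hpi : (π : ℝ) ^ 2 ≠ 0 := by positivity
  have e : ∀ i j, a (i + 1) (j + 1) = (π ^ 2)⁻¹ * pair f (cosw i 0) (cosw j 0) := fun i j => by
    rw [pair_cosw_of_inMclass hp h, cos_zero]; field_simp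
  refine ⟨fun i j => h.2.2.2 _ _ (by omega) (by omega), fun j => ?_, fun i => ?_⟩
  · have := (hf.flip.tendsto_pair (testFun_cosw j 0)).const_mul ((π ^ 2)⁻¹)
    rw [mul_zero] at this
    refine this.congr fun i => ?_
    rw [e, pair_flip]
  · have := (hf.tendsto_pair (testFun_cosw i 0)).const_mul ((π ^ 2)⁻¹)
    rw [mul_zero] at this
    exact this.congr fun j => (e i j).symm

/-! ### Lower bounds by duality -/

/-- The pairing of multiplied coefficients with block sums is bounded by `N` in the dual norm. -/
def DualBd (q : ℝ) (z : ℕ → ℕ → ℝ) (N : ℝ≥0∞) (m m' : ℕ) (lam lam' : ℕ → ℝ) : Prop :=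
  ∀ (S S' : Finset ℕ) (c : ℕ → ℕ → ℝ), (∀ i j, 0 ≤ c i j) →
    ENNReal.ofReal (∑ i ∈ S, ∑ j ∈ S', c i j / (((i : ℝ) + 1) * ((j : ℝ) + 1)) *
      ∑ ν ∈ Finset.Icc m i, ∑ μ ∈ Finset.Icc m' j, z ν μ * (lam ν * lam' μ))
    ≤ N * (∑ i ∈ S, ∑ j ∈ S', ENNReal.ofReal (c i j) ^ q * wt q i * wt q j) ^ (1 / q)

theorem DualBd.swap {q : ℝ} {z : ℕ → ℕ → ℝ} {N : ℝ≥0∞} {m m' : ℕ} {lam lam' : ℕ → ℝ}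
    (h : DualBd q z N m m' lam lam') : DualBd q (fun i j => z j i) N m' m lam' lam := by
  intro S S' c hc
  refine le_of_eq_of_le ?_ ((h S' S (fun i j => c j i) fun i j => hc j i).trans_eq ?_)
  · rw [Finset.sum_comm]
    congr 1
    refine Finset.sum_congr rfl fun i _ => Finset.sum_congr rfl fun j _ => ?_
    rw [Finset.sum_comm, mul_comm ((i : ℝ) + 1)]
    congr 1
    refine Finset.sum_congr rfl fun ν _ => Finset.sum_congr rfl fun μ _ => ?_
    ring
  · rw [Finset.sum_comm]
    congr 2
    refine Finset.sum_congr rfl fun i _ => Finset.sum_congr rfl fun j _ => ?_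
    ring

theorem DualBd.average {q : ℝ} {z : ℕ → ℕ → ℝ} {N : ℝ≥0∞} {m m' : ℕ} {lam : ℝ → ℕ → ℝ}
    {lam' : ℕ → ℝ} {δ : ℝ} (hδ : 0 < δ) (hc : ∀ ν, Continuous fun h => lam h ν)
    (h : ∀ t ∈ Set.Icc 0 δ, DualBd q z N m m' (lam t) lam') :
    DualBd q z N m m' (fun ν => δ⁻¹ * ∫ t in (0:ℝ)..δ, lam t ν) lam' := by
  intro S S' c hc0
  set B := N * (∑ i ∈ S, ∑ j ∈ S', ENNReal.ofReal (c i j) ^ q * wt q i * wt q j) ^ (1 / q)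
  rcases eq_or_ne B ⊤ with hB | hB
  · rw [hB]; exact le_top
  set T : ℝ → ℝ := fun t => ∑ i ∈ S, ∑ j ∈ S', c i j / (((i : ℝ) + 1) * ((j : ℝ) + 1)) *
      ∑ ν ∈ Finset.Icc m i, ∑ μ ∈ Finset.Icc m' j, z ν μ * (lam t ν * lam' μ) with hT
  have hT1 : ∀ t ∈ Set.Icc 0 δ, T t ≤ B.toReal := fun t ht =>
    (ENNReal.ofReal_le_iff_le_toReal hB).1 (h t ht S S' c hc0)
  have hTc : Continuous T := by
    simp only [hT]
    fun_prop
  have e : ∑ i ∈ S, ∑ j ∈ S', c i j / (((i : ℝ) + 1) * ((j : ℝ) + 1)) *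
      ∑ ν ∈ Finset.Icc m i, ∑ μ ∈ Finset.Icc m' j,
        z ν μ * ((δ⁻¹ * ∫ t in (0:ℝ)..δ, lam t ν) * lam' μ) = δ⁻¹ * ∫ t in (0:ℝ)..δ, T t := by
    simp only [hT]
    rw [intervalIntegral.integral_finsetSum fun i _ =>
      Continuous.intervalIntegrable (by fun_prop) _ _, Finset.mul_sum]
    refine Finset.sum_congr rfl fun i _ => ?_
    rw [intervalIntegral.integral_finsetSum fun i _ =>
      Continuous.intervalIntegrable (by fun_prop) _ _, Finset.mul_sum]
    refine Finset.sum_congr rfl fun j _ => ?_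
    rw [intervalIntegral.integral_const_mul, intervalIntegral.integral_finsetSum fun i _ =>
      Continuous.intervalIntegrable (by fun_prop) _ _, mul_left_comm, Finset.mul_sum _ _ δ⁻¹]
    congr 1
    refine Finset.sum_congr rfl fun ν _ => ?_
    rw [intervalIntegral.integral_finsetSum fun i _ =>
      Continuous.intervalIntegrable (by fun_prop) _ _, Finset.mul_sum]
    refine Finset.sum_congr rfl fun μ _ => ?_
    rw [intervalIntegral.integral_const_mul, intervalIntegral.integral_mul_const]
    ring
  simp only [e]
  rw [ENNReal.ofReal_le_iff_le_toReal hB]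
  have h1 : ∫ t in (0:ℝ)..δ, T t ≤ ∫ _ in (0:ℝ)..δ, B.toReal :=
    intervalIntegral.integral_mono_on hδ.le (hTc.intervalIntegrable _ _)
      (continuous_const.intervalIntegrable _ _) hT1
  rw [intervalIntegral.integral_const, sub_zero, smul_eq_mul] at h1
  rwa [inv_mul_le_iff₀ hδ]

theorem exists_dualBd_of_pair {p q : ℝ} (hpq : p.HolderConjugate q) : ∃ K ≠ (⊤ : ℝ≥0∞),
    ∀ (z : ℕ → ℕ → ℝ) (u : ℝ → ℝ → ℝ), Nice u → ∀ (m m' : ℕ) (lam lam' : ℕ → ℝ)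
    (τ τ' φ φ' : ℝ),
    (∀ ν μ, m ≤ ν → m' ≤ μ →
      pair u (cosw ν (((ν : ℝ) + 1) * τ + φ)) (cosw μ (((μ : ℝ) + 1) * τ' + φ'))
        = π ^ 2 * z ν μ * (lam ν * lam' μ)) →
    DualBd q z (K * Lp2Norm p u) m m' lam lam' := by
  obtain ⟨K, hK, h⟩ := exists_dual_bound hpq
  refine ⟨K, hK, ?_⟩
  intro z u hu m m' lam lam' τ τ' φ φ' hp S S' c hc
  refine le_trans ?_ (h u hu S S' c hc m m' τ τ' φ φ')
  have e : ∑ i ∈ S, ∑ j ∈ S', c i j / (((i : ℝ) + 1) * ((j : ℝ) + 1)) *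
      ∑ ν ∈ Finset.Icc m i, ∑ μ ∈ Finset.Icc m' j,
        pair u (cosw ν (((ν : ℝ) + 1) * τ + φ)) (cosw μ (((μ : ℝ) + 1) * τ' + φ'))
      = π ^ 2 * ∑ i ∈ S, ∑ j ∈ S', c i j / (((i : ℝ) + 1) * ((j : ℝ) + 1)) *
      ∑ ν ∈ Finset.Icc m i, ∑ μ ∈ Finset.Icc m' j, z ν μ * (lam ν * lam' μ) := by
    rw [Finset.mul_sum]
    refine Finset.sum_congr rfl fun i _ => ?_
    rw [Finset.mul_sum]
    refine Finset.sum_congr rfl fun j _ => ?_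
    rw [mul_left_comm, Finset.mul_sum _ _ (π ^ 2)]
    congr 1
    refine Finset.sum_congr rfl fun ν hν => ?_
    rw [Finset.mul_sum]
    refine Finset.sum_congr rfl fun μ hμ => ?_
    rw [hp ν μ (Finset.mem_Icc.1 hν).1 (Finset.mem_Icc.1 hμ).1, mul_assoc]
  rw [e, ENNReal.ofReal_mul (by positivity)]
  refine le_mul_of_one_le_left (zero_le) ?_
  rw [ENNReal.one_le_ofReal]
  nlinarith [pi_gt_three]

theorem DualBd.mul_sum_le {p q : ℝ} (hpq : p.HolderConjugate q) {z : ℕ → ℕ → ℝ} (hz : MonoCoef z)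
    {N : ℝ≥0∞} {m m' : ℕ} {lam lam' : ℕ → ℝ} (h : DualBd q z N m m' lam lam') {κ κ' : ℝ}
    (hκ : 0 ≤ κ) (hκ' : 0 ≤ κ') {w w' : ℕ → ℝ} (hw : ∀ i, 0 ≤ w i) (hw' : ∀ i, 0 ≤ w' i)
    (hl : ∀ i, w i ≠ 0 → (∀ ν ∈ Finset.Icc m i, 0 ≤ lam ν) ∧
      κ * w i * ((i : ℝ) + 1) ≤ ∑ ν ∈ Finset.Icc m i, lam ν)
    (hl' : ∀ i, w' i ≠ 0 → (∀ ν ∈ Finset.Icc m' i, 0 ≤ lam' ν) ∧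
      κ' * w' i * ((i : ℝ) + 1) ≤ ∑ ν ∈ Finset.Icc m' i, lam' ν) :
    ENNReal.ofReal (κ * κ') ^ p *
      ∑' i, ∑' j, ENNReal.ofReal (z i j * (w i * w' j)) ^ p * wt p i * wt p j ≤ N ^ p := by
  have hp0 := hpq.pos
  have hp1 := hpq.lt
  have hq0 := hpq.symm.pos
  have key : ∀ S S' : Finset ℕ, ENNReal.ofReal (κ * κ') ^ p * ∑ i ∈ S, ∑ j ∈ S',
      ENNReal.ofReal (z i j * (w i * w' j)) ^ p * wt p i * wt p j ≤ N ^ p := by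
    intro S S'
    set X : ℕ → ℕ → ℝ := fun i j => z i j * (w i * w' j) with hX
    have hX0 : ∀ i j, 0 ≤ X i j := fun i j =>
      mul_nonneg (hz.nonneg i j) (mul_nonneg (hw i) (hw' j))
    set c : ℕ → ℕ → ℝ := fun i j =>
      X i j ^ (p - 1) * (((i : ℝ) + 1) * ((j : ℝ) + 1)) ^ (p - 2) with hc
    have hc0 : ∀ i j, 0 ≤ c i j := fun i j => by
      have := hX0 i j
      positivity
    have h1 := h S S' c hc0
    have hterm : ∀ i j, κ * κ' * (X i j ^ p * ((i : ℝ) + 1) ^ (p - 2) * ((j : ℝ) + 1) ^ (p - 2))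
        ≤ c i j / (((i : ℝ) + 1) * ((j : ℝ) + 1)) *
          ∑ ν ∈ Finset.Icc m i, ∑ μ ∈ Finset.Icc m' j, z ν μ * (lam ν * lam' μ) := by
      intro i j
      rcases eq_or_ne (X i j) 0 with h0 | h0
      · simp [hc, h0, zero_rpow hp0.ne', zero_rpow (sub_pos.2 hp1).ne']
      have hwi : w i ≠ 0 := by rintro hh; simp [hX, hh] at h0
      have hwj : w' j ≠ 0 := by rintro hh; simp [hX, hh] at h0
      obtain ⟨hi0, hi1⟩ := hl i hwi
      obtain ⟨hj0, hj1⟩ := hl' j hwj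
      have h2 : z i j * ((κ * w i * ((i : ℝ) + 1)) * (κ' * w' j * ((j : ℝ) + 1)))
          ≤ ∑ ν ∈ Finset.Icc m i, ∑ μ ∈ Finset.Icc m' j, z ν μ * (lam ν * lam' μ) := by
        calc _ ≤ z i j * ((∑ ν ∈ Finset.Icc m i, lam ν) * ∑ μ ∈ Finset.Icc m' j, lam' μ) := by
              refine mul_le_mul_of_nonneg_left (mul_le_mul hi1 hj1 ?_ ?_) (hz.nonneg i j)
              · have := hw' j; positivity
              · exact Finset.sum_nonneg hi0
          _ = ∑ ν ∈ Finset.Icc m i, ∑ μ ∈ Finset.Icc m' j, z i j * (lam ν * lam' μ) := by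
              rw [Finset.sum_mul_sum, Finset.mul_sum]
              exact Finset.sum_congr rfl fun ν _ => by rw [Finset.mul_sum]
          _ ≤ _ := by
              refine Finset.sum_le_sum fun ν hν => Finset.sum_le_sum fun μ hμ => ?_
              refine mul_le_mul_of_nonneg_right ?_ (mul_nonneg (hi0 ν hν) (hj0 μ hμ))
              exact (hz.antitone_snd i (Finset.mem_Icc.1 hμ).2).trans
                (hz.antitone_fst μ (Finset.mem_Icc.1 hν).2)
      refine le_trans (le_of_eq ?_) (mul_le_mul_of_nonneg_left h2
        (div_nonneg (hc0 i j) (by positivity)))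
      have hXp : X i j ^ p = X i j ^ (p - 1) * X i j := by
        rw [← rpow_add_one h0]; congr 1; ring
      have e1 : ((i : ℝ) + 1) ≠ 0 := by positivity
      have e2 : ((j : ℝ) + 1) ≠ 0 := by positivity
      simp only [hc]
      rw [hXp, mul_rpow (by positivity : 0 ≤ (i : ℝ) + 1) (by positivity : 0 ≤ (j : ℝ) + 1)]
      field_simp
      simp only [hX]
      ring
    have hterm2 : ∀ i j, ENNReal.ofReal (c i j) ^ q * wt q i * wt q j
        = ENNReal.ofReal (X i j) ^ p * wt p i * wt p j := by
      intro i j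
      have e1 : (p - 1) * q = p := by have := hpq.sub_one_mul_conj; linarith
      have e2 : (p - 2) * q + (q - 2) = p - 2 := by linarith
      have hi : (0 : ℝ) < (i : ℝ) + 1 := by positivity
      have hj : (0 : ℝ) < (j : ℝ) + 1 := by positivity
      simp only [wt]
      rw [ENNReal.ofReal_rpow_of_nonneg (hc0 i j) hq0.le,
        ENNReal.ofReal_rpow_of_nonneg (hX0 i j) hp0.le,
        ← ENNReal.ofReal_mul (by have := hc0 i j; positivity),
        ← ENNReal.ofReal_mul (by have := hc0 i j; positivity),
        ← ENNReal.ofReal_mul (by have := hX0 i j; positivity),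
        ← ENNReal.ofReal_mul (by have := hX0 i j; positivity)]
      congr 1
      simp only [hc]
      rw [mul_rpow (rpow_nonneg (hX0 i j) (p - 1)) (by positivity), ← rpow_mul (hX0 i j), e1,
        mul_rpow hi.le hj.le, mul_rpow (rpow_nonneg hi.le _) (rpow_nonneg hj.le _),
        ← rpow_mul hi.le,
        ← rpow_mul hj.le, ← e2, rpow_add hi, rpow_add hj, e2]
      ring
    set A : ℝ≥0∞ := ∑ i ∈ S, ∑ j ∈ S', ENNReal.ofReal (X i j) ^ p * wt p i * wt p j with hA
    have hA1 : ENNReal.ofReal (κ * κ') * A ≤ N * A ^ (1 / q) := by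
      simp only [hterm2] at h1
      refine le_trans (le_of_eq ?_) (le_trans (ENNReal.ofReal_le_ofReal
        (Finset.sum_le_sum fun i _ => Finset.sum_le_sum fun j _ => hterm i j)) h1)
      have hnn : ∀ i j, 0 ≤ X i j ^ p * ((i : ℝ) + 1) ^ (p - 2) * ((j : ℝ) + 1) ^ (p - 2) :=
        fun i j => by have := hX0 i j; positivity
      simp only [← Finset.mul_sum]
      rw [ENNReal.ofReal_mul (mul_nonneg hκ hκ'), ENNReal.ofReal_sum_of_nonneg fun i _ =>
        Finset.sum_nonneg fun j _ => hnn i j, hA]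
      congr 1
      refine Finset.sum_congr rfl fun i _ => ?_
      rw [ENNReal.ofReal_sum_of_nonneg fun j _ => hnn i j]
      refine Finset.sum_congr rfl fun j _ => ?_
      have := hX0 i j
      rw [ENNReal.ofReal_rpow_of_nonneg (hX0 i j) hp0.le, wt, wt,
        ← ENNReal.ofReal_mul (by positivity), ← ENNReal.ofReal_mul (by positivity)]
    have hAt : A ≠ ⊤ := by
      refine ENNReal.sum_ne_top.2 fun i _ => ENNReal.sum_ne_top.2 fun j _ => ?_
      exact ENNReal.mul_ne_top (ENNReal.mul_ne_top
        (ENNReal.rpow_ne_top_of_nonneg hp0.le ENNReal.ofReal_ne_top) ENNReal.ofReal_ne_top)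
        ENNReal.ofReal_ne_top
    rcases eq_or_ne A 0 with hA0 | hA0
    · rw [hA0, mul_zero]; exact zero_le
    have e3 : A = A ^ (1 / p) * A ^ (1 / q) := by
      rw [← ENNReal.rpow_add _ _ hA0 hAt, one_div, one_div, hpq.inv_add_inv_eq_one,
        ENNReal.rpow_one]
    have h5 : ENNReal.ofReal (κ * κ') * A ^ (1 / p) ≤ N := by
      rw [← ENNReal.mul_le_mul_iff_left (c := A ^ (1 / q)), mul_assoc, ← e3]
      · exact hA1
      · simp [ENNReal.rpow_eq_zero_iff, hA0, hAt]
      · exact ENNReal.rpow_ne_top_of_nonneg (by positivity) hAt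
    calc ENNReal.ofReal (κ * κ') ^ p * A
        = (ENNReal.ofReal (κ * κ') * A ^ (1 / p)) ^ p := by
          rw [ENNReal.mul_rpow_of_nonneg _ _ hp0.le, ← ENNReal.rpow_mul,
            one_div_mul_cancel hp0.ne', ENNReal.rpow_one]
      _ ≤ N ^ p := ENNReal.rpow_le_rpow h5 hp0.le
  rw [← ENNReal.tsum_mul_left, ENNReal.tsum_eq_iSup_sum]
  refine iSup_le fun S => ?_
  have e4 : ∀ i, ENNReal.ofReal (κ * κ') ^ p *
      ∑' j, ENNReal.ofReal (z i j * (w i * w' j)) ^ p * wt p i * wt p j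
      = ∑' j, ENNReal.ofReal (κ * κ') ^ p *
        (ENNReal.ofReal (z i j * (w i * w' j)) ^ p * wt p i * wt p j) :=
    fun i => ENNReal.tsum_mul_left.symm
  simp only [e4]
  rw [← Summable.tsum_finsetSum fun _ _ => ENNReal.summable, ENNReal.tsum_eq_iSup_sum]
  refine iSup_le fun S' => ?_
  rw [Finset.sum_comm]
  refine le_trans (le_of_eq ?_) (key S S')
  rw [Finset.mul_sum]
  exact Finset.sum_congr rfl fun i _ => by rw [Finset.mul_sum]

/-! ### Lower bound for the modulus of smoothness -/

/-- The multiplier of the centered difference averaged over steps in `[0, δ]`. -/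
def avgMult (α δ : ℝ) (ν : ℕ) : ℝ :=
  δ⁻¹ * ∫ t in (0:ℝ)..δ, mult α t ν (((ν : ℝ) + 1) * (α * t) + 0)

theorem continuous_mult {α : ℝ} (hα : 0 < α) (ν : ℕ) :
    Continuous fun t => mult α t ν (((ν : ℝ) + 1) * (α * t) + 0) := by
  simp only [add_zero, mult_high]
  refine continuous_tsum (u := fun j => |dcoef α j|) (fun j => by fun_prop)
    (summable_abs_dcoef hα) fun j t => ?_
  rw [norm_mul, norm_eq_abs, norm_eq_abs]
  exact mul_le_of_le_one_right (abs_nonneg _) (abs_cos_le_one _)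

theorem avgMult_eq {α δ : ℝ} (hα : 0 < α) (hδ : 0 < δ) (ν : ℕ) :
    avgMult α δ ν
      = ∑' j : ℕ, dcoef α j * (δ⁻¹ * ∫ t in (0:ℝ)..δ, cos (j * ((ν : ℝ) + 1) * t)) := by
  have hint : ∀ j : ℕ, Integrable (fun t => dcoef α j * cos (j * ((ν : ℝ) + 1) * t))
      (volume.restrict (Set.Ioc 0 δ)) := fun j =>
    ((continuous_const.mul (by fun_prop)).intervalIntegrable 0 δ).1
  have h := hasSum_integral_of_summable_integral_norm hint ?_
  · have h2 := h.mul_left δ⁻¹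
    rw [avgMult, intervalIntegral.integral_of_le hδ.le]
    simp only [add_zero, mult_high]
    rw [← h2.tsum_eq]
    congr 1; ext j
    rw [intervalIntegral.integral_of_le hδ.le, integral_const_mul]
    ring
  · refine Summable.of_nonneg_of_le (fun j => integral_nonneg fun t => norm_nonneg _)
      (fun j => ?_) ((summable_abs_dcoef hα).mul_right δ)
    calc ∫ t in Set.Ioc 0 δ, ‖dcoef α j * cos (j * ((ν : ℝ) + 1) * t)‖
        ≤ ∫ t in Set.Ioc 0 δ, |dcoef α j| := by
          refine integral_mono (hint j).norm (integrable_const _) fun t => ?_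
          simp only [norm_mul, norm_eq_abs]
          exact mul_le_of_le_one_right (abs_nonneg _) (abs_cos_le_one _)
      _ = |dcoef α j| * δ := by
          rw [setIntegral_const, smul_eq_mul, measureReal_def, Real.volume_Ioc, sub_zero,
            ENNReal.toReal_ofReal hδ.le, mul_comm]

theorem half_le_avgMult {α δ : ℝ} (hα : 0 < α) (hδ : 0 < δ) {ν : ℕ}
    (hν : 2 * dmass α ≤ ((ν : ℝ) + 1) * δ) : 1 / 2 ≤ avgMult α δ ν := by
  set c : ℕ → ℝ := fun j => δ⁻¹ * ∫ t in (0:ℝ)..δ, cos (j * ((ν : ℝ) + 1) * t) with hc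
  have hν1 : 0 < ((ν : ℝ) + 1) * δ := by positivity
  have hc0 : c 0 = 1 := by
    simp [hc, hδ.ne']
  have hcj : ∀ j : ℕ, j ≠ 0 → |c j| ≤ 1 / (((ν : ℝ) + 1) * δ) := by
    intro j hj
    have hj1 : (1 : ℝ) ≤ j := by exact_mod_cast Nat.one_le_iff_ne_zero.2 hj
    have hne : (j : ℝ) * ((ν : ℝ) + 1) ≠ 0 := by positivity
    have : c j = sin (j * ((ν : ℝ) + 1) * δ) / (j * (((ν : ℝ) + 1) * δ)) := by
      simp only [hc]
      rw [intervalIntegral.integral_comp_mul_left (fun t => cos t) hne, integral_cos]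
      simp only [mul_zero, sin_zero, sub_zero, smul_eq_mul]
      field_simp
    rw [this, abs_div, abs_of_pos (by positivity : 0 < (j : ℝ) * (((ν : ℝ) + 1) * δ))]
    exact div_le_div₀ zero_le_one (abs_sin_le_one _) hν1 (le_mul_of_one_le_left hν1.le hj1)
  have hb : ∀ j, |if j = 0 then 0 else c j| ≤ 1 / (((ν : ℝ) + 1) * δ) := by
    intro j
    split_ifs with h
    · rw [abs_zero]; positivity
    · exact hcj j h
  have hb1 : ∀ j : ℕ, |if j = 0 then (1 : ℝ) else 0| ≤ 1 := by
    intro j; split_ifs <;> simp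
  have e : avgMult α δ ν = 1 + ∑' j, dcoef α j * (if j = 0 then 0 else c j) := by
    have h1 : ∑' j : ℕ, dcoef α j * (if j = 0 then (1 : ℝ) else 0) = 1 := by
      rw [tsum_eq_single 0 fun j hj => by simp [hj]]
      simp [dcoef_zero]
    have h2 := (summable_dcoef_mul hα hb1).tsum_add (summable_dcoef_mul hα hb)
    rw [h1] at h2
    rw [avgMult_eq hα hδ, ← h2]
    congr 1; ext j
    change dcoef α j * c j = _
    rcases eq_or_ne j 0 with rfl | hj
    · rw [hc0]; simp
    · simp [hj]
  have h2 := abs_tsum_dcoef_mul_le hα hb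
  have h3 : dmass α * (1 / (((ν : ℝ) + 1) * δ)) ≤ 1 / 2 := by
    rw [mul_one_div, div_le_iff₀ hν1]; linarith
  rw [e]
  linarith [neg_le_of_abs_le (h2.trans h3)]

/-- Multipliers of fractional differences with steps in `[0, δ]`, and their averages. -/
def Reach (α δ : ℝ) (lam : ℕ → ℝ) : Prop :=
  (∃ h ∈ Set.Icc 0 δ, ∃ τ φ, lam = fun ν => mult α h ν (((ν : ℝ) + 1) * τ + φ)) ∨
    lam = avgMult α δ

theorem DualBd.of_reach {q : ℝ} {z : ℕ → ℕ → ℝ} {N : ℝ≥0∞} {m m' : ℕ} {lam lam' : ℕ → ℝ}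
    {α δ : ℝ} (hα : 0 < α) (hδ : 0 < δ)
    (h : ∀ t ∈ Set.Icc 0 δ, ∀ τ φ,
      DualBd q z N m m' (fun ν => mult α t ν (((ν : ℝ) + 1) * τ + φ)) lam')
    (hl : Reach α δ lam) : DualBd q z N m m' lam lam' := by
  rcases hl with ⟨t, ht, τ, φ, rfl⟩ | rfl
  · exact h t ht τ φ
  · exact DualBd.average (lam := fun t ν => mult α t ν (((ν : ℝ) + 1) * (α * t) + 0)) hδ
      (continuous_mult hα) fun t ht => h t ht (α * t) 0

theorem half_mul_le_sum {lam : ℕ → ℝ} {m i : ℕ} {b : ℝ} (hb : 0 ≤ b) (hm : 2 * m ≤ i)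
    (h0 : ∀ ν ∈ Finset.Icc m i, 0 ≤ lam ν) (h : ∀ ν ∈ Finset.Icc m i, i ≤ 2 * ν + 1 → b ≤ lam ν) :
    b / 2 * ((i : ℝ) + 1) ≤ ∑ ν ∈ Finset.Icc m i, lam ν := by
  have hsub : Finset.Icc (i / 2) i ⊆ Finset.Icc m i := Finset.Icc_subset_Icc (by omega) le_rfl
  refine le_trans ?_ (Finset.sum_le_sum_of_subset_of_nonneg hsub fun ν hν _ => h0 ν hν)
  refine le_trans ?_ (Finset.card_nsmul_le_sum _ _ b fun ν hν =>
    h ν (hsub hν) (by have := (Finset.mem_Icc.1 hν).1; omega))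
  rw [nsmul_eq_mul, Nat.card_Icc]
  have : (i : ℝ) + 1 ≤ 2 * ((i + 1 - i / 2 : ℕ) : ℝ) := by
    have : i + 1 ≤ 2 * (i + 1 - i / 2) := by omega
    exact_mod_cast this
  nlinarith

theorem exists_blocks {α : ℝ} (hα : 0 < α) : ∃ κ > (0 : ℝ), ∀ n : ℕ, 1 ≤ n →
    ∃ (m : Fin 2 → ℕ) (lam w : Fin 2 → ℕ → ℝ), (∀ b, Reach α (1 / n) (lam b)) ∧
      (∀ b i, 0 ≤ w b i) ∧
      (∀ b i, w b i ≠ 0 → (∀ ν ∈ Finset.Icc (m b) i, 0 ≤ lam b ν) ∧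
        κ * w b i * ((i : ℝ) + 1) ≤ ∑ ν ∈ Finset.Icc (m b) i, lam b ν) ∧
      ∀ i, ∃ b, w b i = wgt α n i := by
  set θ := ⌈2 * dmass α⌉₊ with hθ
  set L : ℝ := 2 * θ + 1 with hL
  have hL0 : 0 < L := by positivity
  set κ₀ : ℝ := (1 / (π * L)) ^ α with hκ
  have hκ0 : 0 < κ₀ := by positivity
  refine ⟨min (κ₀ / 2) (1 / 4), by positivity, fun n hn => ?_⟩
  have hn0 : (0 : ℝ) < n := by exact_mod_cast hn
  set h : ℝ := 1 / (L * n) with hh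
  have hh0 : 0 < h := by positivity
  refine ⟨![0, θ * n], ![fun ν => mult α h ν (((ν : ℝ) + 1) * (α * h / 2) + α * π / 2),
    avgMult α (1 / n)], ![fun i => if i < 2 * (θ * n) then wgt α n i else 0,
    fun i => if i < 2 * (θ * n) then 0 else wgt α n i], ?_, ?_, ?_, ?_⟩
  · intro b
    fin_cases b
    · refine Or.inl ⟨h, ⟨hh0.le, ?_⟩, α * h / 2, α * π / 2, rfl⟩
      rw [hh]
      apply one_div_le_one_div_of_le hn0
      have : 0 ≤ (θ : ℝ) := by positivity
      nlinarith
    · exact Or.inr rfl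
  · intro b i
    have := wgt_pos (α := α) hn i
    fin_cases b <;> simp only <;> simp <;> split_ifs <;> linarith
  · intro b i hw
    fin_cases b
    · simp only [Fin.zero_eta, Fin.isValue, Matrix.cons_val_zero, ne_eq, ite_eq_right_iff,
        not_forall] at hw ⊢
      obtain ⟨hi, -⟩ := hw
      rw [if_pos hi]
      have hi' : (i : ℝ) + 1 ≤ 2 * (θ * n) := by exact_mod_cast hi
      have hν1 : ∀ ν ∈ Finset.Icc 0 i, ((ν : ℝ) + 1) * h ≤ 1 := by
        intro ν hν
        have h1 : (ν : ℝ) ≤ i := by exact_mod_cast (Finset.mem_Icc.1 hν).2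
        rw [hh, mul_one_div, div_le_one (by positivity)]
        nlinarith
      have hlow : ∀ ν ∈ Finset.Icc 0 i, (((ν : ℝ) + 1) * h * (2 / π)) ^ α
          ≤ mult α h ν (((ν : ℝ) + 1) * (α * h / 2) + α * π / 2) := by
        intro ν hν
        rw [mult_low hα hh0.le (hν1 ν hν)]
        have := Real.mul_le_sin (x := ((ν : ℝ) + 1) * h / 2) (by positivity)
          (by linarith [hν1 ν hν, pi_gt_three])
        apply Real.rpow_le_rpow (by positivity) _ hα.le
        linarith
      have h0 : ∀ ν ∈ Finset.Icc 0 i,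
          0 ≤ mult α h ν (((ν : ℝ) + 1) * (α * h / 2) + α * π / 2) := fun ν hν =>
        le_trans (by positivity) (hlow ν hν)
      refine ⟨h0, ?_⟩
      refine le_trans ?_ (half_mul_le_sum (b := κ₀ * wgt α n i)
        (mul_nonneg hκ0.le (wgt_pos hn i).le) (by omega) h0 fun ν hν hν2 =>
          le_trans ?_ (hlow ν hν))
      · have : min (κ₀ / 2) (1 / 4) ≤ κ₀ / 2 := min_le_left _ _
        have h1 := wgt_pos (α := α) hn i
        calc min (κ₀ / 2) (1 / 4) * wgt α n i * ((i : ℝ) + 1)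
            ≤ κ₀ / 2 * wgt α n i * ((i : ℝ) + 1) := by gcongr
          _ = _ := by ring
      · rw [hκ, wgt, ← Real.mul_rpow (by positivity) (by positivity)]
        apply Real.rpow_le_rpow (by positivity) _ hα.le
        have h2 : (i : ℝ) + 1 ≤ 2 * ((ν : ℝ) + 1) := by
          have : i + 1 ≤ 2 * (ν + 1) := by omega
          exact_mod_cast this
        calc 1 / (π * L) * min (((i : ℝ) + 1) / n) 1 ≤ 1 / (π * L) * (((i : ℝ) + 1) / n) := by
              gcongr; exact min_le_left _ _
          _ ≤ 1 / (π * L) * ((2 * ((ν : ℝ) + 1)) / n) := by gcongr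
          _ = _ := by rw [hh]; field_simp
    · simp only [Fin.mk_one, Fin.isValue, Matrix.cons_val_one, Matrix.cons_val_fin_one, ne_eq,
        ite_eq_left_iff, not_forall] at hw ⊢
      obtain ⟨hi, -⟩ := hw
      rw [if_neg hi]
      have hhigh : ∀ ν ∈ Finset.Icc (θ * n) i, 1 / 2 ≤ avgMult α (1 / n) ν := by
        intro ν hν
        apply half_le_avgMult hα (by positivity)
        have h1 : ((θ * n : ℕ) : ℝ) ≤ ν := by exact_mod_cast (Finset.mem_Icc.1 hν).1
        have h2 : 2 * dmass α ≤ θ := Nat.le_ceil _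
        rw [mul_one_div, le_div_iff₀ hn0]
        push_cast at h1
        nlinarith
      refine ⟨fun ν hν => by linarith [hhigh ν hν], ?_⟩
      refine le_trans ?_ (half_mul_le_sum (b := 1 / 2) (by norm_num) (by omega)
        (fun ν hν => by linarith [hhigh ν hν]) fun ν hν _ => hhigh ν hν)
      have h1 : min (κ₀ / 2) (1 / 4) ≤ 1 / 4 := min_le_right _ _
      have h2 := wgt_le_one hα (n := n) i
      have h3 := wgt_pos (α := α) hn i
      calc min (κ₀ / 2) (1 / 4) * wgt α n i * ((i : ℝ) + 1)
          ≤ 1 / 4 * 1 * ((i : ℝ) + 1) := by gcongr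
        _ = _ := by ring
  · intro i
    by_cases hi : i < 2 * (θ * n)
    · exact ⟨0, by simp [hi]⟩
    · exact ⟨1, by simp [hi]⟩

theorem exists_weighted_sum_le_mixedMod {p α₁ α₂ : ℝ} (hp : 1 < p) (hα₁ : 0 < α₁) (hα₂ : 0 < α₂) :
    ∃ C ≠ (⊤ : ℝ≥0∞), ∀ (f : ℝ → ℝ → ℝ) (z : ℕ → ℕ → ℝ) (n₁ n₂ : ℕ), 1 ≤ n₁ → 1 ≤ n₂ →
      Nice f → MonoCoef z →
      (∀ ν μ φ ψ, pair f (cosw ν φ) (cosw μ ψ) = π ^ 2 * z ν μ * cos φ * cos ψ) →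
      ∑' i, ∑' j, ENNReal.ofReal (z i j * (wgt α₁ n₁ i * wgt α₂ n₂ j)) ^ p * wt p i * wt p j
        ≤ C * mixedMod p α₁ α₂ (1 / n₁) (1 / n₂) f ^ p := by
  have hpq := Real.HolderConjugate.conjExponent hp
  obtain ⟨K, hK, hdual⟩ := exists_dualBd_of_pair hpq
  obtain ⟨κ₁, hκ₁, hb₁⟩ := exists_blocks hα₁
  obtain ⟨κ₂, hκ₂, hb₂⟩ := exists_blocks hα₂
  have hp0 : 0 < p := by linarith
  set D := ENNReal.ofReal (κ₁ * κ₂) ^ p with hD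
  have hD0 : D ≠ 0 := by
    simp only [hD, ne_eq, ENNReal.rpow_eq_zero_iff, not_or, not_and]
    exact ⟨fun h => absurd h (by simpa using mul_pos hκ₁ hκ₂), fun h => absurd h (by simp)⟩
  have hDt : D ≠ ⊤ := ENNReal.rpow_ne_top_of_nonneg hp0.le ENNReal.ofReal_ne_top
  refine ⟨4 * (D⁻¹ * K ^ p), ENNReal.mul_ne_top (by simp) (ENNReal.mul_ne_top
    (ENNReal.inv_ne_top.2 hD0) (ENNReal.rpow_ne_top_of_nonneg hp0.le hK)), ?_⟩
  intro f z n₁ n₂ hn₁ hn₂ hf hz hpair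
  obtain ⟨m₁, lam₁, w₁, hr₁, hw₁, hl₁, hc₁⟩ := hb₁ n₁ hn₁
  obtain ⟨m₂, lam₂, w₂, hr₂, hw₂, hl₂, hc₂⟩ := hb₂ n₂ hn₂
  set Ω := mixedMod p α₁ α₂ (1 / n₁) (1 / n₂) f with hΩ
  have hδ₁ : (0 : ℝ) < 1 / n₁ := by have : (0 : ℝ) < n₁ := by exact_mod_cast hn₁
                                    positivity
  have hδ₂ : (0 : ℝ) < 1 / n₂ := by have : (0 : ℝ) < n₂ := by exact_mod_cast hn₂
                                    positivity
  have hbase : ∀ h₁ ∈ Set.Icc 0 (1 / (n₁ : ℝ)), ∀ τ φ, ∀ h₂ ∈ Set.Icc 0 (1 / (n₂ : ℝ)), ∀ τ' φ',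
      ∀ m m', DualBd (p.conjExponent) z (K * Ω) m m'
        (fun ν => mult α₁ h₁ ν (((ν : ℝ) + 1) * τ + φ))
        (fun ν => mult α₂ h₂ ν (((ν : ℝ) + 1) * τ' + φ')) := by
    intro h₁ hh₁ τ φ h₂ hh₂ τ' φ' m m' S S' c hc
    refine (hdual z (diffX α₁ h₁ (diffY α₂ h₂ f)) ((hf.diffY hα₂ h₂).diffX hα₁ h₁) m m' _ _
      τ τ' φ φ' (fun ν μ _ _ => ?_) S S' c hc).trans ?_
    · rw [pair_diff_cosw hα₁ hα₂ h₁ h₂ hf (hpair ν μ)]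
      ring
    · refine mul_le_mul' (mul_le_mul' le_rfl ?_) le_rfl
      rw [hΩ, mixedMod]
      exact le_iSup₂_of_le h₁ (by rw [abs_of_nonneg hh₁.1]; exact hh₁.2)
        (le_iSup₂_of_le h₂ (by rw [abs_of_nonneg hh₂.1]; exact hh₂.2) le_rfl)
  have hall : ∀ b b', DualBd (p.conjExponent) z (K * Ω) (m₁ b) (m₂ b') (lam₁ b) (lam₂ b') := by
    intro b b'
    refine DualBd.of_reach hα₁ hδ₁ (fun t ht τ φ => ?_) (hr₁ b)
    refine DualBd.swap (DualBd.of_reach hα₂ hδ₂ (fun t' ht' τ' φ' => ?_) (hr₂ b'))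
    exact DualBd.swap (hbase t ht τ φ t' ht' τ' φ' _ _)
  set F : Fin 2 → Fin 2 → ℕ → ℕ → ℝ≥0∞ := fun b b' i j =>
    ENNReal.ofReal (z i j * (w₁ b i * w₂ b' j)) ^ p * wt p i * wt p j with hF
  have hFb : ∀ b b', ∑' i, ∑' j, F b b' i j ≤ D⁻¹ * K ^ p * Ω ^ p := by
    intro b b'
    have := (hall b b').mul_sum_le hpq hz hκ₁.le hκ₂.le (hw₁ b) (hw₂ b') (hl₁ b) (hl₂ b')
    rw [ENNReal.mul_rpow_of_nonneg _ _ hp0.le] at this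
    rw [mul_assoc, ← ENNReal.div_eq_inv_mul, ENNReal.le_div_iff_mul_le (Or.inl hD0) (Or.inl hDt),
      mul_comm]
    exact this
  calc _ ≤ ∑' i, ∑' j, ∑ b, ∑ b', F b b' i j := by
        refine ENNReal.tsum_le_tsum fun i => ENNReal.tsum_le_tsum fun j => ?_
        obtain ⟨b, hb⟩ := hc₁ i
        obtain ⟨b', hb'⟩ := hc₂ j
        rw [← hb, ← hb']
        exact (Finset.single_le_sum (f := fun b' => F b b' i j) (fun _ _ => zero_le)
          (Finset.mem_univ b')).trans (Finset.single_le_sum (f := fun b => ∑ b', F b b' i j)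
          (fun _ _ => zero_le) (Finset.mem_univ b))
    _ = ∑ b, ∑ b', ∑' i, ∑' j, F b b' i j := by
        simp only [Summable.tsum_finsetSum fun _ _ => ENNReal.summable]
    _ ≤ ∑ b : Fin 2, ∑ b' : Fin 2, D⁻¹ * K ^ p * Ω ^ p :=
        Finset.sum_le_sum fun b _ => Finset.sum_le_sum fun b' _ => hFb b b'
    _ = _ := by
        simp only [Finset.sum_const, Finset.card_univ, Fintype.card_fin, nsmul_eq_mul]
        push_cast
        ring

/-! ### Lower bound for angular approximation -/

theorem integral_cos_mul_cos {k N : ℕ} (h : k < N) (c a : ℝ) :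
    ∫ x, cos (k * x + c) * cos (N * x + a) ∂circ = 0 := by
  have key : ∀ (n : ℕ) (b : ℝ), n ≠ 0 → ∫ x in (0:ℝ)..(2 * π), cos (n * x + b) = 0 := by
    intro n b hn
    rw [intervalIntegral.integral_comp_mul_add (fun t => cos t) (by exact_mod_cast hn),
      integral_cos]
    have : (n : ℝ) * (2 * π) + b = b + n * (2 * π) := by ring
    rw [this, sin_add_nat_mul_two_pi]
    simp
  have e : ∀ x : ℝ, cos (k * x + c) * cos (N * x + a)
      = 1 / 2 * (cos (((N + k : ℕ) : ℝ) * x + (a + c))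
        + cos (((N - k : ℕ) : ℝ) * x + (a - c))) := by
    intro x
    have h1 := cos_add (N * x + a) (k * x + c)
    have h2 := cos_sub (N * x + a) (k * x + c)
    have e1 : ((N + k : ℕ) : ℝ) * x + (a + c) = (N * x + a) + (k * x + c) := by push_cast; ring
    have e2 : ((N - k : ℕ) : ℝ) * x + (a - c) = (N * x + a) - (k * x + c) := by
      push_cast [h.le]; ring
    rw [e1, e2, h1, h2]; ring
  unfold circ
  rw [← intervalIntegral.integral_of_le two_pi_pos.le]
  simp only [e]
  rw [intervalIntegral.integral_const_mul, intervalIntegral.integral_add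
    (Continuous.intervalIntegrable (by fun_prop) _ _)
    (Continuous.intervalIntegrable (by fun_prop) _ _), key _ _ (by omega), key _ _ (by omega)]
  simp

theorem TrigPolyX.nice {p : ℝ} (hp : 1 < p) {m : ℕ} {T : ℝ → ℝ → ℝ} (h : TrigPolyX p m T) :
    Nice T := by
  obtain ⟨h1, h2, h3, a, b, h4⟩ := h
  refine Nice.of_Lp2Norm hp h1 (fun y x => ?_) h3 h2
  simp only [h4]
  refine Finset.sum_congr rfl fun k _ => ?_
  rw [mul_add, cos_add_nat_mul_two_pi, sin_add_nat_mul_two_pi]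

theorem TrigPolyX.pair_eq_zero {p : ℝ} (hp : 1 < p) {m : ℕ} {T : ℝ → ℝ → ℝ} (h : TrigPolyX p m T)
    {ν : ℕ} (hν : m ≤ ν) (φ : ℝ) {ψ : ℝ → ℝ} (hψ : TestFun ψ) : pair T (cosw ν φ) ψ = 0 := by
  unfold pair torus
  rw [integral_prod_symm _ ((TrigPolyX.nice hp h).integrable_mul (testFun_cosw ν φ) hψ)]
  obtain ⟨h1, h2, h3, a, b, h4⟩ := h
  refine integral_eq_zero_of_ae (Filter.Eventually.of_forall fun y => ?_)
  have e : ∀ x, T x y * (cosw ν φ x * ψ y) = ∑ k ∈ Finset.range (m + 1),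
      (a k y * ψ y * (cos (k * x + 0) * cos (((ν + 1 : ℕ) : ℝ) * x + φ))
        + b k y * ψ y * (cos (k * x + -(π / 2)) * cos (((ν + 1 : ℕ) : ℝ) * x + φ))) := by
    intro x
    rw [h4, Finset.sum_mul]
    refine Finset.sum_congr rfl fun k _ => ?_
    rw [← sub_eq_add_neg, cos_sub_pi_div_two, add_zero, cosw]
    push_cast; ring
  have hint : ∀ (k : ℕ) (c d : ℝ), Integrable
      (fun x => d * (cos (k * x + c) * cos (((ν + 1 : ℕ) : ℝ) * x + φ))) circ := fun k c d =>
    (Continuous.intervalIntegrable (by fun_prop) 0 (2 * π)).1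
  simp only [e, Pi.zero_apply]
  have hadd : ∀ k : ℕ, Integrable (fun x =>
      a k y * ψ y * (cos (k * x + 0) * cos (((ν + 1 : ℕ) : ℝ) * x + φ))
        + b k y * ψ y * (cos (k * x + -(π / 2)) * cos (((ν + 1 : ℕ) : ℝ) * x + φ))) circ :=
    fun k => (hint k _ _).add (hint k _ _)
  rw [integral_finsetSum _ fun k _ => hadd k]
  refine Finset.sum_eq_zero fun k hk => ?_
  have hk' : k < ν + 1 := by have := Finset.mem_range.1 hk; omega
  rw [integral_add (hint k _ _) (hint k _ _), integral_const_mul, integral_const_mul,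
    integral_cos_mul_cos hk', integral_cos_mul_cos hk']
  simp

theorem lp2Norm_flip {p : ℝ} (hp : 0 < p) {f : ℝ → ℝ → ℝ} (hf : Measurable (Function.uncurry f)) :
    Lp2Norm p (fun x y => f y x) = Lp2Norm p f := by
  rw [Lp2Norm_eq _ _ hp, Lp2Norm_eq _ _ hp, lintegral_lintegral_swap]
  exact (hf.comp measurable_swap).norm.ennreal_ofReal.pow_const p |>.aemeasurable

theorem TrigPolyY.flip {p : ℝ} (hp : 0 < p) {m : ℕ} {T : ℝ → ℝ → ℝ} (h : TrigPolyY p m T) :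
    TrigPolyX p m fun x y => T y x := by
  obtain ⟨h1, h2, h3, a, b, h4⟩ := h
  exact ⟨h1.comp measurable_swap, by rwa [lp2Norm_flip hp h1], h3, a, b, fun x y => h4 y x⟩

theorem Nice.sub {u v : ℝ → ℝ → ℝ} (hu : Nice u) (hv : Nice v) :
    Nice fun x y => u x y - v x y where
  meas := hu.meas.sub hv.meas
  per_x y x := by
    have h1 := hu.per_x y x
    have h2 := hv.per_x y x
    simp only at h1 h2 ⊢
    rw [h1, h2]
  per_y x y := by
    have h1 := hu.per_y x y
    have h2 := hv.per_y x y
    simp only at h1 h2 ⊢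
    rw [h1, h2]
  int := hu.int.sub hv.int

theorem pair_sub {u v : ℝ → ℝ → ℝ} (hu : Nice u) (hv : Nice v) {φ ψ : ℝ → ℝ} (hφ : TestFun φ)
    (hψ : TestFun ψ) : pair (fun x y => u x y - v x y) φ ψ = pair u φ ψ - pair v φ ψ := by
  unfold pair
  rw [← integral_sub (hu.integrable_mul hφ hψ) (hv.integrable_mul hφ hψ)]
  congr 1; ext z; ring

/-- The indicator of the indices at least `2 * m`. -/
def high (m i : ℕ) : ℝ := if 2 * m ≤ i then 1 else 0

theorem exists_high_sum_le {p : ℝ} (hp : 1 < p) :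
    ∃ C ≠ (⊤ : ℝ≥0∞), C ≠ 0 ∧ ∀ (u : ℝ → ℝ → ℝ) (z : ℕ → ℕ → ℝ) (m m' : ℕ),
      Nice u → MonoCoef z → (∀ ν μ, m ≤ ν → m' ≤ μ →
        pair u (cosw ν 0) (cosw μ 0) = π ^ 2 * z ν μ) →
      (∑' i, ∑' j, ENNReal.ofReal (z i j * (high m i * high m' j)) ^ p * wt p i * wt p j) ^ (1 / p)
        ≤ C * Lp2Norm p u := by
  have hpq := Real.HolderConjugate.conjExponent hp
  have hp0 : 0 < p := by linarith
  obtain ⟨K, hK, hdual⟩ := exists_dualBd_of_pair hpq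
  refine ⟨4 * (K + 1), ENNReal.mul_ne_top (by simp) (by simp [hK]), by simp, ?_⟩
  intro u z m m' hu hz hpair
  have hh0 : ∀ m i, 0 ≤ high m i := fun m i => by unfold high; split_ifs <;> simp
  have hl : ∀ m i, high m i ≠ 0 → (∀ ν ∈ Finset.Icc m i, (0 : ℝ) ≤ (fun _ => 1 : ℕ → ℝ) ν) ∧
      1 / 2 * high m i * ((i : ℝ) + 1) ≤ ∑ ν ∈ Finset.Icc m i, (fun _ => 1 : ℕ → ℝ) ν := by
    intro m i hi
    unfold high at hi ⊢
    rw [ne_eq, ite_eq_right_iff, not_forall] at hi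
    obtain ⟨hi, -⟩ := hi
    rw [if_pos hi, mul_one]
    exact ⟨fun _ _ => zero_le_one, half_mul_le_sum zero_le_one hi (fun _ _ => zero_le_one)
      fun _ _ _ => le_rfl⟩
  have h1 := (hdual z u hu m m' (fun _ => 1) (fun _ => 1) 0 0 0 0 (fun ν μ hν hμ => by
    simp only [mul_zero, add_zero, mul_one]; exact hpair ν μ hν hμ)).mul_sum_le hpq hz
      (by norm_num) (by norm_num) (hh0 m) (hh0 m') (hl m) (hl m')
  set A := ∑' i, ∑' j, ENNReal.ofReal (z i j * (high m i * high m' j)) ^ p * wt p i * wt p j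
  have h2 := ENNReal.rpow_le_rpow h1 (z := 1 / p) (by positivity)
  rw [ENNReal.mul_rpow_of_nonneg _ _ (by positivity), ← ENNReal.rpow_mul, ← ENNReal.rpow_mul,
    mul_one_div_cancel hp0.ne', ENNReal.rpow_one, ENNReal.rpow_one] at h2
  have h3 : ENNReal.ofReal (1 / 2 * (1 / 2)) = 4⁻¹ := by
    rw [show (1 / 2 * (1 / 2) : ℝ) = (4 : ℝ)⁻¹ by norm_num, ENNReal.ofReal_inv_of_pos (by norm_num)]
    simp
  rw [h3, ← ENNReal.div_eq_inv_mul, ENNReal.div_le_iff_le_mul (by simp) (by simp)] at h2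
  refine h2.trans ?_
  calc K * Lp2Norm p u * 4 = 4 * K * Lp2Norm p u := by ring
    _ ≤ _ := by gcongr; exact le_self_add

theorem exists_high_sum_le_Yapprox {p : ℝ} (hp : 1 < p) :
    ∃ C ≠ (⊤ : ℝ≥0∞), ∀ (f : ℝ → ℝ → ℝ) (z : ℕ → ℕ → ℝ) (m m' : ℕ),
      Nice f → MonoCoef z →
      (∀ ν μ φ ψ, pair f (cosw ν φ) (cosw μ ψ) = π ^ 2 * z ν μ * cos φ * cos ψ) →
      ∑' i, ∑' j, ENNReal.ofReal (z i j * (high m i * high m' j)) ^ p * wt p i * wt p j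
        ≤ C * Yapprox p m m' f ^ p := by
  have hp0 : 0 < p := by linarith
  obtain ⟨C, hC, hC0, h⟩ := exists_high_sum_le hp
  refine ⟨C ^ p, ENNReal.rpow_ne_top_of_nonneg hp0.le hC, ?_⟩
  intro f z m m' hf hz hpair
  set A := ∑' i, ∑' j, ENNReal.ofReal (z i j * (high m i * high m' j)) ^ p * wt p i * wt p j
    with hA
  have key : A ^ (1 / p) / C ≤ Yapprox p m m' f := by
    refine le_iInf fun T₁ => le_iInf fun h₁ => le_iInf fun T₂ => le_iInf fun h₂ => ?_
    rw [ENNReal.div_le_iff_le_mul (Or.inl hC0) (Or.inl hC), mul_comm]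
    have n₁ := TrigPolyX.nice hp h₁
    have h₂' := TrigPolyY.flip hp0 h₂
    have n₂ : Nice T₂ := (TrigPolyX.nice hp h₂').flip
    refine h _ z m m' ((hf.sub n₁).sub n₂) hz fun ν μ hν hμ => ?_
    have t₁ := testFun_cosw ν 0
    have t₂ := testFun_cosw μ 0
    rw [pair_sub (hf.sub n₁) n₂ t₁ t₂, pair_sub hf n₁ t₁ t₂, hpair,
      TrigPolyX.pair_eq_zero hp h₁ hν 0 t₂, ← pair_flip T₂,
      TrigPolyX.pair_eq_zero hp h₂' hμ 0 t₁]
    simp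
  rw [ENNReal.div_le_iff_le_mul (Or.inl hC0) (Or.inl hC), mul_comm] at key
  calc A = (A ^ (1 / p)) ^ p := by
        rw [← ENNReal.rpow_mul, one_div_mul_cancel hp0.ne', ENNReal.rpow_one]
    _ ≤ (C * Yapprox p m m' f) ^ p := ENNReal.rpow_le_rpow key hp0.le
    _ = _ := ENNReal.mul_rpow_of_nonneg _ _ hp0.le

theorem exists_sum_le_Lp2Norm {p : ℝ} (hp : 1 < p) :
    ∃ C ≠ (⊤ : ℝ≥0∞), ∀ (f : ℝ → ℝ → ℝ) (z : ℕ → ℕ → ℝ), Nice f → MonoCoef z →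
      (∀ ν μ φ ψ, pair f (cosw ν φ) (cosw μ ψ) = π ^ 2 * z ν μ * cos φ * cos ψ) →
      ∑' i, ∑' j, ENNReal.ofReal (z i j) ^ p * wt p i * wt p j ≤ C * Lp2Norm p f ^ p := by
  have hp0 : 0 < p := by linarith
  obtain ⟨C, hC, hC0, h⟩ := exists_high_sum_le hp
  refine ⟨C ^ p, ENNReal.rpow_ne_top_of_nonneg hp0.le hC, ?_⟩
  intro f z hf hz hpair
  have h1 := h f z 0 0 hf hz fun ν μ _ _ => by simp [hpair]
  simp only [high, mul_zero, zero_le, if_true, mul_one] at h1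
  have h2 := ENNReal.rpow_le_rpow h1 hp0.le
  rwa [← ENNReal.rpow_mul, one_div_mul_cancel hp0.ne', ENNReal.rpow_one,
    ENNReal.mul_rpow_of_nonneg _ _ hp0.le] at h2

/-! ### Sums of best angular approximations -/

/-- The normalized weight of the sum of best angular approximations in one variable. -/
def sumWt (β : ℝ) (n ν : ℕ) : ℝ≥0∞ := ENNReal.ofReal ((n : ℝ) ^ (-β) * ((ν : ℝ) + 1) ^ (β - 1))

theorem Ysum_rpow {p : ℝ} (hp : 0 < p) (α₁ α₂ : ℝ) (n₁ n₂ : ℕ) (f : ℝ → ℝ → ℝ) :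
    Ysum p α₁ α₂ p n₁ n₂ f ^ p = ∑ ν ∈ Finset.range (n₁ + 1), ∑ μ ∈ Finset.range (n₂ + 1),
      sumWt (α₁ * p) n₁ ν * sumWt (α₂ * p) n₂ μ * Yapprox p ν μ f ^ p := by
  have hreind : ∀ (n : ℕ) (F : ℕ → ℝ≥0∞),
      ∑ ν ∈ Finset.Icc 1 (n + 1), F ν = ∑ ν ∈ Finset.range (n + 1), F (ν + 1) := by
    intro n F
    rw [Finset.range_eq_Ico, Finset.sum_Ico_add' F 0 (n + 1) 1]
    rfl
  unfold Ysum
  rw [ENNReal.mul_rpow_of_nonneg _ _ hp.le, ← ENNReal.rpow_mul, one_div_mul_cancel hp.ne',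
    ENNReal.rpow_one, hreind, Finset.mul_sum]
  refine Finset.sum_congr rfl fun ν _ => ?_
  rw [hreind, Finset.mul_sum]
  refine Finset.sum_congr rfl fun μ _ => ?_
  rw [← mul_assoc]
  congr 1
  unfold sumWt
  rw [ENNReal.ofReal_rpow_of_nonneg (by positivity) hp.le, ← ENNReal.ofReal_mul (by positivity),
    ← ENNReal.ofReal_mul (by positivity), mul_rpow (by positivity) (by positivity),
    ← rpow_mul (by positivity), ← rpow_mul (by positivity), neg_mul, neg_mul]
  push_cast
  congr 1
  ring

theorem wgt_rpow_eq (α p : ℝ) (n i : ℕ) :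
    wgt α n i ^ p = (min (((i : ℝ) + 1) / n) 1) ^ (α * p) := by
  unfold wgt
  rw [← rpow_mul (by positivity)]

theorem ofReal_wgt_rpow_le {α p : ℝ} (hα : 0 < α) (hp : 0 < p) {n : ℕ} (hn : 1 ≤ n) (i : ℕ) :
    ENNReal.ofReal (wgt α n i) ^ p ≤ ENNReal.ofReal (2 ^ (α * p) * max 1 (α * p)) *
      ∑ ν ∈ Finset.range (n + 1), sumWt (α * p) n ν * ENNReal.ofReal (high ν i) ^ p := by
  have hβ : 0 < α * p := mul_pos hα hp
  have hn' : (0 : ℝ) < n := by exact_mod_cast hn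
  set s := min (i / 2) n + 1 with hs
  have hsub : Finset.range s ⊆ Finset.range (n + 1) := Finset.range_subset_range.2 (by omega)
  have h1 : ∑ ν ∈ Finset.range s, sumWt (α * p) n ν ≤
      ∑ ν ∈ Finset.range (n + 1), sumWt (α * p) n ν * ENNReal.ofReal (high ν i) ^ p := by
    refine le_trans (Finset.sum_le_sum fun ν hν => ?_) (Finset.sum_le_sum_of_subset hsub)
    have : 2 * ν ≤ i := by have := Finset.mem_range.1 hν; omega
    simp [high, this]
  refine le_trans ?_ (mul_le_mul' le_rfl h1)
  unfold sumWt
  rw [← ENNReal.ofReal_sum_of_nonneg fun _ _ => by positivity,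
    ← ENNReal.ofReal_mul (by positivity),
    ENNReal.ofReal_rpow_of_nonneg (wgt_pos hn i).le hp.le]
  refine ENNReal.ofReal_le_ofReal ?_
  rw [wgt_rpow_eq, ← Finset.mul_sum]
  have h2 := le_sum_rpow hβ s
  have h3 : min (((i : ℝ) + 1) / n) 1 ≤ 2 * ((n : ℝ)⁻¹ * s) := by
    have e1 : ((i : ℝ) + 1) ≤ 2 * ((i / 2 : ℕ) + 1) := by
      have : i + 1 ≤ 2 * (i / 2 + 1) := by omega
      exact_mod_cast this
    rcases le_total (i / 2) n with h | h
    · refine (min_le_left _ _).trans ?_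
      rw [hs, min_eq_left h, div_eq_inv_mul, mul_left_comm]
      push_cast at e1 ⊢
      gcongr
    · refine (min_le_right _ _).trans ?_
      rw [hs, min_eq_right h]
      have : (1 : ℝ) ≤ (n : ℝ)⁻¹ * ((n + 1 : ℕ) : ℝ) := by
        rw [← div_eq_inv_mul, one_le_div hn']; push_cast; linarith
      linarith
  calc (min (((i : ℝ) + 1) / n) 1) ^ (α * p) ≤ (2 * ((n : ℝ)⁻¹ * s)) ^ (α * p) :=
        rpow_le_rpow (by positivity) h3 hβ.le
    _ = 2 ^ (α * p) * ((n : ℝ) ^ (-(α * p)) * (s : ℝ) ^ (α * p)) := by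
        rw [mul_rpow (by positivity) (by positivity), mul_rpow (by positivity) (by positivity),
          inv_rpow hn'.le, rpow_neg hn'.le]
    _ ≤ 2 ^ (α * p) * ((n : ℝ) ^ (-(α * p)) * (max 1 (α * p) *
          ∑ i ∈ Finset.range s, ((i : ℝ) + 1) ^ (α * p - 1))) := by gcongr
    _ = _ := by ring

theorem exists_weighted_sum_le_Ysum {p α₁ α₂ : ℝ} (hp : 1 < p) (hα₁ : 0 < α₁) (hα₂ : 0 < α₂) :
    ∃ C ≠ (⊤ : ℝ≥0∞), ∀ (f : ℝ → ℝ → ℝ) (z : ℕ → ℕ → ℝ) (n₁ n₂ : ℕ), 1 ≤ n₁ → 1 ≤ n₂ →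
      Nice f → MonoCoef z →
      (∀ ν μ φ ψ, pair f (cosw ν φ) (cosw μ ψ) = π ^ 2 * z ν μ * cos φ * cos ψ) →
      ∑' i, ∑' j, ENNReal.ofReal (z i j * (wgt α₁ n₁ i * wgt α₂ n₂ j)) ^ p * wt p i * wt p j
        ≤ C * Ysum p α₁ α₂ p n₁ n₂ f ^ p := by
  have hp0 : 0 < p := by linarith
  obtain ⟨C, hC, h⟩ := exists_high_sum_le_Yapprox hp
  set A : ℝ → ℝ≥0∞ := fun α => ENNReal.ofReal (2 ^ (α * p) * max 1 (α * p)) with hA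
  refine ⟨A α₁ * A α₂ * C, by finiteness, ?_⟩
  intro f z n₁ n₂ hn₁ hn₂ hf hz hpair
  have hh : ∀ m i, 0 ≤ high m i := fun m i => by unfold high; split_ifs <;> simp
  rw [Ysum_rpow hp0]
  have split : ∀ (i j : ℕ) {a b : ℝ}, 0 ≤ a → 0 ≤ b →
      ENNReal.ofReal (z i j * (a * b)) ^ p * wt p i * wt p j = ENNReal.ofReal (z i j) ^ p *
        (ENNReal.ofReal a ^ p * ENNReal.ofReal b ^ p) * (wt p i * wt p j) := by
    intro i j a b ha hb
    rw [ENNReal.ofReal_mul (hz.nonneg i j), ENNReal.ofReal_mul ha,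
      ENNReal.mul_rpow_of_nonneg _ _ hp0.le, ENNReal.mul_rpow_of_nonneg _ _ hp0.le, mul_assoc]
  set S : ℕ → ℕ → ℕ → ℕ → ℝ≥0∞ := fun ν μ i j =>
    ENNReal.ofReal (z i j * (high ν i * high μ j)) ^ p * wt p i * wt p j with hS
  calc ∑' i, ∑' j, ENNReal.ofReal (z i j * (wgt α₁ n₁ i * wgt α₂ n₂ j)) ^ p * wt p i * wt p j
      ≤ ∑' i, ∑' j, A α₁ * A α₂ * ∑ ν ∈ Finset.range (n₁ + 1), ∑ μ ∈ Finset.range (n₂ + 1),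
          sumWt (α₁ * p) n₁ ν * sumWt (α₂ * p) n₂ μ * S ν μ i j := by
        refine ENNReal.tsum_le_tsum fun i => ENNReal.tsum_le_tsum fun j => ?_
        rw [split i j (wgt_pos hn₁ i).le (wgt_pos hn₂ j).le]
        refine (mul_le_mul' (mul_le_mul' le_rfl (mul_le_mul' (ofReal_wgt_rpow_le hα₁ hp0 hn₁ i)
          (ofReal_wgt_rpow_le hα₂ hp0 hn₂ j))) le_rfl).trans_eq ?_
        simp only [hS, split i j (hh _ i) (hh _ j)]
        rw [mul_mul_mul_comm (ENNReal.ofReal (2 ^ (α₁ * p) * max 1 (α₁ * p))), Finset.sum_mul_sum,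
          mul_left_comm (ENNReal.ofReal (z i j) ^ p), mul_assoc (_ * _)]
        congr 1
        rw [Finset.mul_sum, Finset.sum_mul]
        refine Finset.sum_congr rfl fun ν _ => ?_
        rw [Finset.mul_sum, Finset.sum_mul]
        refine Finset.sum_congr rfl fun μ _ => ?_
        ring
    _ = A α₁ * A α₂ * ∑ ν ∈ Finset.range (n₁ + 1), ∑ μ ∈ Finset.range (n₂ + 1),
          sumWt (α₁ * p) n₁ ν * sumWt (α₂ * p) n₂ μ * ∑' i, ∑' j, S ν μ i j := by
        simp only [ENNReal.tsum_mul_left, Summable.tsum_finsetSum fun _ _ => ENNReal.summable]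
    _ ≤ A α₁ * A α₂ * ∑ ν ∈ Finset.range (n₁ + 1), ∑ μ ∈ Finset.range (n₂ + 1),
          sumWt (α₁ * p) n₁ ν * sumWt (α₂ * p) n₂ μ * (C * Yapprox p ν μ f ^ p) := by
        refine mul_le_mul' le_rfl (Finset.sum_le_sum fun ν _ => Finset.sum_le_sum fun μ _ =>
          mul_le_mul' le_rfl (h f z ν μ hf hz hpair))
    _ = _ := by
        rw [mul_assoc (A α₁ * A α₂), Finset.mul_sum _ _ C]
        congr 1
        refine Finset.sum_congr rfl fun ν _ => ?_
        rw [Finset.mul_sum _ _ C]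
        refine Finset.sum_congr rfl fun μ _ => ?_
        ring

theorem exists_sum_wt_le {p : ℝ} (hp : 1 < p) :
    ∃ C ≠ (⊤ : ℝ≥0∞), ∀ ν : ℕ,
      ∑ i ∈ Finset.range (ν + 1), wt p i ≤ C * (ENNReal.ofReal ((ν : ℝ) + 1) * wt p ν) := by
  have hm : 0 < min 1 (p - 1) := lt_min one_pos (by linarith)
  refine ⟨ENNReal.ofReal (min 1 (p - 1))⁻¹, ENNReal.ofReal_ne_top, fun ν => ?_⟩
  unfold wt
  rw [← ENNReal.ofReal_sum_of_nonneg fun _ _ => by positivity,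
    ← ENNReal.ofReal_mul (by positivity), ← ENNReal.ofReal_mul (by positivity)]
  refine ENNReal.ofReal_le_ofReal ?_
  have h := sum_rpow_le (show 0 < p - 1 by linarith) (ν + 1)
  have e : ((ν : ℝ) + 1) * ((ν : ℝ) + 1) ^ (p - 2) = ((ν : ℝ) + 1) ^ (p - 1) := by
    rw [← rpow_one_add' (by positivity) (by linarith)]
    congr 1; ring
  rw [e, inv_mul_eq_div, le_div_iff₀ hm, mul_comm]
  rw [show p - 1 - 1 = p - 2 by ring] at h
  exact_mod_cast h

theorem exists_sum_sumWt_tsum_max_le {p α : ℝ} (hp : 1 < p) (hα : 0 < α) :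
    ∃ C ≠ (⊤ : ℝ≥0∞), ∀ (n : ℕ) (X : ℕ → ℝ≥0∞), 1 ≤ n →
      ∑ ν ∈ Finset.range (n + 1), sumWt (α * p) n ν * ∑' i, X (max i ν) * wt p i
        ≤ C * ∑' s, X s * (ENNReal.ofReal (wgt α n s) ^ p * wt p s) := by
  have hp0 : 0 < p := by linarith
  have hβ : 0 < α * p := mul_pos hα hp0
  have hm : 0 < min 1 (α * p) := lt_min one_pos hβ
  obtain ⟨C, hC, hwt⟩ := exists_sum_wt_le hp
  set K : ℝ := 2 ^ (α * p) * (min 1 (α * p))⁻¹ with hK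
  refine ⟨ENNReal.ofReal K + C * ENNReal.ofReal (2 ^ (α * p)), by finiteness, ?_⟩
  intro n X hn
  have hn' : (0 : ℝ) < n := by exact_mod_cast hn
  have h2n : (n : ℝ) + 1 ≤ 2 * n := by
    have : (1 : ℝ) ≤ n := by exact_mod_cast hn
    linarith
  have hstep : ∀ ν, ∑' i, X (max i ν) * wt p i ≤ ∑' s, ind ν s * (X s * wt p s)
      + X ν * ∑ i ∈ Finset.range (ν + 1), wt p i := by
    intro ν
    rw [sum_range_eq_tsum_ind, ← ENNReal.tsum_mul_left, ← ENNReal.tsum_add]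
    refine ENNReal.tsum_le_tsum fun i => ?_
    rcases le_total ν i with h | h
    · rw [max_eq_left h]
      simp [ind, h]
    · rw [max_eq_right h]
      simp [ind, h]
  have hpt : ∀ s m : ℕ, (m : ℝ) ≤ s + 1 → m ≤ n + 1 →
      (n : ℝ) ^ (-(α * p)) * (m : ℝ) ^ (α * p) ≤ 2 ^ (α * p) * wgt α n s ^ p := by
    intro s m h1 h2
    have h2' : (m : ℝ) ≤ n + 1 := by exact_mod_cast h2
    rw [wgt_rpow_eq, rpow_neg hn'.le, ← inv_rpow hn'.le, ← mul_rpow (by positivity) (by positivity),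
      ← mul_rpow (by positivity) (by positivity)]
    refine rpow_le_rpow (by positivity) ?_ hβ.le
    rw [mul_min_of_nonneg _ _ (by norm_num), inv_mul_eq_div]
    refine le_min ?_ ?_
    · calc (m : ℝ) / n ≤ (s + 1) / n := by gcongr
        _ ≤ _ := le_mul_of_one_le_left (by positivity) (by norm_num)
    · rw [div_le_iff₀ hn']; linarith
  have hcol : ∀ s, ∑ ν ∈ Finset.range (n + 1), sumWt (α * p) n ν * ind ν s
      ≤ ENNReal.ofReal K * ENNReal.ofReal (wgt α n s) ^ p := by
    intro s
    have e : ∑ ν ∈ Finset.range (n + 1), sumWt (α * p) n ν * ind ν s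
        ≤ ∑ ν ∈ Finset.range (min (s + 1) (n + 1)), sumWt (α * p) n ν := by
      have : ∀ ν, sumWt (α * p) n ν * ind ν s = if ν ≤ s then sumWt (α * p) n ν else 0 := by
        intro ν; unfold ind; split_ifs <;> simp
      simp only [this]
      rw [← Finset.sum_filter]
      refine Finset.sum_le_sum_of_subset fun ν hν => ?_
      simp only [Finset.mem_filter, Finset.mem_range] at hν ⊢
      omega
    refine e.trans ?_
    unfold sumWt
    rw [← ENNReal.ofReal_sum_of_nonneg fun _ _ => by positivity,
      ENNReal.ofReal_rpow_of_nonneg (wgt_pos hn s).le hp0.le, ← ENNReal.ofReal_mul (by positivity)]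
    refine ENNReal.ofReal_le_ofReal ?_
    rw [← Finset.mul_sum]
    have h1 := sum_rpow_le hβ (min (s + 1) (n + 1))
    have h2 := hpt s (min (s + 1) (n + 1)) (by exact_mod_cast min_le_left _ _) (min_le_right _ _)
    rw [mul_comm, ← le_div_iff₀ hm] at h1
    calc _ ≤ (n : ℝ) ^ (-(α * p)) * (((min (s + 1) (n + 1) : ℕ) : ℝ) ^ (α * p)
          / min 1 (α * p)) := by gcongr
      _ = (n : ℝ) ^ (-(α * p)) * ((min (s + 1) (n + 1) : ℕ) : ℝ) ^ (α * p)
          * (min 1 (α * p))⁻¹ := by ring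
      _ ≤ 2 ^ (α * p) * wgt α n s ^ p * (min 1 (α * p))⁻¹ := by gcongr
      _ = _ := by rw [hK]; ring
  have hdiag : ∀ ν ∈ Finset.range (n + 1), sumWt (α * p) n ν * ENNReal.ofReal ((ν : ℝ) + 1)
      ≤ ENNReal.ofReal (2 ^ (α * p)) * ENNReal.ofReal (wgt α n ν) ^ p := by
    intro ν hν
    unfold sumWt
    rw [ENNReal.ofReal_rpow_of_nonneg (wgt_pos hn ν).le hp0.le,
      ← ENNReal.ofReal_mul (by positivity),
      ← ENNReal.ofReal_mul (by positivity)]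
    refine ENNReal.ofReal_le_ofReal ?_
    have h2 := hpt ν (ν + 1) (by push_cast; exact le_rfl) (by simpa [Nat.lt_succ_iff] using hν)
    refine le_trans (le_of_eq ?_) h2
    rw [mul_assoc, ← rpow_add_one (by positivity)]
    push_cast
    congr 2; ring
  calc ∑ ν ∈ Finset.range (n + 1), sumWt (α * p) n ν * ∑' i, X (max i ν) * wt p i
      ≤ ∑ ν ∈ Finset.range (n + 1), sumWt (α * p) n ν * (∑' s, ind ν s * (X s * wt p s)
          + X ν * (C * (ENNReal.ofReal ((ν : ℝ) + 1) * wt p ν))) :=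
        Finset.sum_le_sum fun ν _ => mul_le_mul' le_rfl ((hstep ν).trans
          (add_le_add le_rfl (mul_le_mul' le_rfl (hwt ν))))
    _ = ∑' s, (∑ ν ∈ Finset.range (n + 1), sumWt (α * p) n ν * ind ν s) * (X s * wt p s)
        + C * ∑ ν ∈ Finset.range (n + 1),
          (sumWt (α * p) n ν * ENNReal.ofReal ((ν : ℝ) + 1)) * (X ν * wt p ν) := by
        simp only [mul_add, Finset.sum_add_distrib, Finset.sum_mul]
        congr 1
        · rw [Summable.tsum_finsetSum fun _ _ => ENNReal.summable]
          refine Finset.sum_congr rfl fun ν _ => ?_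
          rw [← ENNReal.tsum_mul_left]
          simp only [mul_assoc]
        · rw [Finset.mul_sum]
          refine Finset.sum_congr rfl fun ν _ => ?_
          ring
    _ ≤ ∑' s, (ENNReal.ofReal K * ENNReal.ofReal (wgt α n s) ^ p) * (X s * wt p s)
        + C * ∑' s, (ENNReal.ofReal (2 ^ (α * p)) * ENNReal.ofReal (wgt α n s) ^ p)
          * (X s * wt p s) := by
        refine add_le_add (ENNReal.tsum_le_tsum fun s => mul_le_mul' (hcol s) le_rfl)
          (mul_le_mul' le_rfl ?_)
        exact (Finset.sum_le_sum fun ν hν => mul_le_mul' (hdiag ν hν) le_rfl).trans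
          (ENNReal.sum_le_tsum _)
    _ = _ := by
        have hc : ∀ s, X s * (ENNReal.ofReal (wgt α n s) ^ p * wt p s)
            = ENNReal.ofReal (wgt α n s) ^ p * (X s * wt p s) := fun s => mul_left_comm _ _ _
        simp only [hc, mul_assoc, ENNReal.tsum_mul_left, add_mul]

/-! ### Uniqueness of Fourier coefficients -/

theorem integral_mul_circle_eq_zero {u : ℝ → ℝ} (hu : Integrable u circ)
    (hc : ∀ n : ℕ, ∫ x, u x * cos (n * x) ∂circ = 0)
    (hs : ∀ n : ℕ, ∫ x, u x * sin (n * x) ∂circ = 0) (g : C(AddCircle (2 * π), ℂ)) :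
    ∫ x, (u x : ℂ) * g (x : AddCircle (2 * π)) ∂circ = 0 := by
  have : Fact (0 < 2 * π) := ⟨two_pi_pos⟩
  have hmeas : ∀ g : C(AddCircle (2 * π), ℂ),
      AEStronglyMeasurable (fun x : ℝ => g (x : AddCircle (2 * π))) circ := fun g =>
    (g.continuous.comp (AddCircle.continuous_mk' _)).aestronglyMeasurable
  have hint : ∀ g : C(AddCircle (2 * π), ℂ),
      Integrable (fun x : ℝ => (u x : ℂ) * g (x : AddCircle (2 * π))) circ := fun g =>
    hu.ofReal.mul_bdd (c := ‖g‖) (hmeas g)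
      (Filter.Eventually.of_forall fun x => g.norm_coe_le_norm _)
  let L : C(AddCircle (2 * π), ℂ) →ₗ[ℂ] ℂ :=
    { toFun := fun g => ∫ x, (u x : ℂ) * g (x : AddCircle (2 * π)) ∂circ
      map_add' := fun g₁ g₂ => by
        rw [← integral_add (hint g₁) (hint g₂)]
        simp [mul_add]
      map_smul' := fun c g => by
        rw [RingHom.id_apply, smul_eq_mul, ← integral_const_mul]
        simp [mul_left_comm] }
  have hL : ∀ g, ‖L g‖ ≤ (∫ x, ‖u x‖ ∂circ) * ‖g‖ := fun g => by
    refine (norm_integral_le_of_norm_le (hu.norm.mul_const ‖g‖)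
      (Filter.Eventually.of_forall fun x => ?_)).trans_eq (integral_mul_const _ _)
    rw [norm_mul, Complex.norm_real]
    gcongr
    exact g.norm_coe_le_norm _
  set L' := L.mkContinuous _ hL with hL'
  have hcos : ∀ n : ℤ, ∫ x, u x * cos (n * x) ∂circ = 0 := fun n => by
    rcases Int.natAbs_eq n with h | h <;> rw [h] <;> simpa using hc n.natAbs
  have hsin : ∀ n : ℤ, ∫ x, u x * sin (n * x) ∂circ = 0 := fun n => by
    rcases Int.natAbs_eq n with h | h <;> rw [h]
    · simpa using hs n.natAbs
    · simpa [integral_neg] using hs n.natAbs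
  have hf : ∀ n : ℤ, L' (fourier n) = 0 := fun n => by
    have e : ∀ x : ℝ, (u x : ℂ) * fourier n (x : AddCircle (2 * π))
        = ((u x * cos (n * x) : ℝ) : ℂ) + ((u x * sin (n * x) : ℝ) : ℂ) * Complex.I := by
      intro x
      have hpi : (π : ℂ) ≠ 0 := by exact_mod_cast pi_ne_zero
      rw [fourier_coe_apply, show 2 * π * Complex.I * n * x / ((2 * π : ℝ) : ℂ)
        = ((n * x : ℝ) : ℂ) * Complex.I by push_cast; field_simp, Complex.exp_mul_I]
      push_cast; ring
    have hb : ∀ t : ℝ → ℝ, Continuous t → (∀ x, |t x| ≤ 1) →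
        Integrable (fun x => u x * t x) circ := fun t ht hb =>
      hu.mul_bdd (c := 1) ht.aestronglyMeasurable (Filter.Eventually.of_forall hb)
    change ∫ x, (u x : ℂ) * fourier n (x : AddCircle (2 * π)) ∂circ = 0
    simp only [e]
    rw [integral_add (hb _ (by fun_prop) fun _ => abs_cos_le_one _).ofReal
      ((hb _ (by fun_prop) fun _ => abs_sin_le_one _).ofReal.mul_const _), integral_mul_const,
      integral_complex_ofReal, integral_complex_ofReal, hcos, hsin]
    simp
  have hspan : Submodule.span ℂ (Set.range (@fourier (2 * π))) ≤ LinearMap.ker L'.toLinearMap := by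
    rw [Submodule.span_le]
    rintro _ ⟨n, rfl⟩
    exact hf n
  have htop := Submodule.topologicalClosure_minimal _ hspan L'.isClosed_ker
  rw [span_fourier_closure_eq_top] at htop
  exact htop (Submodule.mem_top (x := g))

theorem ae_eq_zero_of_integral_trig {u : ℝ → ℝ} (hu : Integrable u circ)
    (hc : ∀ n : ℕ, ∫ x, u x * cos (n * x) ∂circ = 0)
    (hs : ∀ n : ℕ, ∫ x, u x * sin (n * x) ∂circ = 0) : ∀ᵐ x ∂circ, u x = 0 := by
  have : Fact (0 < 2 * π) := ⟨two_pi_pos⟩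
  have hu' : Integrable u (volume.restrict (Set.Ioo (0 : ℝ) (2 * π))) :=
    hu.mono_measure (Measure.restrict_mono Set.Ioo_subset_Ioc_self le_rfl)
  have h := (isOpen_Ioo (a := (0 : ℝ)) (b := 2 * π)).ae_eq_zero_of_integral_contDiff_smul_eq_zero
    (f := u) (μ := volume) (IntegrableOn.locallyIntegrableOn hu') ?_
  · unfold circ
    rw [← restrict_Ioo_eq_restrict_Ioc, ae_restrict_iff' measurableSet_Ioo]
    exact h
  · intro g hg _ hsupp
    have hz : ∀ x, x ∉ Set.Ioo (0 : ℝ) (2 * π) → g x = 0 := fun x hx =>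
      image_eq_zero_of_notMem_tsupport fun h => hx (hsupp h)
    let G : C(AddCircle (2 * π), ℂ) :=
      ⟨AddCircle.liftIco (2 * π) 0 fun x => (g x : ℂ), AddCircle.liftIco_zero_continuous
        (by rw [hz 0 (by simp), hz (2 * π) (by simp)])
        (Complex.continuous_ofReal.comp hg.continuous).continuousOn⟩
    have h0 := integral_mul_circle_eq_zero hu hc hs G
    have e : ∫ x, (u x : ℂ) * G (x : AddCircle (2 * π)) ∂circ
        = ∫ x, ((g x * u x : ℝ) : ℂ) ∂circ := by
      unfold circ
      rw [← restrict_Ioo_eq_restrict_Ioc]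
      refine setIntegral_congr_fun measurableSet_Ioo fun x hx => ?_
      have : G (x : AddCircle (2 * π)) = (g x : ℂ) :=
        AddCircle.liftIco_coe_apply (f := fun x => (g x : ℂ)) (by simpa using ⟨hx.1.le, hx.2⟩)
      simp only [this]
      push_cast; ring
    rw [e, integral_complex_ofReal] at h0
    have h1 : ∫ x, g x * u x ∂circ = 0 := by exact_mod_cast h0
    rw [← h1]
    unfold circ
    simp only [smul_eq_mul]
    refine (setIntegral_eq_integral_of_forall_compl_eq_zero fun x hx => ?_).symm
    rw [hz x fun h => hx (Set.Ioo_subset_Ioc_self h), zero_mul]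

theorem Nice.ae_eq_zero {g : ℝ → ℝ → ℝ} (hg : Nice g)
    (h : ∀ t₁ t₂ : ℝ → ℝ, (∃ n : ℕ, t₁ = (fun x => cos (n * x)) ∨ t₁ = fun x => sin (n * x)) →
      (∃ n : ℕ, t₂ = (fun x => cos (n * x)) ∨ t₂ = fun x => sin (n * x)) → pair g t₁ t₂ = 0) :
    ∀ᵐ x ∂circ, ∀ᵐ y ∂circ, g x y = 0 := by
  have ht : ∀ t : ℝ → ℝ, (∃ n : ℕ, t = (fun x => cos (n * x)) ∨ t = fun x => sin (n * x)) →
      TestFun t := by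
    rintro t ⟨n, rfl | rfl⟩
    exacts [testFun_cos n, testFun_sin n]
  have hone : TestFun fun _ => (1 : ℝ) := ⟨continuous_const, by simp, fun _ => rfl⟩
  have key : ∀ t : ℝ → ℝ, (∃ n : ℕ, t = (fun x => cos (n * x)) ∨ t = fun x => sin (n * x)) →
      ∀ᵐ x ∂circ, ∫ y, g x y * t y ∂circ = 0 := by
    intro t ht'
    have hint : Integrable (fun z : ℝ × ℝ => g z.1 z.2 * t z.2) (circ.prod circ) := by
      simpa [torus] using hg.integrable_mul hone (ht t ht')
    have e : ∀ t₁, (∃ n : ℕ, t₁ = (fun x => cos (n * x)) ∨ t₁ = fun x => sin (n * x)) →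
        ∫ x, (∫ y, g x y * t y ∂circ) * t₁ x ∂circ = 0 := by
      intro t₁ h₁
      have := h t₁ t h₁ ht'
      unfold pair torus at this
      rw [integral_prod _ (hg.integrable_mul (ht t₁ h₁) (ht t ht'))] at this
      rw [← this]
      congr 1; ext x
      rw [← integral_mul_const]
      congr 1; ext y; ring
    exact ae_eq_zero_of_integral_trig hint.integral_prod_left
      (fun n => e _ ⟨n, Or.inl rfl⟩) fun n => e _ ⟨n, Or.inr rfl⟩
  have hgi : Integrable (Function.uncurry g) (circ.prod circ) := hg.int
  filter_upwards [ae_all_iff.2 fun n : ℕ => key _ ⟨n, Or.inl rfl⟩,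
    ae_all_iff.2 fun n : ℕ => key _ ⟨n, Or.inr rfl⟩, hgi.prod_right_ae] with x h1 h2 h3
  exact ae_eq_zero_of_integral_trig h3 h1 h2

/-! ### Double series of Dirichlet kernels -/

/-- The absolute majorant of a double series of Dirichlet kernels. -/
def absDirkSum (d : ℕ → ℕ → ℝ≥0∞) (x y : ℝ) : ℝ≥0∞ :=
  ∑' k, ∑' l, d k l * ENNReal.ofReal |dirk k x| * ENNReal.ofReal |dirk l y|

/-- A double series of Dirichlet kernels. -/
def dirkSum (d : ℕ → ℕ → ℝ≥0∞) (x y : ℝ) : ℝ :=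
  ∑' q : ℕ × ℕ, (d q.1 q.2).toReal * (dirk q.1 x * dirk q.2 y)

theorem exists_lintegral_absDirkSum_le {p : ℝ} (hp : 1 < p) :
    ∃ C ≠ (⊤ : ℝ≥0∞), ∀ d : ℕ → ℕ → ℝ≥0∞, ∫⁻ x, ∫⁻ y, absDirkSum d x y ^ p ∂circ ∂circ
      ≤ C * ∑' i, ∑' j, tailSum d i j ^ p * wt p i * wt p j := by
  have hp0 : 0 < p := by linarith
  obtain ⟨C, hC, hb⟩ := exists_tbound_dker hp
  refine ⟨C * C * (2 * 1 * (2 * 1)) ^ p, ENNReal.mul_ne_top (ENNReal.mul_ne_top hC hC)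
    (ENNReal.rpow_ne_top_of_nonneg hp0.le (by finiteness)), fun d => ?_⟩
  have hG : ∀ k x, ENNReal.ofReal |dirk k x|
      ≤ 2 * 1 * ∑ i ∈ Finset.range (k + 1), (fun _ => 1 : ℕ → ℝ≥0∞) i * dker i x := fun k x => by
    refine (ofReal_abs_dirk_le k x).trans ?_
    have := mul_dker_le_sum (w := fun _ => 1) (c := 1) (k := k) x (by simp)
    rwa [one_mul] at this
  have := lintegral_kernel_sum_le hp hb hb hG hG d
  simpa only [one_mul, absDirkSum] using this

theorem measurable_absDirkSum (d : ℕ → ℕ → ℝ≥0∞) :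
    Measurable (Function.uncurry (absDirkSum d)) := by
  change Measurable fun z : ℝ × ℝ =>
    ∑' k, ∑' l, d k l * ENNReal.ofReal |dirk k z.1| * ENNReal.ofReal |dirk l z.2|
  refine Measurable.tsum fun k => Measurable.tsum fun l => ?_
  have h1 := (continuous_dirk k).measurable
  have h2 := (continuous_dirk l).measurable
  fun_prop

theorem le_one_add_rpow {p : ℝ} (hp : 1 ≤ p) (a : ℝ≥0∞) : a ≤ 1 + a ^ p := by
  rcases le_total a 1 with h | h
  · exact h.trans le_self_add
  · refine le_trans ?_ (self_le_add_left _ _)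
    simpa using ENNReal.rpow_le_rpow_of_exponent_le h hp

theorem lintegral_absDirkSum_ne_top {p : ℝ} (hp : 1 < p) {d : ℕ → ℕ → ℝ≥0∞}
    (hd : ∑' i, ∑' j, tailSum d i j ^ p * wt p i * wt p j ≠ ⊤) :
    ∫⁻ z : ℝ × ℝ, absDirkSum d z.1 z.2 ∂torus ≠ ⊤ := by
  obtain ⟨C, hC, h⟩ := exists_lintegral_absDirkSum_le hp
  have hm : Measurable fun z : ℝ × ℝ => absDirkSum d z.1 z.2 := measurable_absDirkSum d
  refine ne_top_of_le_ne_top ?_ (lintegral_mono fun z => le_one_add_rpow hp.le _)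
  rw [lintegral_add_left measurable_const, lintegral_one]
  refine ENNReal.add_ne_top.2 ⟨measure_ne_top _ _, ?_⟩
  unfold torus
  rw [lintegral_prod _ (hm.pow_const p).aemeasurable]
  exact ne_top_of_le_ne_top (ENNReal.mul_ne_top hC hd) (h d)

theorem enorm_dirkSum_term_le (d : ℕ → ℕ → ℝ≥0∞) (x y : ℝ) (q : ℕ × ℕ) :
    ‖(d q.1 q.2).toReal * (dirk q.1 x * dirk q.2 y)‖ₑ
      ≤ d q.1 q.2 * ENNReal.ofReal |dirk q.1 x| * ENNReal.ofReal |dirk q.2 y| := by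
  rw [enorm_mul, enorm_mul, Real.enorm_eq_ofReal_abs, Real.enorm_eq_ofReal_abs,
    Real.enorm_eq_ofReal_abs, abs_of_nonneg ENNReal.toReal_nonneg, ← mul_assoc]
  gcongr
  exact ENNReal.ofReal_toReal_le

theorem absDirkSum_eq (d : ℕ → ℕ → ℝ≥0∞) (x y : ℝ) : absDirkSum d x y
    = ∑' q : ℕ × ℕ, d q.1 q.2 * ENNReal.ofReal |dirk q.1 x| * ENNReal.ofReal |dirk q.2 y| :=
  (ENNReal.tsum_prod (f := fun k l =>
    d k l * ENNReal.ofReal |dirk k x| * ENNReal.ofReal |dirk l y|)).symm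

theorem enorm_dirkSum_le (d : ℕ → ℕ → ℝ≥0∞) (x y : ℝ) :
    ‖dirkSum d x y‖ₑ ≤ absDirkSum d x y := by
  rw [absDirkSum_eq]
  exact enorm_tsum_le_tsum_enorm.trans (ENNReal.tsum_le_tsum (enorm_dirkSum_term_le d x y))

theorem dirk_add_two_pi (k : ℕ) (x : ℝ) : dirk k (x + 2 * π) = dirk k x := by
  unfold dirk
  refine Finset.sum_congr rfl fun ν _ => ?_
  have := cos_add_nat_mul_two_pi (((ν : ℝ) + 1) * x) (ν + 1)
  rw [← this]; push_cast; congr 1; ring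

theorem measurable_dirkSum (d : ℕ → ℕ → ℝ≥0∞) : Measurable (Function.uncurry (dirkSum d)) := by
  change Measurable fun z : ℝ × ℝ =>
    ∑' q : ℕ × ℕ, (d q.1 q.2).toReal * (dirk q.1 z.1 * dirk q.2 z.2)
  refine Measurable.tsum fun q => ?_
  have h1 := (continuous_dirk q.1).measurable
  have h2 := (continuous_dirk q.2).measurable
  fun_prop

theorem dirkSum_add_fst (d : ℕ → ℕ → ℝ≥0∞) (x y : ℝ) :
    dirkSum d (x + 2 * π) y = dirkSum d x y := by
  simp only [dirkSum, dirk_add_two_pi]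

theorem dirkSum_add_snd (d : ℕ → ℕ → ℝ≥0∞) (x y : ℝ) :
    dirkSum d x (y + 2 * π) = dirkSum d x y := by
  simp only [dirkSum, dirk_add_two_pi]

theorem integrable_dirkSum {p : ℝ} (hp : 1 < p) {d : ℕ → ℕ → ℝ≥0∞}
    (hd : ∑' i, ∑' j, tailSum d i j ^ p * wt p i * wt p j ≠ ⊤) :
    Integrable (Function.uncurry (dirkSum d)) torus := by
  have h : ∫⁻ z : ℝ × ℝ, ‖Function.uncurry (dirkSum d) z‖ₑ ∂torus
      ≤ ∫⁻ z : ℝ × ℝ, absDirkSum d z.1 z.2 ∂torus :=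
    lintegral_mono fun z => enorm_dirkSum_le d z.1 z.2
  exact ⟨(measurable_dirkSum d).aestronglyMeasurable,
    lt_of_le_of_lt h (lintegral_absDirkSum_ne_top hp hd).lt_top⟩

theorem nice_dirkSum {p : ℝ} (hp : 1 < p) {d : ℕ → ℕ → ℝ≥0∞}
    (hd : ∑' i, ∑' j, tailSum d i j ^ p * wt p i * wt p j ≠ ⊤) : Nice (dirkSum d) where
  meas := measurable_dirkSum d
  per_x y x := dirkSum_add_fst d x y
  per_y x y := dirkSum_add_snd d x y
  int := integrable_dirkSum hp hd

theorem pair_dirkSum {p : ℝ} (hp : 1 < p) {d : ℕ → ℕ → ℝ≥0∞}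
    (hd : ∑' i, ∑' j, tailSum d i j ^ p * wt p i * wt p j ≠ ⊤) {φ ψ : ℝ → ℝ} (hφ : TestFun φ)
    (hψ : TestFun ψ) : pair (dirkSum d) φ ψ = ∑' q : ℕ × ℕ, (d q.1 q.2).toReal *
      ((∫ x, dirk q.1 x * φ x ∂circ) * ∫ y, dirk q.2 y * ψ y ∂circ) := by
  set T : ℕ × ℕ → ℝ × ℝ → ℝ := fun q z =>
    (d q.1 q.2).toReal * (dirk q.1 z.1 * dirk q.2 z.2) * (φ z.1 * ψ z.2) with hT
  have hTm : ∀ q, Measurable (T q) := fun q => by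
    have h1 := (continuous_dirk q.1).measurable
    have h2 := (continuous_dirk q.2).measurable
    have h3 := hφ.cont.measurable
    have h4 := hψ.cont.measurable
    fun_prop
  have hle : ∀ q z, ‖T q z‖ₑ ≤ d q.1 q.2 * ENNReal.ofReal |dirk q.1 z.1|
      * ENNReal.ofReal |dirk q.2 z.2| := fun q z => by
    refine le_trans ?_ (enorm_dirkSum_term_le d z.1 z.2 q)
    rw [hT, enorm_mul]
    refine mul_le_of_le_one_right' ?_
    rw [Real.enorm_eq_ofReal_abs, ENNReal.ofReal_le_one, abs_mul]
    exact mul_le_one₀ (hφ.le_one _) (abs_nonneg _) (hψ.le_one _)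
  have hfin : ∑' q, ∫⁻ z, ‖T q z‖ₑ ∂torus ≠ ⊤ := by
    rw [← lintegral_tsum fun q => (hTm q).enorm.aemeasurable]
    refine ne_top_of_le_ne_top (lintegral_absDirkSum_ne_top hp hd) (lintegral_mono fun z => ?_)
    rw [absDirkSum_eq]
    exact ENNReal.tsum_le_tsum fun q => hle q z
  have e : ∀ z : ℝ × ℝ, dirkSum d z.1 z.2 * (φ z.1 * ψ z.2) = ∑' q, T q z := fun z =>
    tsum_mul_right.symm
  unfold pair
  simp only [e]
  rw [integral_tsum (fun q => (hTm q).aestronglyMeasurable) hfin]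
  refine tsum_congr fun q => ?_
  have e2 : ∀ z, T q z = (d q.1 q.2).toReal * ((dirk q.1 z.1 * φ z.1) * (dirk q.2 z.2 * ψ z.2)) :=
    fun z => by simp only [hT]; ring
  simp only [e2]
  rw [integral_const_mul, torus, integral_prod_mul (fun x => dirk q.1 x * φ x)
    fun y => dirk q.2 y * ψ y]

theorem integral_cos_add {N : ℕ} (h : 0 < N) (a : ℝ) : ∫ x, cos (N * x + a) ∂circ = 0 := by
  simpa using integral_cos_mul_cos h 0 a

theorem integral_cos_mul_cosw (n ν : ℕ) (φ : ℝ) :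
    ∫ x, cos (((n : ℝ) + 1) * x) * cosw ν φ x ∂circ = if n = ν then π * cos φ else 0 := by
  unfold cosw
  rcases lt_trichotomy n ν with h | rfl | h
  · rw [if_neg h.ne]
    simpa using integral_cos_mul_cos (Nat.add_lt_add_right h 1) 0 φ
  · rw [if_pos rfl]
    have e : ∀ x, cos (((n : ℝ) + 1) * x) * cos (((n : ℝ) + 1) * x + φ)
        = 1 / 2 * cos (((2 * (n + 1) : ℕ) : ℝ) * x + φ) + 1 / 2 * cos φ := fun x => by
      have h1 := cos_sub_cos (((2 * (n + 1) : ℕ) : ℝ) * x + φ) (π + φ)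
      have h2 := two_mul_cos_mul_cos (((n : ℝ) + 1) * x) (((n : ℝ) + 1) * x + φ)
      rw [show ((n : ℝ) + 1) * x - (((n : ℝ) + 1) * x + φ) = -φ by ring, cos_neg,
        show ((n : ℝ) + 1) * x + (((n : ℝ) + 1) * x + φ) = ((2 * (n + 1) : ℕ) : ℝ) * x + φ by
          push_cast; ring] at h2
      linarith
    simp only [e]
    have hint : Integrable (fun x => cos (((2 * (n + 1) : ℕ) : ℝ) * x + φ)) circ :=
      (Continuous.intervalIntegrable (by fun_prop) 0 (2 * π)).1
    rw [integral_add (hint.const_mul _) (integrable_const _), integral_const_mul,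
      integral_cos_add (by omega)]
    simp [circ, Measure.real, ENNReal.toReal_ofReal pi_pos.le]
    ring
  · rw [if_neg h.ne']
    have := integral_cos_mul_cos (Nat.add_lt_add_right h 1) φ 0
    simp only [mul_comm (cos (((ν + 1 : ℕ) : ℝ) * _ + φ))] at this
    simpa using this

theorem integral_dirk_mul_cosw (k ν : ℕ) (φ : ℝ) :
    ∫ x, dirk k x * cosw ν φ x ∂circ = if ν ≤ k then π * cos φ else 0 := by
  simp only [dirk, Finset.sum_mul]
  have hint : ∀ i : ℕ, Integrable (fun x => cos (((i : ℝ) + 1) * x) * cosw ν φ x) circ := fun i =>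
    (Continuous.intervalIntegrable (by unfold cosw; fun_prop) 0 (2 * π)).1
  rw [integral_finsetSum _ fun i _ => hint i]
  simp only [integral_cos_mul_cosw]
  rw [Finset.sum_ite_eq']
  simp

theorem integral_dirk (k : ℕ) : ∫ x, dirk k x ∂circ = 0 := by
  unfold dirk
  have hint : ∀ i : ℕ, Integrable (fun x => cos (((i : ℝ) + 1) * x)) circ := fun i =>
    (Continuous.intervalIntegrable (by fun_prop) 0 (2 * π)).1
  rw [integral_finsetSum _ fun i _ => hint i]
  refine Finset.sum_eq_zero fun i _ => ?_
  simpa using integral_cos_add (Nat.succ_pos i) 0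

theorem MonoCoef.pair_dirkSum_cosw {p : ℝ} (hp : 1 < p) {z : ℕ → ℕ → ℝ} (hz : MonoCoef z)
    (hd : ∑' i, ∑' j, tailSum (mixedDiff z) i j ^ p * wt p i * wt p j ≠ ⊤) (ν μ : ℕ) (φ ψ : ℝ) :
    pair (dirkSum (mixedDiff z)) (cosw ν φ) (cosw μ ψ) = π ^ 2 * z ν μ * cos φ * cos ψ := by
  rw [pair_dirkSum hp hd (testFun_cosw _ _) (testFun_cosw _ _)]
  have e : ∀ q : ℕ × ℕ, (mixedDiff z q.1 q.2).toReal *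
      ((∫ x, dirk q.1 x * cosw ν φ x ∂circ) * ∫ y, dirk q.2 y * cosw μ ψ y ∂circ)
      = (ind ν q.1 * ind μ q.2 * mixedDiff z q.1 q.2).toReal * (π * cos φ * (π * cos ψ)) := by
    intro q
    rw [integral_dirk_mul_cosw, integral_dirk_mul_cosw]
    unfold ind
    split_ifs <;> simp
  simp only [e]
  rw [tsum_mul_right, ← ENNReal.tsum_toReal_eq, ENNReal.tsum_prod
    (f := fun k l => ind ν k * ind μ l * mixedDiff z k l)]
  · have := hz.tailSum_mixedDiff ν μ
    unfold tailSum at this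
    rw [this, ENNReal.toReal_ofReal (hz.nonneg _ _)]
    ring
  · intro q
    unfold ind mixedDiff
    split_ifs <;> simp

/-- Membership in the relevant class, in terms of pairings with test functions. -/
structure CosSeries (f : ℝ → ℝ → ℝ) (z : ℕ → ℕ → ℝ) : Prop where
  nice : Nice f
  mono : MonoCoef z
  pair_cosw : ∀ ν μ φ ψ, pair f (cosw ν φ) (cosw μ ψ) = π ^ 2 * z ν μ * cos φ * cos ψ
  mean_fst : ∀ ψ, TestFun ψ → pair f (fun _ => 1) ψ = 0
  mean_snd : ∀ φ, TestFun φ → pair f φ (fun _ => 1) = 0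

theorem pair_one_eq_zero {f : ℝ → ℝ → ℝ} (hf : Nice f)
    (h : ∀ᵐ (y : ℝ) ∂volume, (∫ x in (0:ℝ)..(2*π), f x y) = 0) {ψ : ℝ → ℝ} (hψ : TestFun ψ) :
    pair f (fun _ => 1) ψ = 0 := by
  have hone : TestFun fun _ => (1 : ℝ) := ⟨continuous_const, by simp, fun _ => rfl⟩
  unfold pair torus
  rw [integral_prod_symm _ (hf.integrable_mul hone hψ)]
  refine integral_eq_zero_of_ae (ae_restrict_of_ae (h.mono fun y hy => ?_))
  simp only [one_mul, Pi.zero_apply]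
  rw [integral_mul_const, circ, ← intervalIntegral.integral_of_le two_pi_pos.le, hy, zero_mul]

theorem cosSeries_of_inMclass {p : ℝ} (hp : 1 < p) {f : ℝ → ℝ → ℝ} {a : ℕ → ℕ → ℝ}
    (h : InMclass p f a) : CosSeries f fun i j => a (i + 1) (j + 1) where
  nice := MemLp0.nice hp h.1
  mono := monoCoef_of_inMclass hp h
  pair_cosw := pair_cosw_of_inMclass hp h
  mean_fst ψ hψ := pair_one_eq_zero (MemLp0.nice hp h.1) h.1.mean_x hψ
  mean_snd φ hφ := by
    rw [← pair_flip]
    exact pair_one_eq_zero (MemLp0.nice hp h.1).flip h.1.mean_y hφ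

theorem CosSeries.ae_eq_dirkSum {p : ℝ} (hp : 1 < p) {f : ℝ → ℝ → ℝ} {z : ℕ → ℕ → ℝ}
    (h : CosSeries f z)
    (hd : ∑' i, ∑' j, tailSum (mixedDiff z) i j ^ p * wt p i * wt p j ≠ ⊤) :
    ∀ᵐ x ∂circ, ∀ᵐ y ∂circ, f x y = dirkSum (mixedDiff z) x y := by
  have hF := nice_dirkSum hp hd
  have hone : TestFun fun _ => (1 : ℝ) := ⟨continuous_const, by simp, fun _ => rfl⟩
  have ht : ∀ t : ℝ → ℝ, (∃ n : ℕ, t = (fun x => cos (n * x)) ∨ t = fun x => sin (n * x)) →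
      TestFun t := by
    rintro t ⟨n, rfl | rfl⟩
    exacts [testFun_cos n, testFun_sin n]
  have htrig : ∀ t : ℝ → ℝ, (∃ n : ℕ, t = (fun x => cos (n * x)) ∨ t = fun x => sin (n * x)) →
      t = (fun _ => 1) ∨ t = (fun _ => 0) ∨ ∃ ν φ, t = cosw ν φ := by
    rintro t ⟨_ | n, rfl | rfl⟩
    · left; simp
    · right; left; simp
    · right; right; exact ⟨n, 0, by ext x; simp [cosw]⟩
    · right; right
      refine ⟨n, -(π / 2), ?_⟩
      ext x
      rw [cosw, ← sub_eq_add_neg, cos_sub_pi_div_two]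
      push_cast; rfl
  have hpair : ∀ t₁ t₂ : ℝ → ℝ,
      (∃ n : ℕ, t₁ = (fun x => cos (n * x)) ∨ t₁ = fun x => sin (n * x)) →
      (∃ n : ℕ, t₂ = (fun x => cos (n * x)) ∨ t₂ = fun x => sin (n * x)) →
      pair f t₁ t₂ = pair (dirkSum (mixedDiff z)) t₁ t₂ := by
    intro t₁ t₂ h₁ h₂
    have ht₁ := ht t₁ h₁
    have ht₂ := ht t₂ h₂
    rcases htrig t₁ h₁ with rfl | rfl | ⟨ν, φ, rfl⟩
    · rw [h.mean_fst _ ht₂, pair_dirkSum hp hd hone ht₂]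
      simp [integral_dirk]
    · simp [pair]
    · rcases htrig t₂ h₂ with rfl | rfl | ⟨μ, ψ, rfl⟩
      · rw [h.mean_snd _ ht₁, pair_dirkSum hp hd ht₁ hone]
        simp [integral_dirk]
      · simp [pair]
      · rw [h.pair_cosw, h.mono.pair_dirkSum_cosw hp hd]
  have hzero := (h.nice.sub hF).ae_eq_zero fun t₁ t₂ h₁ h₂ => by
    rw [pair_sub h.nice hF (ht t₁ h₁) (ht t₂ h₂), hpair t₁ t₂ h₁ h₂, sub_self]
  filter_upwards [hzero] with x hx
  filter_upwards [hx] with y hy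
  exact sub_eq_zero.1 hy

/-! ### Upper bound for angular approximation -/

/-- A double series of Dirichlet kernels, summed iteratively. -/
def iterSum (d : ℕ → ℕ → ℝ≥0∞) (x y : ℝ) : ℝ :=
  ∑' k, dirk k x * ∑' l, (d k l).toReal * dirk l y

theorem measurable_iterSum (d : ℕ → ℕ → ℝ≥0∞) : Measurable (Function.uncurry (iterSum d)) := by
  change Measurable fun z : ℝ × ℝ => ∑' k, dirk k z.1 * ∑' l, (d k l).toReal * dirk l z.2
  refine Measurable.tsum fun k => ((continuous_dirk k).measurable.comp measurable_fst).mul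
    (Measurable.tsum fun l => ?_)
  have h2 := (continuous_dirk l).measurable
  fun_prop

theorem enorm_iterSum_le (d : ℕ → ℕ → ℝ≥0∞) (x y : ℝ) :
    ‖iterSum d x y‖ₑ ≤ absDirkSum d x y := by
  refine enorm_tsum_le_tsum_enorm.trans (ENNReal.tsum_le_tsum fun k => ?_)
  rw [← tsum_mul_left]
  refine enorm_tsum_le_tsum_enorm.trans (ENNReal.tsum_le_tsum fun l => ?_)
  refine le_trans (le_of_eq ?_) (enorm_dirkSum_term_le d x y (k, l))
  congr 1; ring

theorem summable_dirkSum_term {d : ℕ → ℕ → ℝ≥0∞} {x y : ℝ} (h : absDirkSum d x y ≠ ⊤) :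
    Summable fun q : ℕ × ℕ => (d q.1 q.2).toReal * (dirk q.1 x * dirk q.2 y) := by
  rw [absDirkSum_eq] at h
  exact (tsum_enorm_ne_top_iff_summable_norm.1 (ne_top_of_le_ne_top h
    (ENNReal.tsum_le_tsum (enorm_dirkSum_term_le d x y)))).of_norm

theorem dirkSum_eq_iterSum {d : ℕ → ℕ → ℝ≥0∞} {x y : ℝ} (h : absDirkSum d x y ≠ ⊤) :
    dirkSum d x y = iterSum d x y := by
  unfold dirkSum iterSum
  rw [(summable_dirkSum_term h).tsum_prod]
  refine tsum_congr fun k => ?_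
  rw [← tsum_mul_left]
  exact tsum_congr fun l => by ring

theorem absDirkSum_flip (d : ℕ → ℕ → ℝ≥0∞) (x y : ℝ) :
    absDirkSum (fun k l => d l k) y x = absDirkSum d x y := by
  unfold absDirkSum
  rw [ENNReal.tsum_comm]
  exact tsum_congr fun k => tsum_congr fun l => by ring

theorem dirkSum_flip (d : ℕ → ℕ → ℝ≥0∞) (x y : ℝ) :
    dirkSum (fun k l => d l k) y x = dirkSum d x y := by
  unfold dirkSum
  rw [← (Equiv.prodComm ℕ ℕ).tsum_eq]
  exact tsum_congr fun q => by simp only [Equiv.prodComm_apply, Prod.fst_swap, Prod.snd_swap]; ring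

open Classical in
/-- Restriction of a double sequence to a set of indices. -/
def restr (S : Set (ℕ × ℕ)) (d : ℕ → ℕ → ℝ≥0∞) (k l : ℕ) : ℝ≥0∞ :=
  if (k, l) ∈ S then d k l else 0

theorem restr_le (S : Set (ℕ × ℕ)) (d : ℕ → ℕ → ℝ≥0∞) (k l : ℕ) : restr S d k l ≤ d k l := by
  unfold restr; split_ifs <;> simp

theorem absDirkSum_restr_le (S : Set (ℕ × ℕ)) (d : ℕ → ℕ → ℝ≥0∞) (x y : ℝ) :
    absDirkSum (restr S d) x y ≤ absDirkSum d x y :=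
  ENNReal.tsum_le_tsum fun k => ENNReal.tsum_le_tsum fun l => by
    gcongr; exact restr_le S d k l

theorem dirkSum_eq_restr_add {d : ℕ → ℕ → ℝ≥0∞} {x y : ℝ} (h : absDirkSum d x y ≠ ⊤)
    (S : Set (ℕ × ℕ)) : dirkSum d x y = dirkSum (restr S d) x y + dirkSum (restr Sᶜ d) x y := by
  unfold dirkSum
  rw [← Summable.tsum_add (summable_dirkSum_term (ne_top_of_le_ne_top h
      (absDirkSum_restr_le S d x y))) (summable_dirkSum_term (ne_top_of_le_ne_top h
      (absDirkSum_restr_le Sᶜ d x y)))]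
  refine tsum_congr fun q => ?_
  by_cases hq : q ∈ S <;> simp [restr, hq]

theorem tailSum_restr (d : ℕ → ℕ → ℝ≥0∞) (ν μ i j : ℕ) :
    tailSum (restr {q | ν ≤ q.1 ∧ μ ≤ q.2} d) i j = tailSum d (max i ν) (max j μ) := by
  refine tsum_congr fun k => tsum_congr fun l => ?_
  simp only [ind, restr, Set.mem_ofPred_eq, max_le_iff]
  by_cases h1 : i ≤ k <;> by_cases h2 : j ≤ l <;> by_cases h3 : ν ≤ k <;> by_cases h4 : μ ≤ l <;>
    simp [h1, h2, h3, h4]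

theorem dirk_eq_sum_cos {k n : ℕ} (h : k < n) (x : ℝ) : dirk k x
    = ∑ m ∈ Finset.range (n + 1), (if 1 ≤ m ∧ m ≤ k + 1 then 1 else 0) * cos ((m : ℝ) * x) := by
  rw [Finset.sum_range_succ']
  simp only [ite_mul, one_mul, zero_mul, ← Finset.sum_filter]
  simp only [dirk, Nat.cast_add, Nat.cast_one, nonpos_iff_eq_zero, one_ne_zero, false_and,
    if_false, add_zero]
  refine Finset.sum_congr ?_ fun _ _ => rfl
  ext m
  simp only [Finset.mem_range, Finset.mem_filter]
  omega

theorem lp2Norm_le_of_ae {p : ℝ} (hp : 0 < p) {f : ℝ → ℝ → ℝ} {F : ℝ → ℝ → ℝ≥0∞}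
    (h : ∀ᵐ x ∂circ, ∀ᵐ y ∂circ, ‖f x y‖ₑ ≤ F x y) :
    Lp2Norm p f ^ p ≤ ∫⁻ x, ∫⁻ y, F x y ^ p ∂circ ∂circ := by
  rw [Lp2Norm_rpow hp]
  refine lintegral_mono_ae ?_
  filter_upwards [h] with x hx
  refine lintegral_mono_ae ?_
  filter_upwards [hx] with y hy
  rw [← Real.enorm_eq_ofReal_abs]
  exact ENNReal.rpow_le_rpow hy hp.le

theorem lintegral_absDirkSum_rpow_ne_top {p : ℝ} (hp : 1 < p) {d : ℕ → ℕ → ℝ≥0∞}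
    (hd : ∑' i, ∑' j, tailSum d i j ^ p * wt p i * wt p j ≠ ⊤) :
    ∫⁻ x, ∫⁻ y, absDirkSum d x y ^ p ∂circ ∂circ ≠ ⊤ := by
  obtain ⟨C, hC, h⟩ := exists_lintegral_absDirkSum_le hp
  exact ne_top_of_le_ne_top (ENNReal.mul_ne_top hC hd) (h d)

theorem tailSum_mono {d d' : ℕ → ℕ → ℝ≥0∞} (h : ∀ k l, d k l ≤ d' k l) (i j : ℕ) :
    tailSum d i j ≤ tailSum d' i j :=
  ENNReal.tsum_le_tsum fun k => ENNReal.tsum_le_tsum fun l => mul_le_mul' le_rfl (h k l)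

theorem trigPolyX_iterSum {p : ℝ} (hp : 1 < p) {d : ℕ → ℕ → ℝ≥0∞} {n : ℕ}
    (hd : ∑' i, ∑' j, tailSum d i j ^ p * wt p i * wt p j ≠ ⊤) (hn : ∀ k l, n ≤ k → d k l = 0) :
    TrigPolyX p n (iterSum d) := by
  have hp0 : 0 < p := by linarith
  refine ⟨measurable_iterSum d, ?_, ?_, ?_⟩
  · have h := lp2Norm_le_of_ae hp0 (Filter.Eventually.of_forall fun x =>
      Filter.Eventually.of_forall fun y => enorm_iterSum_le d x y) (f := iterSum d)
    have h2 := ne_top_of_le_ne_top (lintegral_absDirkSum_rpow_ne_top hp hd) h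
    intro ht
    rw [ht, ENNReal.top_rpow_of_pos hp0] at h2
    exact h2 rfl
  · intro x y
    simp only [iterSum, dirk_add_two_pi]
  · refine ⟨fun m y => ∑ k ∈ Finset.range n, (if 1 ≤ m ∧ m ≤ k + 1 then 1 else 0) *
      ∑' l, (d k l).toReal * dirk l y, fun _ _ => 0, fun x y => ?_⟩
    unfold iterSum
    rw [tsum_eq_sum (s := Finset.range n) fun k hk => by
      simp [fun l => hn k l (not_lt.1 fun h => hk (Finset.mem_range.2 h))]]
    simp only [zero_mul, add_zero, Finset.sum_mul]
    rw [Finset.sum_comm]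
    refine Finset.sum_congr rfl fun k hk => ?_
    rw [dirk_eq_sum_cos (Finset.mem_range.1 hk), Finset.sum_mul]
    exact Finset.sum_congr rfl fun m _ => by ring

theorem TrigPolyX.flip {p : ℝ} (hp : 0 < p) {n : ℕ} {T : ℝ → ℝ → ℝ} (h : TrigPolyX p n T) :
    TrigPolyY p n fun x y => T y x := by
  obtain ⟨hm, hn, hper, a, b, hab⟩ := h
  refine ⟨hm.comp measurable_swap, ?_, hper, a, b, fun x y => hab y x⟩
  rwa [lp2Norm_flip hp hm]

theorem tsum_tailSum_flip (p : ℝ) (d : ℕ → ℕ → ℝ≥0∞) :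
    ∑' i, ∑' j, tailSum (fun k l => d l k) i j ^ p * wt p i * wt p j
      = ∑' i, ∑' j, tailSum d i j ^ p * wt p i * wt p j := by
  rw [ENNReal.tsum_comm]
  refine tsum_congr fun i => tsum_congr fun j => ?_
  have : tailSum (fun k l => d l k) j i = tailSum d i j := by
    unfold tailSum
    rw [ENNReal.tsum_comm]
    exact tsum_congr fun k => tsum_congr fun l => by ring
  rw [this]; ring

theorem ae_absDirkSum_ne_top {p : ℝ} (hp : 1 < p) {d : ℕ → ℕ → ℝ≥0∞}
    (hd : ∑' i, ∑' j, tailSum d i j ^ p * wt p i * wt p j ≠ ⊤) :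
    ∀ᵐ x ∂circ, ∀ᵐ y ∂circ, absDirkSum d x y ≠ ⊤ := by
  have h : ∀ᵐ z ∂torus, absDirkSum d z.1 z.2 < ⊤ :=
    ae_lt_top (measurable_absDirkSum d) (lintegral_absDirkSum_ne_top hp hd)
  filter_upwards [Measure.ae_ae_of_ae_prod h] with x hx
  filter_upwards [hx] with y hy using hy.ne

theorem exists_Yapprox_le {p : ℝ} (hp : 1 < p) : ∃ C ≠ (⊤ : ℝ≥0∞),
    ∀ (f : ℝ → ℝ → ℝ) (d : ℕ → ℕ → ℝ≥0∞) (ν μ : ℕ),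
      ∑' i, ∑' j, tailSum d i j ^ p * wt p i * wt p j ≠ ⊤ →
      (∀ᵐ x ∂circ, ∀ᵐ y ∂circ, f x y = dirkSum d x y) →
      Yapprox p ν μ f ^ p
        ≤ C * ∑' i, ∑' j, tailSum d (max i ν) (max j μ) ^ p * wt p i * wt p j := by
  have hp0 : 0 < p := by linarith
  obtain ⟨C, hC, hb⟩ := exists_lintegral_absDirkSum_le hp
  refine ⟨C, hC, fun f d ν μ hd hf => ?_⟩
  have hfin : ∀ S, ∑' i, ∑' j, tailSum (restr S d) i j ^ p * wt p i * wt p j ≠ ⊤ := fun S =>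
    ne_top_of_le_ne_top hd (ENNReal.tsum_le_tsum fun i => ENNReal.tsum_le_tsum fun j => by
      gcongr; exact tailSum_mono (restr_le S d) i j)
  set S₁ : Set (ℕ × ℕ) := {q | q.1 < ν} with hS₁
  set S₂ : Set (ℕ × ℕ) := {q | ν ≤ q.1 ∧ q.2 < μ} with hS₂
  set S₃ : Set (ℕ × ℕ) := {q | ν ≤ q.1 ∧ μ ≤ q.2} with hS₃
  have hT₁ : TrigPolyX p ν (iterSum (restr S₁ d)) :=
    trigPolyX_iterSum hp (hfin S₁) fun k l hk => by simp [restr, hS₁, not_lt.2 hk]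
  have hT₂ : TrigPolyY p μ fun x y => iterSum (fun k l => restr S₂ d l k) y x :=
    TrigPolyX.flip hp0 (trigPolyX_iterSum hp (by rw [tsum_tailSum_flip]; exact hfin S₂)
      fun k l hk => by simp [restr, hS₂, not_lt.2 hk])
  have hY : Yapprox p ν μ f ≤ Lp2Norm p fun x y => f x y - iterSum (restr S₁ d) x y
      - iterSum (fun k l => restr S₂ d l k) y x :=
    (iInf₂_le (iterSum (restr S₁ d)) hT₁).trans (iInf₂_le _ hT₂)
  refine (ENNReal.rpow_le_rpow hY hp0.le).trans ?_
  simp only [← tailSum_restr]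
  refine le_trans (lp2Norm_le_of_ae hp0 ?_) (hb (restr S₃ d))
  filter_upwards [hf, ae_absDirkSum_ne_top hp hd] with x hx hx'
  filter_upwards [hx, hx'] with y hy hy'
  have hle := fun S => ne_top_of_le_ne_top hy' (absDirkSum_restr_le S d x y)
  have h23 : ∀ S, restr S (restr S₁ᶜ d) = restr (S ∩ S₁ᶜ) d := fun S => by
    ext k l
    by_cases h1 : (k, l) ∈ S <;> by_cases h2 : (k, l) ∈ S₁ᶜ <;> simp [restr, h1, h2]
  have e2 : S₂ ∩ S₁ᶜ = S₂ := by
    ext q; simp only [hS₁, hS₂, Set.mem_inter_iff, Set.mem_compl_iff, Set.mem_ofPred_eq]; omega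
  have e3 : S₂ᶜ ∩ S₁ᶜ = S₃ := by
    ext q; simp only [hS₁, hS₂, hS₃, Set.mem_inter_iff, Set.mem_compl_iff, Set.mem_ofPred_eq]; omega
  have e : f x y - iterSum (restr S₁ d) x y - iterSum (fun k l => restr S₂ d l k) y x
      = dirkSum (restr S₃ d) x y := by
    rw [← dirkSum_eq_iterSum (hle S₁), ← dirkSum_eq_iterSum (by rw [absDirkSum_flip]; exact hle S₂),
      dirkSum_flip (restr S₂ d), hy, dirkSum_eq_restr_add hy' S₁, dirkSum_eq_restr_add (hle S₁ᶜ) S₂,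
      h23, h23, e2, e3]
    ring
  rw [e]
  exact enorm_dirkSum_le _ x y

theorem exists_Ysum_le {p α₁ α₂ : ℝ} (hp : 1 < p) (hα₁ : 0 < α₁) (hα₂ : 0 < α₂) :
    ∃ C ≠ (⊤ : ℝ≥0∞), ∀ (f : ℝ → ℝ → ℝ) (z : ℕ → ℕ → ℝ) (n₁ n₂ : ℕ), 1 ≤ n₁ → 1 ≤ n₂ →
      CosSeries f z →
      ∑' i, ∑' j, tailSum (mixedDiff z) i j ^ p * wt p i * wt p j ≠ ⊤ →
      Ysum p α₁ α₂ p n₁ n₂ f ^ p ≤ C * ∑' i, ∑' j,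
        ENNReal.ofReal (z i j * (wgt α₁ n₁ i * wgt α₂ n₂ j)) ^ p * wt p i * wt p j := by
  have hp0 : 0 < p := by linarith
  obtain ⟨C, hC, hY⟩ := exists_Yapprox_le hp
  obtain ⟨C₁, hC₁, h₁⟩ := exists_sum_sumWt_tsum_max_le hp hα₁
  obtain ⟨C₂, hC₂, h₂⟩ := exists_sum_sumWt_tsum_max_le hp hα₂
  refine ⟨C * (C₂ * C₁), by finiteness, fun f z n₁ n₂ hn₁ hn₂ h hd => ?_⟩
  set X : ℕ → ℕ → ℝ≥0∞ := fun i j => ENNReal.ofReal (z i j) ^ p with hX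
  set V : ℝ → ℕ → ℕ → ℝ≥0∞ := fun α n s => ENNReal.ofReal (wgt α n s) ^ p * wt p s with hV
  have hY' : ∀ ν μ, Yapprox p ν μ f ^ p
      ≤ C * ∑' i, ∑' j, X (max i ν) (max j μ) * wt p i * wt p j := fun ν μ => by
    simpa only [h.mono.tailSum_mixedDiff] using
      hY f (mixedDiff z) ν μ hd (h.ae_eq_dirkSum hp hd)
  calc Ysum p α₁ α₂ p n₁ n₂ f ^ p
      ≤ ∑ ν ∈ Finset.range (n₁ + 1), ∑ μ ∈ Finset.range (n₂ + 1),
        sumWt (α₁ * p) n₁ ν * sumWt (α₂ * p) n₂ μ *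
          (C * ∑' i, ∑' j, X (max i ν) (max j μ) * wt p i * wt p j) := by
        rw [Ysum_rpow hp0]
        exact Finset.sum_le_sum fun ν _ => Finset.sum_le_sum fun μ _ =>
          mul_le_mul' le_rfl (hY' ν μ)
    _ = C * ∑ ν ∈ Finset.range (n₁ + 1), sumWt (α₁ * p) n₁ ν * ∑' i,
        (∑ μ ∈ Finset.range (n₂ + 1), sumWt (α₂ * p) n₂ μ * ∑' j, X (max i ν) (max j μ) * wt p j)
          * wt p i := by
        rw [Finset.mul_sum _ _ C]
        refine Finset.sum_congr rfl fun ν _ => ?_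
        simp only [Finset.sum_mul]
        rw [Summable.tsum_finsetSum fun _ _ => ENNReal.summable, Finset.mul_sum, Finset.mul_sum]
        refine Finset.sum_congr rfl fun μ _ => ?_
        simp only [← ENNReal.tsum_mul_left, ← ENNReal.tsum_mul_right]
        exact tsum_congr fun i => tsum_congr fun j => by ring
    _ ≤ C * ∑ ν ∈ Finset.range (n₁ + 1), sumWt (α₁ * p) n₁ ν * ∑' i,
        (C₂ * ∑' t, X (max i ν) t * V α₂ n₂ t) * wt p i := by
        refine mul_le_mul' le_rfl (Finset.sum_le_sum fun ν _ => mul_le_mul' le_rfl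
          (ENNReal.tsum_le_tsum fun i => mul_le_mul' (h₂ n₂ _ hn₂) le_rfl))
    _ ≤ C * (C₁ * ∑' s, (C₂ * ∑' t, X s t * V α₂ n₂ t) * V α₁ n₁ s) :=
        mul_le_mul' le_rfl (h₁ n₁ (fun s => C₂ * ∑' t, X s t * V α₂ n₂ t) hn₁)
    _ = _ := by
        simp only [← ENNReal.tsum_mul_left, ← ENNReal.tsum_mul_right]
        refine tsum_congr fun i => tsum_congr fun j => ?_
        rw [ENNReal.ofReal_mul (h.mono.nonneg i j), ENNReal.ofReal_mul (wgt_pos hn₁ i).le,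
          ENNReal.mul_rpow_of_nonneg _ _ hp0.le, ENNReal.mul_rpow_of_nonneg _ _ hp0.le]
        simp only [hX, hV]
        ring

/-! ### Upper bound for the modulus of smoothness -/

theorem lintegral_torus_shift_shift {G : ℝ → ℝ → ℝ≥0∞} (hG : Measurable (Function.uncurry G))
    (hx : ∀ x y, G (x + 2 * π) y = G x y) (hy : ∀ x y, G x (y + 2 * π) = G x y) (s t : ℝ) :
    ∫⁻ z : ℝ × ℝ, G (z.1 + s) (z.2 + t) ∂torus = ∫⁻ z : ℝ × ℝ, G z.1 z.2 ∂torus := by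
  have hG' : Measurable fun z : ℝ × ℝ => G (z.1 + s) (z.2 + t) :=
    hG.comp (f := fun z : ℝ × ℝ => (z.1 + s, z.2 + t)) (by fun_prop)
  have hG₀ : Measurable fun z : ℝ × ℝ => G z.1 z.2 := hG
  unfold torus
  rw [lintegral_prod _ hG'.aemeasurable, lintegral_prod _ hG₀.aemeasurable]
  have h1 : ∀ x, ∫⁻ y, G (x + s) (y + t) ∂circ = ∫⁻ y, G (x + s) y ∂circ := fun x =>
    lintegral_circ_shift (F := G (x + s)) (fun y => hy _ y) t
  simp only [h1]
  exact lintegral_circ_shift (F := fun x => ∫⁻ y, G x y ∂circ) (fun x => by simp only [hx]) s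

theorem Nice.ae_eq_shift {f g : ℝ → ℝ → ℝ} (hf : Nice f) (hg : Nice g)
    (h : ∀ᵐ x ∂circ, ∀ᵐ y ∂circ, f x y = g x y) (s t : ℝ) :
    ∀ᵐ z : ℝ × ℝ ∂torus, f (z.1 + s) (z.2 + t) = g (z.1 + s) (z.2 + t) := by
  have hm : Measurable (Function.uncurry fun x y => ‖f x y - g x y‖ₑ) := (hf.meas.sub hg.meas).enorm
  have hm₀ : Measurable fun z : ℝ × ℝ => ‖f z.1 z.2 - g z.1 z.2‖ₑ := hm
  have h0 : ∫⁻ z : ℝ × ℝ, ‖f z.1 z.2 - g z.1 z.2‖ₑ ∂torus = 0 := by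
    unfold torus
    rw [lintegral_prod _ hm₀.aemeasurable]
    have : ∀ᵐ x ∂circ, ∫⁻ y, ‖f x y - g x y‖ₑ ∂circ = 0 := by
      filter_upwards [h] with x hx
      rw [lintegral_congr_ae (g := fun _ => 0), lintegral_zero]
      filter_upwards [hx] with y hy
      simp [hy]
    rw [lintegral_congr_ae this, lintegral_zero]
  rw [← lintegral_torus_shift_shift hm (fun x y => by
      have h1 := hf.per_x y x
      have h2 := hg.per_x y x
      simp only at h1 h2
      rw [h1, h2]) (fun x y => by rw [hf.per_y x y, hg.per_y x y]) s t] at h0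
  have hm' : Measurable fun z : ℝ × ℝ =>
      ‖f (z.1 + s) (z.2 + t) - g (z.1 + s) (z.2 + t)‖ₑ :=
    hm.comp (f := fun z : ℝ × ℝ => (z.1 + s, z.2 + t)) (by fun_prop)
  filter_upwards [(lintegral_eq_zero_iff hm').1 h0] with z hz
  exact sub_eq_zero.1 (enorm_eq_zero.1 hz)

theorem absDirkSum_add_fst (d : ℕ → ℕ → ℝ≥0∞) (x y : ℝ) :
    absDirkSum d (x + 2 * π) y = absDirkSum d x y := by
  simp only [absDirkSum, dirk_add_two_pi]

theorem absDirkSum_add_snd (d : ℕ → ℕ → ℝ≥0∞) (x y : ℝ) :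
    absDirkSum d x (y + 2 * π) = absDirkSum d x y := by
  simp only [absDirkSum, dirk_add_two_pi]

/-- The average of shifts of `absDirkSum` that majorises a mixed difference. -/
def shiftMaj (α₁ α₂ h₁ h₂ : ℝ) (d : ℕ → ℕ → ℝ≥0∞) (x y : ℝ) : ℝ≥0∞ :=
  ∑' q : ℕ × ℕ, ‖dcoef α₁ q.1 * dcoef α₂ q.2‖ₑ *
    absDirkSum d (x + (α₁ - q.1) * h₁) (y + (α₂ - q.2) * h₂)

theorem ae_shiftMaj_ne_top {p α₁ α₂ : ℝ} (hp : 1 < p) (hα₁ : 0 < α₁) (hα₂ : 0 < α₂)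
    (h₁ h₂ : ℝ) {d : ℕ → ℕ → ℝ≥0∞}
    (hd : ∑' i, ∑' j, tailSum d i j ^ p * wt p i * wt p j ≠ ⊤) :
    ∀ᵐ z : ℝ × ℝ ∂torus, shiftMaj α₁ α₂ h₁ h₂ d z.1 z.2 ≠ ⊤ := by
  have hm : ∀ q : ℕ × ℕ, Measurable fun z : ℝ × ℝ => ‖dcoef α₁ q.1 * dcoef α₂ q.2‖ₑ *
      absDirkSum d (z.1 + (α₁ - q.1) * h₁) (z.2 + (α₂ - q.2) * h₂) := fun q =>
    ((measurable_absDirkSum d).comp (f := fun z : ℝ × ℝ =>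
      (z.1 + (α₁ - q.1) * h₁, z.2 + (α₂ - q.2) * h₂)) (by fun_prop)).const_mul _
  have hs : ∑' q : ℕ × ℕ, ‖dcoef α₁ q.1 * dcoef α₂ q.2‖ₑ ≠ ⊤ := by
    have := (summable_abs_dcoef hα₁).mul_of_nonneg (summable_abs_dcoef hα₂)
      (fun _ => abs_nonneg _) (fun _ => abs_nonneg _)
    refine tsum_enorm_ne_top_iff_summable_norm.2 ?_
    simpa only [norm_mul, norm_eq_abs] using this
  have hfin : ∫⁻ z : ℝ × ℝ, shiftMaj α₁ α₂ h₁ h₂ d z.1 z.2 ∂torus ≠ ⊤ := by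
    unfold shiftMaj
    rw [lintegral_tsum fun q => (hm q).aemeasurable]
    have e : ∀ q : ℕ × ℕ, ∫⁻ z : ℝ × ℝ, ‖dcoef α₁ q.1 * dcoef α₂ q.2‖ₑ *
        absDirkSum d (z.1 + (α₁ - q.1) * h₁) (z.2 + (α₂ - q.2) * h₂) ∂torus
        = ‖dcoef α₁ q.1 * dcoef α₂ q.2‖ₑ * ∫⁻ z : ℝ × ℝ, absDirkSum d z.1 z.2 ∂torus :=
      fun q => by
        rw [lintegral_const_mul' _ _ enorm_ne_top, lintegral_torus_shift_shift
          (measurable_absDirkSum d) (absDirkSum_add_fst d) (absDirkSum_add_snd d)]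
    simp only [e]
    rw [ENNReal.tsum_mul_right]
    exact ENNReal.mul_ne_top hs (lintegral_absDirkSum_ne_top hp hd)
  filter_upwards [ae_lt_top (Measurable.tsum hm) hfin] with z hz using hz.ne

/-- The double series of differences of Dirichlet kernels, in absolute values. -/
def absDiffSum (α₁ α₂ h₁ h₂ : ℝ) (d : ℕ → ℕ → ℝ≥0∞) (x y : ℝ) : ℝ≥0∞ :=
  ∑' k, ∑' l, d k l * ENNReal.ofReal |diffDirk α₁ h₁ k x| * ENNReal.ofReal |diffDirk α₂ h₂ l y|

theorem tsum_dcoef_mul_dirk_mul_dirk {α₁ α₂ : ℝ} (hα₁ : 0 < α₁) (hα₂ : 0 < α₂) (h₁ h₂ : ℝ)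
    (k l : ℕ) (x y c : ℝ) : ∑' q : ℕ × ℕ, dcoef α₁ q.1 * dcoef α₂ q.2 *
      (c * (dirk k (x + (α₁ - q.1) * h₁) * dirk l (y + (α₂ - q.2) * h₂)))
      = c * (diffDirk α₁ h₁ k x * diffDirk α₂ h₂ l y) := by
  have s1 := summable_dcoef_mul hα₁ (v := fun j => dirk k (x + (α₁ - j) * h₁))
    fun j => abs_dirk_le _ _
  have s2 := summable_dcoef_mul hα₂ (v := fun j => dirk l (y + (α₂ - j) * h₂))
    fun j => abs_dirk_le _ _
  unfold diffDirk
  rw [tsum_mul_tsum_of_summable_norm s1.norm s2.norm, ← tsum_mul_left]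
  exact tsum_congr fun q => by ring

/-- The terms of the mixed difference of `dirkSum`. -/
def diffTerm (α₁ α₂ h₁ h₂ : ℝ) (d : ℕ → ℕ → ℝ≥0∞) (x y : ℝ) (q r : ℕ × ℕ) : ℝ :=
  dcoef α₁ q.1 * dcoef α₂ q.2 * ((d r.1 r.2).toReal *
    (dirk r.1 (x + (α₁ - q.1) * h₁) * dirk r.2 (y + (α₂ - q.2) * h₂)))

theorem summable_diffTerm {α₁ α₂ h₁ h₂ : ℝ} {d : ℕ → ℕ → ℝ≥0∞} {x y : ℝ}
    (h : shiftMaj α₁ α₂ h₁ h₂ d x y ≠ ⊤) :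
    Summable fun r : (ℕ × ℕ) × (ℕ × ℕ) => diffTerm α₁ α₂ h₁ h₂ d x y r.1 r.2 := by
  refine (tsum_enorm_ne_top_iff_summable_norm.1 (ne_top_of_le_ne_top h ?_)).of_norm
  rw [ENNReal.tsum_prod (f := fun q r => ‖diffTerm α₁ α₂ h₁ h₂ d x y q r‖ₑ)]
  refine ENNReal.tsum_le_tsum fun q => ?_
  rw [absDirkSum_eq, ← ENNReal.tsum_mul_left]
  refine ENNReal.tsum_le_tsum fun r => ?_
  rw [diffTerm, enorm_mul]
  exact mul_le_mul' le_rfl (enorm_dirkSum_term_le d _ _ r)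

theorem diffX_diffY_dirkSum {α₁ α₂ : ℝ} (hα₁ : 0 < α₁) (hα₂ : 0 < α₂) {h₁ h₂ : ℝ}
    {d : ℕ → ℕ → ℝ≥0∞} {x y : ℝ} (h : shiftMaj α₁ α₂ h₁ h₂ d x y ≠ ⊤) :
    diffX α₁ h₁ (diffY α₂ h₂ (dirkSum d)) x y = ∑' r : ℕ × ℕ,
      (d r.1 r.2).toReal * (diffDirk α₁ h₁ r.1 x * diffDirk α₂ h₂ r.2 y) := by
  have hsum := summable_diffTerm h
  have e1 : diffX α₁ h₁ (diffY α₂ h₂ (dirkSum d)) x y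
      = ∑' q, ∑' r, diffTerm α₁ α₂ h₁ h₂ d x y q r := by
    rw [Summable.tsum_prod (f := fun q => ∑' r, diffTerm α₁ α₂ h₁ h₂ d x y q r) hsum.prod, diffX_eq]
    refine tsum_congr fun i => ?_
    rw [diffY_eq]
    simp only [diffX_eq]
    rw [← tsum_mul_left]
    refine tsum_congr fun j => ?_
    simp only [diffTerm, dirkSum]
    rw [tsum_mul_left, mul_assoc]
  rw [e1, ← Summable.tsum_comm (f := diffTerm α₁ α₂ h₁ h₂ d x y) hsum]
  exact tsum_congr fun r => tsum_dcoef_mul_dirk_mul_dirk hα₁ hα₂ h₁ h₂ r.1 r.2 x y _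

theorem enorm_diffX_diffY_dirkSum_le {α₁ α₂ : ℝ} (hα₁ : 0 < α₁) (hα₂ : 0 < α₂) (h₁ h₂ : ℝ)
    {d : ℕ → ℕ → ℝ≥0∞} {x y : ℝ} (h : shiftMaj α₁ α₂ h₁ h₂ d x y ≠ ⊤) :
    ‖diffX α₁ h₁ (diffY α₂ h₂ (dirkSum d)) x y‖ₑ ≤ absDiffSum α₁ α₂ h₁ h₂ d x y := by
  rw [diffX_diffY_dirkSum hα₁ hα₂ h]
  refine enorm_tsum_le_tsum_enorm.trans ?_
  unfold absDiffSum
  rw [← ENNReal.tsum_prod (f := fun k l => d k l * ENNReal.ofReal |diffDirk α₁ h₁ k x|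
    * ENNReal.ofReal |diffDirk α₂ h₂ l y|)]
  refine ENNReal.tsum_le_tsum fun r => ?_
  rw [enorm_mul, enorm_mul, Real.enorm_eq_ofReal_abs, Real.enorm_eq_ofReal_abs,
    Real.enorm_eq_ofReal_abs, abs_of_nonneg ENNReal.toReal_nonneg, ← mul_assoc]
  gcongr
  exact ENNReal.ofReal_toReal_le

theorem ae_enorm_diffX_diffY_le {p α₁ α₂ : ℝ} (hp : 1 < p) (hα₁ : 0 < α₁) (hα₂ : 0 < α₂)
    (h₁ h₂ : ℝ) {f : ℝ → ℝ → ℝ} {d : ℕ → ℕ → ℝ≥0∞} (hf : Nice f)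
    (hd : ∑' i, ∑' j, tailSum d i j ^ p * wt p i * wt p j ≠ ⊤)
    (h : ∀ᵐ x ∂circ, ∀ᵐ y ∂circ, f x y = dirkSum d x y) :
    ∀ᵐ x ∂circ, ∀ᵐ y ∂circ, ‖diffX α₁ h₁ (diffY α₂ h₂ f) x y‖ₑ
      ≤ absDiffSum α₁ α₂ h₁ h₂ d x y := by
  have hsh : ∀ᵐ z : ℝ × ℝ ∂torus, ∀ i j : ℕ,
      f (z.1 + (α₁ - i) * h₁) (z.2 + (α₂ - j) * h₂)
        = dirkSum d (z.1 + (α₁ - i) * h₁) (z.2 + (α₂ - j) * h₂) :=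
    ae_all_iff.2 fun i => ae_all_iff.2 fun j =>
      hf.ae_eq_shift (nice_dirkSum hp hd) h _ _
  have key : ∀ᵐ z : ℝ × ℝ ∂torus, ‖diffX α₁ h₁ (diffY α₂ h₂ f) z.1 z.2‖ₑ
      ≤ absDiffSum α₁ α₂ h₁ h₂ d z.1 z.2 := by
    filter_upwards [hsh, ae_shiftMaj_ne_top hp hα₁ hα₂ h₁ h₂ hd] with z hz hz'
    have e : diffX α₁ h₁ (diffY α₂ h₂ f) z.1 z.2
        = diffX α₁ h₁ (diffY α₂ h₂ (dirkSum d)) z.1 z.2 := by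
      simp only [diffX_eq, diffY_eq, hz]
    rw [e]
    exact enorm_diffX_diffY_dirkSum_le hα₁ hα₂ h₁ h₂ hz'
  exact Measure.ae_ae_of_ae_prod key

theorem exists_mixedMod_le {p α₁ α₂ : ℝ} (hp : 1 < p) (hα₁ : 0 < α₁) (hα₂ : 0 < α₂) :
    ∃ C ≠ (⊤ : ℝ≥0∞), ∀ (f : ℝ → ℝ → ℝ) (z : ℕ → ℕ → ℝ) (n₁ n₂ : ℕ), 1 ≤ n₁ → 1 ≤ n₂ →
      CosSeries f z →
      ∑' i, ∑' j, tailSum (mixedDiff z) i j ^ p * wt p i * wt p j ≠ ⊤ →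
      mixedMod p α₁ α₂ (1 / (n₁ : ℝ)) (1 / (n₂ : ℝ)) f ^ p ≤ C * ∑' i, ∑' j,
        ENNReal.ofReal (z i j * (wgt α₁ n₁ i * wgt α₂ n₂ j)) ^ p * wt p i * wt p j := by
  have hp0 : 0 < p := by linarith
  obtain ⟨C₁, hC₁, hb₁⟩ := exists_tbound_diffKer hp hα₁
  obtain ⟨C₂, hC₂, hb₂⟩ := exists_tbound_diffKer hp hα₂
  set A : ℝ → ℝ≥0∞ := fun α => 4 * ENNReal.ofReal (2 ^ α) with hA
  have hAt : A α₁ * A α₂ ≠ ⊤ := by finiteness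
  refine ⟨C₁ * C₂ * (A α₁ * A α₂) ^ p, ENNReal.mul_ne_top (ENNReal.mul_ne_top hC₁ hC₂)
    (ENNReal.rpow_ne_top_of_nonneg hp0.le hAt), fun f z n₁ n₂ hn₁ hn₂ h hd => ?_⟩
  rw [← ENNReal.le_rpow_inv_iff hp0]
  refine iSup₂_le fun h₁ hh₁ => iSup₂_le fun h₂ hh₂ => ?_
  rw [ENNReal.le_rpow_inv_iff hp0]
  refine (lp2Norm_le_of_ae hp0 (ae_enorm_diffX_diffY_le hp hα₁ hα₂ h₁ h₂ h.nice hd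
    (h.ae_eq_dirkSum hp hd))).trans ?_
  refine (lintegral_kernel_sum_le hp (hb₁ h₁) (hb₂ h₂) (ofReal_abs_diffDirk_le_sum hα₁ hn₁ hh₁)
    (ofReal_abs_diffDirk_le_sum hα₂ hn₂ hh₂) (mixedDiff z)).trans (le_of_eq ?_)
  congr 1
  refine tsum_congr fun i => tsum_congr fun j => ?_
  rw [h.mono.tailSum_mixedDiff, ENNReal.ofReal_mul (h.mono.nonneg i j),
    ENNReal.ofReal_mul (wgt_pos hn₁ i).le, mul_comm (ENNReal.ofReal (z i j))]

theorem exists_equivalence {p α₁ α₂ : ℝ} (hp : 1 < p) (hα₁ : 0 < α₁) (hα₂ : 0 < α₂) :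
    ∃ C ≠ (⊤ : ℝ≥0∞), ∀ (f : ℝ → ℝ → ℝ) (a : ℕ → ℕ → ℝ) (n₁ n₂ : ℕ), 1 ≤ n₁ → 1 ≤ n₂ →
      InMclass p f a →
      mixedMod p α₁ α₂ (1 / (n₁ : ℝ)) (1 / (n₂ : ℝ)) f ^ p ≤ C * Ysum p α₁ α₂ p n₁ n₂ f ^ p ∧
      Ysum p α₁ α₂ p n₁ n₂ f ^ p
        ≤ C * mixedMod p α₁ α₂ (1 / (n₁ : ℝ)) (1 / (n₂ : ℝ)) f ^ p := by
  obtain ⟨C₀, hC₀, h₀⟩ := exists_sum_le_Lp2Norm hp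
  obtain ⟨C₁, hC₁, h₁⟩ := exists_weighted_sum_le_mixedMod hp hα₁ hα₂
  obtain ⟨C₂, hC₂, h₂⟩ := exists_weighted_sum_le_Ysum hp hα₁ hα₂
  obtain ⟨C₃, hC₃, h₃⟩ := exists_Ysum_le hp hα₁ hα₂
  obtain ⟨C₄, hC₄, h₄⟩ := exists_mixedMod_le hp hα₁ hα₂
  refine ⟨C₄ * C₂ + C₃ * C₁, by finiteness, fun f a n₁ n₂ hn₁ hn₂ h => ?_⟩
  have hs := cosSeries_of_inMclass hp h
  have hd : ∑' i, ∑' j, tailSum (mixedDiff fun i j => a (i + 1) (j + 1)) i j ^ p * wt p i * wt p j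
      ≠ ⊤ := by
    simp only [hs.mono.tailSum_mixedDiff]
    exact ne_top_of_le_ne_top (ENNReal.mul_ne_top hC₀ (ENNReal.rpow_ne_top_of_nonneg
      (by linarith) h.1.norm_ne_top)) (h₀ f _ hs.nice hs.mono hs.pair_cosw)
  constructor
  · refine (h₄ f _ n₁ n₂ hn₁ hn₂ hs hd).trans ((mul_le_mul' le_rfl
      (h₂ f _ n₁ n₂ hn₁ hn₂ hs.nice hs.mono hs.pair_cosw)).trans ?_)
    rw [← mul_assoc]
    exact mul_le_mul' le_self_add le_rfl
  · refine (h₃ f _ n₁ n₂ hn₁ hn₂ hs hd).trans ((mul_le_mul' le_rfl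
      (h₁ f _ n₁ n₂ hn₁ hn₂ hs.nice hs.mono hs.pair_cosw)).trans ?_)
    rw [← mul_assoc]
    exact mul_le_mul' le_add_self le_rfl

theorem le_ofReal_mul_of_rpow_le {p : ℝ} (hp : 0 < p) {C x y : ℝ≥0∞} (hC : C ≠ ⊤)
    (h : x ^ p ≤ C * y ^ p) : x ≤ ENNReal.ofReal ((C ^ p⁻¹).toReal + 1) * y := by
  have h1 := ENNReal.rpow_le_rpow h (inv_pos.2 hp).le
  rw [ENNReal.mul_rpow_of_nonneg _ _ (inv_pos.2 hp).le, ENNReal.rpow_rpow_inv hp.ne',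
    ENNReal.rpow_rpow_inv hp.ne'] at h1
  refine h1.trans (mul_le_mul' ?_ le_rfl)
  rw [← ENNReal.ofReal_toReal (ENNReal.rpow_ne_top_of_nonneg (inv_pos.2 hp).le hC)]
  refine ENNReal.ofReal_le_ofReal ?_
  rw [ENNReal.toReal_ofReal ENNReal.toReal_nonneg]
  linarith

end MixedModulus

/-- For `f ∈ M_p`, the mixed modulus of smoothness is equivalent to the weighted
sum (with exponent `p`) of angular approximations (Theorem 9.2). -/
theorem modulus_vs_angular_Mclass (p α₁ α₂ : ℝ) (hp : 1 < p)
    (hα₁ : 0 < α₁) (hα₂ : 0 < α₂) :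
    ∃ C : ℝ, 0 < C ∧ ∀ (f : ℝ → ℝ → ℝ) (a : ℕ → ℕ → ℝ) (n₁ n₂ : ℕ),
      1 ≤ n₁ → 1 ≤ n₂ → InMclass p f a →
      mixedMod p α₁ α₂ (1/(n₁:ℝ)) (1/(n₂:ℝ)) f ≤
          ENNReal.ofReal C * Ysum p α₁ α₂ p n₁ n₂ f ∧
      Ysum p α₁ α₂ p n₁ n₂ f ≤
          ENNReal.ofReal C * mixedMod p α₁ α₂ (1/(n₁:ℝ)) (1/(n₂:ℝ)) f := by
  obtain ⟨C, hC, h⟩ := MixedModulus.exists_equivalence hp hα₁ hα₂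
  have hp0 : 0 < p := by linarith
  refine ⟨(C ^ p⁻¹).toReal + 1, by positivity, fun f a n₁ n₂ hn₁ hn₂ hf => ?_⟩
  obtain ⟨h₁, h₂⟩ := h f a n₁ n₂ hn₁ hn₂ hf
  exact ⟨MixedModulus.le_ofReal_mul_of_rpow_le hp0 hC h₁,
    MixedModulus.le_ofReal_mul_of_rpow_le hp0 hC h₂⟩

end
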